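/- Let Δ denote either exterior algebraic shifting or symmetric algebraic shifting, and let Σ be a (d−1)-dimensional pure shifted simplicial complex on [n] satisfying h_i(Σ) = h_{d−i}(Σ) for i = 0,1,…,d and Σ ⊆ Δ^s(C(n,d)). Then there exists a squeezed (d−1)-sphere Γ such that Δ(Γ) = Σ. -/

import Mathlib

/-! Combinatorics of simplicial complexes on subsets of ℕ (vertex set `[n] = Finset.Icc 1 n`). -/

/-- `Γ` is a simplicial complex on the vertex set `V`. -/
def SimplicialComplexOn (V : Finset ℕ) (Γ : Set (Finset ℕ)) : Prop :=
  (∀ F ∈ Γ, F ⊆ V) ∧ (∀ v ∈ V, ({v} : Finset ℕ) ∈ Γ) ∧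
    (∀ F ∈ Γ, ∀ G, G ⊆ F → G ∈ Γ)

/-- The dimension of a simplicial complex, as an integer (`dim Γ = max {|F| - 1 : F ∈ Γ}`). -/
noncomputable def sdim (Γ : Set (Finset ℕ)) : ℤ :=
  sSup ((fun F : Finset ℕ => (F.card : ℤ) - 1) '' Γ)

/-- A facet of `Γ` is a maximal face. -/
def IsFacet (Γ : Set (Finset ℕ)) (F : Finset ℕ) : Prop :=
  F ∈ Γ ∧ ∀ G ∈ Γ, F ⊆ G → F = G

/-- A complex is pure if all of its facets have the same cardinality. -/
def PureComplex (Γ : Set (Finset ℕ)) : Prop :=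
  ∀ F G, IsFacet Γ F → IsFacet Γ G → F.card = G.card

/-- `fvec Γ k` is the number of faces of `Γ` of cardinality `k`, i.e. `f_{k-1}(Γ)`. -/
noncomputable def fvec (Γ : Set (Finset ℕ)) (k : ℕ) : ℕ :=
  {F ∈ Γ | F.card = k}.ncard

/-- The `h`-vector of a `(d-1)`-dimensional complex:
`h_i = ∑_{j=0}^i (-1)^{i-j} binom(d-j, d-i) f_{j-1}`. -/
noncomputable def hvec (d : ℕ) (Γ : Set (Finset ℕ)) (i : ℕ) : ℤ :=
  ∑ j ∈ Finset.range (i + 1),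
    (-1 : ℤ) ^ (i - j) * (Nat.choose (d - j) (d - i) : ℤ) * (fvec Γ j : ℤ)

/-- The link of `Γ` with respect to a face `F`. -/
def linkOf (Γ : Set (Finset ℕ)) (F : Finset ℕ) : Set (Finset ℕ) :=
  {G | Disjoint G F ∧ G ∪ F ∈ Γ}

/-- The contraction of `Γ` with respect to `{i,j}`, identifying vertex `i` with `j`. -/
def contraction (Γ : Set (Finset ℕ)) (i j : ℕ) : Set (Finset ℕ) :=
  {F | F ∈ Γ ∧ i ∉ F} ∪ {G | ∃ F ∈ Γ, i ∈ F ∧ G = F.erase i ∪ {j}}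

/-- The Link condition: `lk_Γ({i}) ∩ lk_Γ({j}) = lk_Γ({i,j})`. -/
def LinkCondition (Γ : Set (Finset ℕ)) (i j : ℕ) : Prop :=
  linkOf Γ {i} ∩ linkOf Γ {j} = linkOf Γ {i, j}

open Classical in
/-- The shift operator `C_{ij}` on faces. -/
noncomputable def shiftMap (Γ : Set (Finset ℕ)) (i j : ℕ) (F : Finset ℕ) : Finset ℕ :=
  if i ∈ F ∧ j ∉ F ∧ F.erase i ∪ {j} ∉ Γ then F.erase i ∪ {j} else F

/-- `Shift_{ij}(Γ) = {C_{ij}(F) : F ∈ Γ}`. -/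
noncomputable def shiftComplex (Γ : Set (Finset ℕ)) (i j : ℕ) : Set (Finset ℕ) :=
  (shiftMap Γ i j) '' Γ

/-- The join `W * Σ = {F ∪ G : F ⊆ W, G ∈ Σ}` of a vertex set with a complex. -/
def joinW (W : Finset ℕ) (C : Set (Finset ℕ)) : Set (Finset ℕ) :=
  {H | ∃ F ⊆ W, ∃ G ∈ C, H = F ∪ G}

/-- Strong edge decomposability: boundaries of simplices and `{∅}` are strongly edge
decomposable, and recursively, a pure complex satisfying the Link condition w.r.t. an edge
`{i,j}` whose contraction and link are strongly edge decomposable is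
strongly edge decomposable. -/
inductive StronglyEdgeDecomposable : Set (Finset ℕ) → Prop
  | trivialComplex : StronglyEdgeDecomposable {(∅ : Finset ℕ)}
  | simplexBoundary (V : Finset ℕ) (hV : V.Nonempty) :
      StronglyEdgeDecomposable {F | F ⊆ V ∧ F ≠ V}
  | contract (Γ : Set (Finset ℕ)) (i j : ℕ) (hij : i < j)
      (hpure : PureComplex Γ) (hedge : ({i, j} : Finset ℕ) ∈ Γ)
      (hlc : LinkCondition Γ i j)
      (hcon : StronglyEdgeDecomposable (contraction Γ i j))
      (hlk : StronglyEdgeDecomposable (linkOf Γ {i, j})) :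
      StronglyEdgeDecomposable Γ

/-- A shifted complex: `F ∈ Γ`, `i ∈ F`, `i < j`, `j ∈ V` imply `(F \ {i}) ∪ {j} ∈ Γ`. -/
def ShiftedComplex (V : Finset ℕ) (Γ : Set (Finset ℕ)) : Prop :=
  ∀ F ∈ Γ, ∀ i ∈ F, ∀ j, i < j → j ∈ V → insert j (F.erase i) ∈ Γ

/-- A `d`-subset `F ⊆ [n]` is admissible if `n - k ∉ F` implies `[n-d+k, n-k-1] ⊆ F`. -/
def Admissible (n d : ℕ) (F : Finset ℕ) : Prop :=
  F ⊆ Finset.Icc 1 n ∧ F.card = d ∧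
    ∀ k < n, (n - k) ∉ F → Finset.Icc (n - d + k) (n - k - 1) ⊆ F

/-- `Δ(n,d)`, the complex generated by all admissible `d`-subsets of `[n]`; by a theorem of
Kalai this is the symmetric algebraic shifted complex `Δˢ(C(n,d))` of the boundary complex of
the cyclic `d`-polytope with `n` vertices. -/
def DeltaC (n d : ℕ) : Set (Finset ℕ) :=
  if d = 0 then {(∅ : Finset ℕ)} else {G | ∃ F, Admissible n d F ∧ G ⊆ F}

/-- The increasing enumeration of `V`, as a map `{1, …, |V|} → V ⊆ ℕ` (identity elsewhere). -/
noncomputable def vlabel (V : Finset ℕ) (i : ℕ) : ℕ :=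
  if h : i - 1 < V.card then (((V.orderIsoOfFin rfl) ⟨i - 1, h⟩ : V) : ℕ) else i

/-- `Δ(V,d)`: the complex `Δ(|V|,d)` relabeled order-isomorphically onto the vertex set `V`. -/
noncomputable def DeltaV (V : Finset ℕ) (d : ℕ) : Set (Finset ℕ) :=
  (fun G : Finset ℕ => G.image (vlabel V)) '' DeltaC V.card d
/-! Squeezed balls and spheres (Kalai). Monomials on `[m]` are represented as multisets. -/

/-- `U` is a shifted order ideal of monomials on `[m]`: it contains `1` and all variables
`x_1,…,x_m`, is closed under divisibility, and `u·x_i ∈ U`, `i < j ≤ m` imply `u·x_j ∈ U`.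
(A monomial is encoded as the multiset of its variable indices.) -/
def IsShiftedOrderIdeal (m : ℕ) (U : Set (Multiset ℕ)) : Prop :=
  (∀ u ∈ U, ∀ i ∈ u, i ∈ Finset.Icc 1 m) ∧ (0 : Multiset ℕ) ∈ U ∧
    (∀ i ∈ Finset.Icc 1 m, ({i} : Multiset ℕ) ∈ U) ∧
    (∀ u ∈ U, ∀ v, v ≤ u → v ∈ U) ∧
    (∀ u : Multiset ℕ, ∀ i j : ℕ, i < j → j ≤ m → (i ::ₘ u) ∈ U → (j ::ₘ u) ∈ U)

/-- For a monomial `u = x_{i_1}⋯x_{i_k}` (`i_1 ≤ … ≤ i_k`), the `(d+1)`-set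
`F_d(u) = {i_1, i_1+1} ∪ {i_2+2, i_2+3} ∪ ⋯ ∪ {i_k+2(k-1), i_k+2k-1} ∪ [n+2k-d, n]`. -/
noncomputable def Fd (n d : ℕ) (u : Multiset ℕ) : Finset ℕ :=
  (Finset.range (Multiset.card u)).biUnion
      (fun j => {(u.sort (· ≤ ·)).getD j 0 + 2 * j, (u.sort (· ≤ ·)).getD j 0 + 2 * j + 1}) ∪
    Finset.Icc (n + 2 * Multiset.card u - d) n

/-- The squeezed `d`-ball `B_d(U)`: the complex generated by `{F_d(u) : u ∈ U}`. -/
def squeezedBall (n d : ℕ) (U : Set (Multiset ℕ)) : Set (Finset ℕ) :=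
  {G | ∃ u ∈ U, G ⊆ Fd n d u}

/-- The boundary of a pure `d`-dimensional complex `B`: the subcomplex generated by the
`(d-1)`-dimensional faces (cardinality-`d` faces) contained in exactly one facet. -/
noncomputable def complexBoundary (d : ℕ) (B : Set (Finset ℕ)) : Set (Finset ℕ) :=
  {F | ∃ G, F ⊆ G ∧ G ∈ B ∧ G.card = d ∧
    {H | H ∈ B ∧ H.card = d + 1 ∧ G ⊆ H}.ncard = 1}

/-- The squeezed `(d-1)`-sphere `S_d(U) = ∂ B_d(U)`. -/
noncomputable def squeezedSphere (n d : ℕ) (U : Set (Multiset ℕ)) : Set (Finset ℕ) :=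
  complexBoundary d (squeezedBall n d U)

/-! The Stanley–Reisner ideal, the degree reverse lexicographic order, initial ideals and
generic initial ideals in the polynomial ring `K[x_1,…,x_n]`, realized as
`MvPolynomial (Fin n) K` with the variable `x_i` being `X ⟨i-1⟩`. -/

/-- The squarefree monomial `x_F = ∏_{i ∈ F} x_i` (variable `x_i`, `1 ≤ i ≤ n`, is `X ⟨i-1⟩`). -/
noncomputable def faceMonomial (K : Type*) [CommRing K] (n : ℕ) (F : Finset ℕ) :
    MvPolynomial (Fin n) K :=
  ∏ a ∈ Finset.univ.filter (fun a : Fin n => (a : ℕ) + 1 ∈ F), MvPolynomial.X a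

/-- The Stanley–Reisner ideal of a complex `Γ` on `[n]`, generated by the squarefree
monomials `x_F` with `F ⊆ [n]`, `F ∉ Γ`. -/
noncomputable def srIdeal (K : Type*) [CommRing K] (n : ℕ) (Γ : Set (Finset ℕ)) :
    Ideal (MvPolynomial (Fin n) K) :=
  Ideal.span {f | ∃ F : Finset ℕ, F ⊆ Finset.Icc 1 n ∧ F ∉ Γ ∧ f = faceMonomial K n F}

/-- The degree reverse lexicographic order (induced by `x_1 > x_2 > ⋯`, smaller index =
bigger variable): `u < v` iff `deg u < deg v`, or degrees agree and at the largest index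
where `u, v` differ, `u` has the larger exponent. -/
def DegRevLexLT {σ : Type*} [LinearOrder σ] (u v : σ →₀ ℕ) : Prop :=
  (u.sum fun _ e => e) < (v.sum fun _ e => e) ∨
    ((u.sum fun _ e => e) = (v.sum fun _ e => e) ∧
      ∃ k, v k < u k ∧ ∀ l, k < l → u l = v l)

/-- The initial ideal of `I` w.r.t. the degree reverse lexicographic order: the ideal
spanned by the leading monomials of the elements of `I`. -/
noncomputable def initialIdeal {σ : Type*} [LinearOrder σ] {K : Type*} [Field K]
    (I : Ideal (MvPolynomial σ K)) : Ideal (MvPolynomial σ K) :=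
  Ideal.span {m | ∃ f ∈ I, ∃ u ∈ f.support, m = MvPolynomial.monomial u (1 : K) ∧
    ∀ v ∈ f.support, v ≠ u → DegRevLexLT v u}

/-- The linear change of coordinates of `K[x_1,…,x_n]` associated with a matrix `M`,
`x_j ↦ ∑_i M_{ij} x_i`. -/
noncomputable def genLin {K : Type*} [CommRing K] {n : ℕ} (M : Matrix (Fin n) (Fin n) K) :
    MvPolynomial (Fin n) K →ₐ[K] MvPolynomial (Fin n) K :=
  MvPolynomial.aeval (fun j => ∑ a : Fin n, MvPolynomial.C (M a j) * MvPolynomial.X a)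

/-- `J` is the generic initial ideal (w.r.t. degrevlex) of `I`: there is a nonempty Zariski
open subset `U ⊆ GL_n(K)` (the nonvanishing locus of a nonzero polynomial in the matrix
entries) such that `in(φ(I)) = J` for every `φ ∈ U`. -/
def IsGin {K : Type*} [Field K] {n : ℕ} (I J : Ideal (MvPolynomial (Fin n) K)) : Prop :=
  ∃ p : MvPolynomial (Fin n × Fin n) K, p ≠ 0 ∧
    ∀ M : Matrix (Fin n) (Fin n) K, IsUnit M.det →
      MvPolynomial.eval (fun q => M q.1 q.2) p ≠ 0 →
      initialIdeal (Ideal.map (genLin M) I) = J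

/-- The set `G(J)` of (exponent vectors of) minimal monomial generators of a monomial
ideal `J`. -/
def minimalMonomialGens {σ : Type*} {K : Type*} [Field K] (J : Ideal (MvPolynomial σ K)) :
    Set (σ →₀ ℕ) :=
  {u | MvPolynomial.monomial u (1 : K) ∈ J ∧
    ∀ v : σ →₀ ℕ, v ≤ u → MvPolynomial.monomial v (1 : K) ∈ J → v = u}

/-- The squarefree operation `Φ` on exponent vectors:
`x_{i_1} x_{i_2} ⋯ x_{i_k} ↦ {i_1, i_2+1, …, i_k+k-1}` (`i_1 ≤ i_2 ≤ ⋯ ≤ i_k`). -/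
noncomputable def sqfreeOp {n : ℕ} (u : Fin n →₀ ℕ) : Finset ℕ :=
  (List.zipWith (· + ·)
      ((u.toMultiset.map (fun a : Fin n => (a : ℕ) + 1)).sort (· ≤ ·))
      (List.range (Multiset.card (u.toMultiset)))).toFinset

/-- `Δs` is the symmetric algebraic shifted complex of `Γ`: its Stanley–Reisner ideal is
`Φ(Gin(I_Γ))`, i.e. `Δs` consists of the `F ⊆ [n]` containing no `Φ(u)`, `u ∈ G(Gin(I_Γ))`. -/
def IsSymmetricShift (K : Type*) [Field K] (n : ℕ) (Γ Δs : Set (Finset ℕ)) : Prop :=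
  ∃ J : Ideal (MvPolynomial (Fin n) K), IsGin (srIdeal K n Γ) J ∧
    Δs = {F | F ⊆ Finset.Icc 1 n ∧ ∀ u ∈ minimalMonomialGens J, ¬ sqfreeOp u ⊆ F}

/-- The exponent vector (in `K[x_1,…,x_n]`) of a monomial given as a multiset. -/
noncomputable def multisetToExp (n : ℕ) (u : Multiset ℕ) : Fin n →₀ ℕ :=
  Finsupp.equivFunOnFinite.symm (fun a : Fin n => u.count ((a : ℕ) + 1))
/-! The exterior algebra `E = ⋀⟨e_1, e_2, …⟩` over `K`, exterior face ideals, the reverse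
lexicographic order, initial ideals and exterior algebraic shifting. We realize `E` as the
exterior algebra of the `K`-module `ℕ → K`, with `e_i` the image of `Pi.single i 1`. -/

/-- The exterior algebra `⋀ (ℕ → K)` hosting all the exterior face ideals. -/
abbrev ExtAlg (K : Type*) [Field K] := ExteriorAlgebra K (ℕ → K)

/-- The exterior monomial `e_F = e_{i_1} ∧ ⋯ ∧ e_{i_k}` for `F = {i_1 < ⋯ < i_k}`. -/
noncomputable def eMon (K : Type*) [Field K] (F : Finset ℕ) : ExtAlg K :=
  ((F.sort (· ≤ ·)).map (fun i => ExteriorAlgebra.ι K (Pi.single i (1 : K)))).prod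

/-- The exterior face ideal `J_Γ` of a complex `Γ` on the vertex set `V`, generated by the
monomials `e_F` with `F ⊆ V`, `F ∉ Γ`. -/
noncomputable def extFaceIdeal (K : Type*) [Field K] (V : Finset ℕ) (Γ : Set (Finset ℕ)) :
    Ideal (ExtAlg K) :=
  Ideal.span {x | ∃ F : Finset ℕ, F ⊆ V ∧ F ∉ Γ ∧ x = eMon K F}

/-- The alternating form computing the determinant of the coordinates indexed by `F`. -/
noncomputable def detCoeffAlt (K : Type*) [Field K] (F : Finset ℕ) :
    (ℕ → K) [⋀^Fin F.card]→ₗ[K] K :=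
  (Matrix.detRowAlternating).compLinearMap
    (LinearMap.funLeft K K (fun b : Fin F.card => ((F.orderIsoOfFin rfl b : F) : ℕ)))

/-- The coefficient functional of the basis monomial `e_F`: the linear functional on the
exterior algebra giving the coefficient of `e_F` in the monomial basis expansion. -/
noncomputable def extCoeff (K : Type*) [Field K] (F : Finset ℕ) : ExtAlg K →ₗ[K] K :=
  ExteriorAlgebra.liftAlternating
    (fun i => if h : i = F.card then (detCoeffAlt K F).domDomCongr (finCongr h.symm) else 0)

/-- The reverse lexicographic order (induced by `1 > 2 > ⋯`) on exterior monomials: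
`F < G` iff `|F| < |G|`, or the cardinalities agree and the largest element of the
symmetric difference `F Δ G` belongs to `F`. -/
def RevLexLT (F G : Finset ℕ) : Prop :=
  F.card < G.card ∨ (F.card = G.card ∧
    ∃ k, k ∈ F ∧ k ∉ G ∧ ∀ l, k < l → (l ∈ F ↔ l ∈ G))

/-- The initial ideal of an ideal `I` of the exterior algebra w.r.t. the reverse
lexicographic order: spanned by the leading monomials `e_F` of the elements of `I`. -/
noncomputable def extInitialIdeal (K : Type*) [Field K] (I : Ideal (ExtAlg K)) :
    Ideal (ExtAlg K) :=
  Ideal.span {x | ∃ y ∈ I, ∃ F : Finset ℕ, x = eMon K F ∧ extCoeff K F y ≠ 0 ∧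
    ∀ G : Finset ℕ, extCoeff K G y ≠ 0 → G ≠ F → RevLexLT G F}

/-- The linear change of coordinates of `span{e_i : i ∈ V}` (identity elsewhere)
associated with a `|V| × |V|` matrix `M`. -/
noncomputable def extLinMap (K : Type*) [Field K] (V : Finset ℕ)
    (M : Matrix (Fin V.card) (Fin V.card) K) : (ℕ → K) →ₗ[K] (ℕ → K) where
  toFun v k :=
    if h : k ∈ V then
      ∑ a : Fin V.card,
        M ((V.orderIsoOfFin rfl).symm ⟨k, h⟩) a * v ((V.orderIsoOfFin rfl a : V) : ℕ)
    else v k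
  map_add' x y := by
    funext k
    by_cases h : k ∈ V <;> simp [h, mul_add, Finset.sum_add_distrib]
  map_smul' c x := by
    funext k
    by_cases h : k ∈ V <;> simp [h, Finset.mul_sum, mul_left_comm]

/-- The algebra automorphism of the exterior algebra induced by `extLinMap`. -/
noncomputable def extAlgMap (K : Type*) [Field K] (V : Finset ℕ)
    (M : Matrix (Fin V.card) (Fin V.card) K) : ExtAlg K →ₐ[K] ExtAlg K :=
  ExteriorAlgebra.lift K ⟨(ExteriorAlgebra.ι K).comp (extLinMap K V M),
    fun _ => ExteriorAlgebra.ι_sq_zero _⟩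

/-- `Δe` is the exterior algebraic shifted complex of `Γ` (as complexes on the vertex set
`V`): `J_{Δe} = Gin(J_Γ)`, where the generic initial ideal is witnessed by a nonempty
Zariski open subset of `GL(V)` (the nonvanishing locus of a nonzero polynomial in the
matrix entries). -/
def IsExteriorShift (K : Type*) [Field K] (V : Finset ℕ) (Γ Δe : Set (Finset ℕ)) : Prop :=
  ∃ p : MvPolynomial (Fin V.card × Fin V.card) K, p ≠ 0 ∧
    ∀ M : Matrix (Fin V.card) (Fin V.card) K, IsUnit M.det →
      MvPolynomial.eval (fun q => M q.1 q.2) p ≠ 0 →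
      extInitialIdeal K (Ideal.map (extAlgMap K V M) (extFaceIdeal K V Γ)) =
        extFaceIdeal K V Δe

/-- The simplicial complex on `V` whose exterior face ideal is the (monomial) ideal `J`. -/
noncomputable def complexOfExtIdeal (K : Type*) [Field K] (V : Finset ℕ)
    (J : Ideal (ExtAlg K)) : Set (Finset ℕ) :=
  {F | F ⊆ V ∧ eMon K F ∉ J}

/-- Nongeneric exterior shifting `Δ_φ(Γ)`, defined by `J_{Δ_φ(Γ)} = in(φ(J_Γ))` for an
individual linear change of coordinates `φ` given by the matrix `M`. -/
noncomputable def DeltaPhi (K : Type*) [Field K] (V : Finset ℕ)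
    (M : Matrix (Fin V.card) (Fin V.card) K) (Γ : Set (Finset ℕ)) : Set (Finset ℕ) :=
  complexOfExtIdeal K V (extInitialIdeal K (Ideal.map (extAlgMap K V M) (extFaceIdeal K V Γ)))

/-- The shifting-theoretic upper bound relation for a `(d-1)`-dimensional complex `Γ` on the
vertex set `V`: `Δᵉ(Γ) ⊆ Δ(V,d)`. -/
def ShiftingUBR (K : Type*) [Field K] (V : Finset ℕ) (d : ℕ) (Γ : Set (Finset ℕ)) : Prop :=
  ∀ Δe, IsExteriorShift K V Γ Δe → Δe ⊆ DeltaV V d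
/-! Graded pieces, linear systems of parameters, the Cohen–Macaulay property and the strong
Lefschetz property for graded quotients `A = K[x_1,…,x_n]/I`. -/

/-- The degree-`k` homogeneous component of the graded quotient `S/I` (the image of the
degree-`k` homogeneous polynomials). -/
noncomputable def quotPiece {K : Type*} [Field K] {n : ℕ}
    (I : Ideal (MvPolynomial (Fin n) K)) (k : ℕ) :
    Submodule K (MvPolynomial (Fin n) K ⧸ I) :=
  (MvPolynomial.homogeneousSubmodule (Fin n) K k).map (Ideal.Quotient.mkₐ K I).toLinearMap

/-- `θ_1, …, θ_d` is a linear system of parameters of `S/I`: the `θ_a` are linear forms and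
the quotient `S/(I + (θ_1,…,θ_d))` has Krull dimension `≤ 0`. -/
def IsLSOP {K : Type*} [Field K] {n : ℕ} (I : Ideal (MvPolynomial (Fin n) K)) (d : ℕ)
    (θ : Fin d → MvPolynomial (Fin n) K) : Prop :=
  (∀ a, (θ a).IsHomogeneous 1) ∧
    ringKrullDim (MvPolynomial (Fin n) K ⧸ (I ⊔ Ideal.span (Set.range θ))) ≤ 0

set_option synthInstance.maxHeartbeats 1000000 in
/-- The graded quotient `A = S/I` is Cohen–Macaulay: a linear system of parameters of
length `d = dim A` forms a regular `A`-sequence. -/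
def IsCMIdeal {K : Type*} [Field K] {n : ℕ} (I : Ideal (MvPolynomial (Fin n) K)) : Prop :=
  ∃ d : ℕ, ringKrullDim (MvPolynomial (Fin n) K ⧸ I) = d ∧
    ∃ θ : Fin d → MvPolynomial (Fin n) K, IsLSOP I d θ ∧
      RingTheory.Sequence.IsRegular (MvPolynomial (Fin n) K ⧸ I)
        ((List.ofFn θ).map (⇑(Ideal.Quotient.mk I)))

/-- The graded quotient `A = S/I` has the strong Lefschetz property: `A` is Cohen–Macaulay
and there are an l.s.o.p. `θ_1, …, θ_d` (`d = dim A`) and a linear form `ω` such that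
`ω^{s-2i} : (A/θA)_i → (A/θA)_{s-i}` is bijective for `0 ≤ i ≤ s/2`, where
`s = max{k : (A/θA)_k ≠ 0}`. -/
def HasSLPIdeal {K : Type*} [Field K] {n : ℕ} (I : Ideal (MvPolynomial (Fin n) K)) : Prop :=
  IsCMIdeal I ∧
    ∃ d : ℕ, ringKrullDim (MvPolynomial (Fin n) K ⧸ I) = d ∧
      ∃ θ : Fin d → MvPolynomial (Fin n) K, IsLSOP I d θ ∧
        ∃ ω : MvPolynomial (Fin n) K, ω.IsHomogeneous 1 ∧
          ∃ s : ℕ,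
            (quotPiece (I ⊔ Ideal.span (Set.range θ)) s ≠ ⊥ ∧
              ∀ k, s < k → quotPiece (I ⊔ Ideal.span (Set.range θ)) k = ⊥) ∧
            ∀ i : ℕ, 2 * i ≤ s →
              Set.BijOn
                (fun x => (Ideal.Quotient.mk (I ⊔ Ideal.span (Set.range θ)) ω) ^ (s - 2 * i) * x)
                (quotPiece (I ⊔ Ideal.span (Set.range θ)) i)
                (quotPiece (I ⊔ Ideal.span (Set.range θ)) (s - i))

/-- A simplicial complex is Cohen–Macaulay over `K` if its Stanley–Reisner ring is. -/
def ComplexCM (K : Type*) [Field K] (n : ℕ) (Γ : Set (Finset ℕ)) : Prop :=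
  IsCMIdeal (srIdeal K n Γ)

/-- A `(d-1)`-dimensional complex `Γ` has the strong Lefschetz property if `h_d(Γ) > 0` and
its Stanley–Reisner ring has the strong Lefschetz property. -/
def ComplexSLP (K : Type*) [Field K] (n d : ℕ) (Γ : Set (Finset ℕ)) : Prop :=
  0 < hvec d Γ d ∧ HasSLPIdeal (srIdeal K n Γ)

/-- A `1`-dimensional simplicial sphere (a cycle): a complex all of whose faces are edges or
smaller, every vertex lying in exactly two edges, whose edge graph is connected. -/
def IsCycleComplex (V : Finset ℕ) (Γ : Set (Finset ℕ)) : Prop :=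
  SimplicialComplexOn V Γ ∧ (∀ F ∈ Γ, F.card ≤ 2) ∧
    (∀ v ∈ V, {e | e ∈ Γ ∧ e.card = 2 ∧ v ∈ e}.ncard = 2) ∧
    ∀ u ∈ V, ∀ v ∈ V,
      Relation.ReflTransGen (fun a b : ℕ => ({a, b} : Finset ℕ) ∈ Γ) u v

namespace Squeezed
open Submodule

section Generic

variable {K I A : Type*} [Field K] [Ring A] [Algebra K A]

/-- `P` holds on the nonvanishing locus of some nonzero polynomial. -/
def Gen (P : (I → K) → Prop) : Prop :=
  ∃ p : MvPolynomial I K, p ≠ 0 ∧ ∀ x, MvPolynomial.eval x p ≠ 0 → P x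

theorem Gen.mono {P Q : (I → K) → Prop} (h : Gen P) (hPQ : ∀ x, P x → Q x) : Gen Q := by
  obtain ⟨p, hp, h⟩ := h
  exact ⟨p, hp, fun x hx => hPQ x (h x hx)⟩

theorem Gen.of_forall {P : (I → K) → Prop} (h : ∀ x, P x) : Gen P :=
  ⟨1, one_ne_zero, fun x _ => h x⟩

theorem Gen.and {P Q : (I → K) → Prop} (hP : Gen P) (hQ : Gen Q) :
    Gen (fun x => P x ∧ Q x) := by
  obtain ⟨p, hp, hP⟩ := hP
  obtain ⟨q, hq, hQ⟩ := hQ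
  refine ⟨p * q, mul_ne_zero hp hq, fun x hx => ?_⟩
  rw [map_mul] at hx
  exact ⟨hP x (left_ne_zero_of_mul hx), hQ x (right_ne_zero_of_mul hx)⟩

theorem Gen.forall_mem {ι : Type*} (s : Finset ι) {P : ι → (I → K) → Prop}
    (h : ∀ i ∈ s, Gen (P i)) : Gen (fun x => ∀ i ∈ s, P i x) := by
  classical
  induction s using Finset.induction_on with
  | empty => exact Gen.of_forall (by simp)
  | insert a s ha ih =>
    refine ((h a (by simp)).and (ih fun i hi => h i (by simp [hi]))).mono fun x hx => ?_
    simpa using hx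

theorem Gen.exists [Infinite K] {P : (I → K) → Prop} (h : Gen P) : ∃ x, P x := by
  obtain ⟨p, hp, h⟩ := h
  by_contra hne
  push Not at hne
  exact hp (MvPolynomial.funext fun x => by
    by_contra hx
    exact hne x (h x (by simpa using hx)))

/-- Functions with values in `A` that depend polynomially on the argument. -/
def polyMaps (K I A : Type*) [Field K] [Ring A] [Algebra K A] : Submodule K ((I → K) → A) :=
  span K {f | ∃ (q : MvPolynomial I K) (a : A), f = fun x => MvPolynomial.eval x q • a}

theorem const_mem_polyMaps (a : A) : (fun _ => a) ∈ polyMaps K I A :=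
  subset_span ⟨1, a, by simp⟩

theorem coord_mem_polyMaps (q : MvPolynomial I K) (a : A) :
    (fun x => MvPolynomial.eval x q • a) ∈ polyMaps K I A :=
  subset_span ⟨q, a, rfl⟩

theorem mul_mem_polyMaps {f g : (I → K) → A} (hf : f ∈ polyMaps K I A)
    (hg : g ∈ polyMaps K I A) : (fun x => f x * g x) ∈ polyMaps K I A := by
  change f * g ∈ _
  induction hf using span_induction with
  | zero => simp
  | add a b _ _ ha hb => rw [add_mul]; exact add_mem ha hb
  | smul c a _ ha => rw [smul_mul_assoc]; exact smul_mem _ _ ha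
  | mem a ha =>
    obtain ⟨p, a, rfl⟩ := ha
    induction hg using span_induction with
    | zero => simp
    | add a b _ _ ha hb => rw [mul_add]; exact add_mem ha hb
    | smul c a _ ha => rw [mul_smul_comm]; exact smul_mem _ _ ha
    | mem b hb =>
      obtain ⟨q, b, rfl⟩ := hb
      refine subset_span ⟨p * q, a * b, ?_⟩
      funext x
      simp [smul_smul, mul_comm]

theorem list_prod_mem_polyMaps {ι : Type*} (l : List ι) {f : (I → K) → ι → A}
    (hf : ∀ i, (fun x => f x i) ∈ polyMaps K I A) :
    (fun x => (l.map (f x)).prod) ∈ polyMaps K I A := by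
  induction l with
  | nil => exact const_mem_polyMaps 1
  | cons a l ih =>
    simp only [List.map_cons, List.prod_cons]
    exact mul_mem_polyMaps (hf a) ih

theorem exists_eval_eq (φ : A →ₗ[K] K) {f : (I → K) → A} (hf : f ∈ polyMaps K I A) :
    ∃ q : MvPolynomial I K, ∀ x, MvPolynomial.eval x q = φ (f x) := by
  induction hf using span_induction with
  | zero => exact ⟨0, by simp⟩
  | add a b _ _ ha hb =>
    obtain ⟨p, hp⟩ := ha
    obtain ⟨q, hq⟩ := hb
    exact ⟨p + q, fun x => by simp [hp, hq]⟩
  | smul c a _ ha =>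
    obtain ⟨p, hp⟩ := ha
    exact ⟨MvPolynomial.C c * p, fun x => by simp [hp]⟩
  | mem a ha =>
    obtain ⟨p, a, rfl⟩ := ha
    exact ⟨p * MvPolynomial.C (φ a), fun x => by simp⟩

/-- A family of subspaces spanned by a set of polynomially varying vectors. -/
def PolyFam (V : (I → K) → Submodule K A) : Prop :=
  ∃ S : Set ((I → K) → A), (∀ f ∈ S, f ∈ polyMaps K I A) ∧ ∀ x, V x = span K ((fun f => f x) '' S)

theorem PolyFam.const (X : Submodule K A) : PolyFam (fun _ : I → K => X) :=
  ⟨(fun a _ => a) '' (X : Set A), by rintro _ ⟨a, -, rfl⟩; exact const_mem_polyMaps a,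
    fun x => by rw [Set.image_image]; simp⟩

theorem PolyFam.singleton {f : (I → K) → A} (hf : f ∈ polyMaps K I A) :
    PolyFam (fun x => K ∙ f x) :=
  ⟨{f}, by simpa using hf, fun x => by simp⟩

theorem PolyFam.sup {V W : (I → K) → Submodule K A} (hV : PolyFam V) (hW : PolyFam W) :
    PolyFam (fun x => V x ⊔ W x) := by
  obtain ⟨S, hS, hV⟩ := hV
  obtain ⟨T, hT, hW⟩ := hW
  exact ⟨S ∪ T, fun f hf => hf.elim (hS f) (hT f), fun x => by
    simp only [hV, hW, Set.image_union, span_union]⟩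

theorem PolyFam.iSup {ι : Sort*} {V : ι → (I → K) → Submodule K A} (hV : ∀ i, PolyFam (V i)) :
    PolyFam (fun x => ⨆ i, V i x) := by
  choose S hS hV using hV
  refine ⟨⋃ i, S i, fun f hf => ?_, fun x => ?_⟩
  · obtain ⟨i, hi⟩ := Set.mem_iUnion.1 hf
    exact hS i f hi
  · rw [Set.image_iUnion, span_iUnion]
    exact iSup_congr fun i => hV i x

theorem PolyFam.mul {V W : (I → K) → Submodule K A} (hV : PolyFam V) (hW : PolyFam W) :
    PolyFam (fun x => V x * W x) := by
  obtain ⟨S, hS, hV⟩ := hV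
  obtain ⟨T, hT, hW⟩ := hW
  refine ⟨Set.image2 (fun f g x => f x * g x) S T, ?_, fun x => ?_⟩
  · rintro _ ⟨f, hf, g, hg, rfl⟩
    exact mul_mem_polyMaps (hS f hf) (hT g hg)
  · simp only [hV, hW, span_mul_span]
    congr 1
    ext y
    simp only [Set.mem_mul, Set.mem_image, Set.mem_image2]
    constructor
    · rintro ⟨_, ⟨f, hf, rfl⟩, _, ⟨g, hg, rfl⟩, rfl⟩
      exact ⟨_, ⟨f, hf, g, hg, rfl⟩, rfl⟩
    · rintro ⟨_, ⟨f, hf, g, hg, rfl⟩, rfl⟩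
      exact ⟨_, ⟨f, hf, rfl⟩, _, ⟨g, hg, rfl⟩, rfl⟩

/-- Spanning a fixed finite-dimensional space is a generic property. -/
theorem PolyFam.gen_le {V : (I → K) → Submodule K A} (hV : PolyFam V) (X : Submodule K A)
    [FiniteDimensional K X] (hX : ∀ x, V x ≤ X) (x₀ : I → K) (h₀ : X ≤ V x₀) :
    Gen (fun x => X ≤ V x) := by
  classical
  obtain ⟨S, hS, hV⟩ := hV
  have hXeq : span K ((fun f => f x₀) '' S) = X := by
    rw [← hV]; exact le_antisymm (hX _) h₀
  have : FiniteDimensional K (span K ((fun f : (I → K) → A => f x₀) '' S)) := by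
    rw [hXeq]; infer_instance
  obtain ⟨g, hg, hspan, hli⟩ := exists_fun_fin_finrank_span_eq (K := K) ((fun f => f x₀) '' S)
  have hr : Module.finrank K (span K ((fun f : (I → K) → A => f x₀) '' S)) =
      Module.finrank K X := by rw [hXeq]
  generalize Module.finrank K (span K ((fun f : (I → K) → A => f x₀) '' S)) = r at *
  choose F hF hFg using hg
  rw [hXeq] at hspan
  have hgX : ∀ i, g i ∈ X := fun i => by rw [← hspan]; exact subset_span ⟨i, rfl⟩
  have key : ∃ φ : A →ₗ[K] (Fin r → K), ∀ i, φ (g i) = Pi.single i 1 := by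
    obtain ⟨φ, hφ⟩ := LinearMap.exists_extend
      ((Finsupp.linearEquivFunOnFinite K K (Fin r)).toLinearMap ∘ₗ hli.repr)
    refine ⟨φ, fun i => ?_⟩
    have := LinearMap.congr_fun hφ ⟨g i, subset_span ⟨i, rfl⟩⟩
    simp only [LinearMap.comp_apply, subtype_apply] at this
    rw [this, hli.repr_eq_single i _ rfl]
    simp
  obtain ⟨φ, hφ⟩ := key
  have hq : ∀ i k, ∃ q : MvPolynomial I K, ∀ x, MvPolynomial.eval x q = φ (F i x) k := fun i k =>
    exists_eval_eq (LinearMap.proj k ∘ₗ φ) (hS _ (hF i))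
  choose q hq using hq
  have hdet : ∀ x, MvPolynomial.eval x (Matrix.of q).det =
      (Matrix.of fun i k => φ (F i x) k).det := fun x => by
    rw [RingHom.map_det]
    congr 1
    ext i k
    simp [hq]
  refine ⟨(Matrix.of q).det, fun h0 => ?_, fun x hx => ?_⟩
  · have := hdet x₀
    rw [h0, map_zero] at this
    have h1 : (Matrix.of fun i k => φ (F i x₀) k) = (1 : Matrix (Fin r) (Fin r) K) := by
      ext i k
      have : F i x₀ = g i := hFg i
      simp only [Matrix.of_apply, this, hφ, Matrix.one_apply, Pi.single_apply]
      simp [eq_comm]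
    rw [h1, Matrix.det_one] at this
    exact zero_ne_one this
  · rw [hdet] at hx
    have hli2 : LinearIndependent K fun i => F i x := by
      have : LinearIndependent K (Matrix.of fun i k => φ (F i x) k).row :=
        Matrix.linearIndependent_rows_iff_isUnit.2
          ((Matrix.isUnit_iff_isUnit_det _).2 (isUnit_iff_ne_zero.2 hx))
      exact LinearIndependent.of_comp φ this
    have hle : span K (Set.range fun i => F i x) ≤ V x := by
      rw [hV]
      apply span_mono
      rintro _ ⟨i, rfl⟩
      exact ⟨F i, hF i, rfl⟩
    have : span K (Set.range fun i => F i x) = X := by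
      refine eq_of_le_of_finrank_le (hle.trans (hX x)) ?_
      rw [finrank_span_eq_card hli2, Fintype.card_fin, hr]
    rw [← this]
    exact hle

end Generic
end Squeezed

namespace Squeezed

/-- Weakly increasing lists of length `e` with entries in `[i, M]`. -/
def Lst (i M e : ℕ) : Set (List ℕ) :=
  {s | s.length = e ∧ s.Pairwise (· ≤ ·) ∧ ∀ x ∈ s, i ≤ x ∧ x ≤ M}

/-- The stretched support `{s_l + 2 l + σ : s_l < M}` of a weakly increasing list. -/
def phi2 (M : ℕ) : ℕ → List ℕ → List ℕ
  | _, [] => []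
  | σ, a :: s => if a < M then (a + σ) :: phi2 M (σ + 2) s else []

/-- The list `s_l + 2 l + σ + 1` over entries `s_l < M`, followed by a terminal interval. -/
def intl (M n : ℕ) : ℕ → List ℕ → List ℕ
  | _, [] => []
  | σ, a :: s => if a < M then (a + σ + 1) :: intl M n (σ + 2) s
      else List.range' (a + σ) (n + 1 - (a + σ))

/-- An up-closed set of lists in `Lst i M e`, all of which end in `M`. -/
structure Good (i M e : ℕ) (W : Set (List ℕ)) : Prop where
  sub : W ⊆ Lst i M e
  up : ∀ s ∈ W, ∀ t ∈ Lst i M e, List.Forall₂ (· ≤ ·) s t → t ∈ W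
  top : ∀ s ∈ W, M ∈ s

def Wx (i : ℕ) (W : Set (List ℕ)) : Set (List ℕ) := {s | i :: s ∈ W}

def Wn (i : ℕ) (W : Set (List ℕ)) : Set (List ℕ) := {s | s ∈ W ∧ ∀ x ∈ s, i + 1 ≤ x}

theorem Lst_cons_iff {i M e a : ℕ} {s : List ℕ} :
    a :: s ∈ Lst i M (e + 1) ↔ i ≤ a ∧ a ≤ M ∧ s ∈ Lst a M e := by
  simp only [Lst, Set.mem_ofPred_eq, List.length_cons, List.pairwise_cons, List.mem_cons,
    forall_eq_or_imp, Nat.add_right_cancel_iff]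
  constructor
  · rintro ⟨h1, ⟨h2, h3⟩, h4, h5⟩
    exact ⟨h4.1, h4.2, h1, h3, fun x hx => ⟨h2 x hx, (h5 x hx).2⟩⟩
  · rintro ⟨h1, h2, h3, h4, h5⟩
    exact ⟨h3, ⟨fun x hx => (h5 x hx).1, h4⟩, ⟨h1, h2⟩,
      fun x hx => ⟨h1.trans (h5 x hx).1, (h5 x hx).2⟩⟩

theorem Lst_mono {i j M e : ℕ} (h : i ≤ j) : Lst j M e ⊆ Lst i M e :=
  fun _ hs => ⟨hs.1, hs.2.1, fun x hx => ⟨h.trans (hs.2.2 x hx).1, (hs.2.2 x hx).2⟩⟩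

theorem Lst_succ_of {i M e : ℕ} {s : List ℕ} (h : s ∈ Lst i M e) (h' : ∀ x ∈ s, i + 1 ≤ x) :
    s ∈ Lst (i + 1) M e :=
  ⟨h.1, h.2.1, fun x hx => ⟨h' x hx, (h.2.2 x hx).2⟩⟩

theorem Good.wx {i M e : ℕ} {W : Set (List ℕ)} (h : Good i M (e + 1) W) (hi : i < M) :
    Good i M e (Wx i W) where
  sub s hs := (Lst_cons_iff.1 (h.sub hs)).2.2
  up s hs t ht hst := h.up _ hs _ (Lst_cons_iff.2 ⟨le_rfl, hi.le, ht⟩) (.cons le_rfl hst)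
  top s hs := by
    have := h.top _ hs
    rcases List.mem_cons.1 this with h | h
    · omega
    · exact h

theorem Good.wn {i M e : ℕ} {W : Set (List ℕ)} (h : Good i M e W) :
    Good (i + 1) M e (Wn i W) where
  sub s hs := Lst_succ_of (h.sub hs.1) hs.2
  up s hs t ht hst := ⟨h.up _ hs.1 _ (Lst_mono (Nat.le_succ i) ht) hst,
    fun x hx => (ht.2.2 x hx).1⟩
  top s hs := h.top _ hs.1

/-- Strictly increasing lists with entries in `[i + σ, n]` which contain one of the distinguished
nonfaces attached to `W`. -/
def NF (n i σ M e : ℕ) (W : Set (List ℕ)) : Set (List ℕ) :=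
  {l | l.Pairwise (· < ·) ∧ (∀ x ∈ l, i + σ ≤ x ∧ x ≤ n) ∧
    ((∃ s ∈ Lst i M e, s ∉ W ∧ (phi2 M σ s).Sublist l) ∨ ∃ s ∈ W, (intl M n σ s).Sublist l)}

theorem sublist_of_lt_head {l g : List ℕ} {q : ℕ} (h : l.Sublist (q :: g))
    (hl : ∀ x ∈ l, q < x) : l.Sublist g := by
  rcases List.sublist_cons_iff.1 h with h | ⟨r, rfl, h⟩
  · exact h
  · exact absurd (hl q (by simp)) (lt_irrefl q)

theorem le_of_mem_phi2 {M : ℕ} {s : List ℕ} {i σ e : ℕ} (h : s ∈ Lst i M e) :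
    ∀ x ∈ phi2 M σ s, i + σ ≤ x := by
  induction s generalizing i σ e with
  | nil => simp [phi2]
  | cons a s ih =>
    obtain ⟨e, rfl⟩ : ∃ e', e = e' + 1 := ⟨s.length, h.1.symm⟩
    have h' := Lst_cons_iff.1 h
    intro x hx
    rw [phi2] at hx
    split_ifs at hx
    · rcases List.mem_cons.1 hx with rfl | hx
      · omega
      · have := ih h'.2.2 x hx
        omega
    · simp at hx

theorem le_of_mem_intl {M n : ℕ} {s : List ℕ} {i σ e : ℕ} (h : s ∈ Lst i M e) :
    ∀ x ∈ intl M n σ s, i + σ ≤ x ∧ (i < M → i + σ + 1 ≤ x) := by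
  induction s generalizing i σ e with
  | nil => simp [intl]
  | cons a s ih =>
    obtain ⟨e, rfl⟩ : ∃ e', e = e' + 1 := ⟨s.length, h.1.symm⟩
    have h' := Lst_cons_iff.1 h
    intro x hx
    rw [intl] at hx
    split_ifs at hx
    · rcases List.mem_cons.1 hx with rfl | hx
      · omega
      · have := ih h'.2.2 x hx
        omega
    · rw [List.mem_range'_1] at hx
      omega

theorem phi2_replicate_sublist {M i : ℕ} (hi : i < M) (e σ L : ℕ) (hL : 2 * e ≤ L + 1) :
    (phi2 M σ (List.replicate e i)).Sublist (List.range' (i + σ) L) := by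
  induction e generalizing σ L with
  | zero => simp [phi2]
  | succ e ih =>
    obtain ⟨L, rfl⟩ : ∃ L', L = L' + 1 := ⟨L - 1, by omega⟩
    rw [List.replicate_succ, phi2, if_pos hi, List.range'_succ]
    apply List.Sublist.cons_cons
    rcases e with _ | e
    · simp [phi2]
    · obtain ⟨L, rfl⟩ : ∃ L', L = L' + 1 := ⟨L - 1, by omega⟩
      rw [List.range'_succ]
      apply List.Sublist.cons
      have := ih (σ + 2) L (by omega)
      rwa [show i + (σ + 2) = i + σ + 1 + 1 by omega] at this

theorem replicate_mem_Lst {i M e : ℕ} (h : i ≤ M) (a : ℕ) (h1 : i ≤ a) (h2 : a ≤ M) :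
    List.replicate e a ∈ Lst i M e := by
  refine ⟨by simp, by simp [List.pairwise_replicate], ?_⟩
  intro x hx
  rw [List.eq_of_mem_replicate hx]
  exact ⟨h1, h2⟩

theorem Forall₂_le_refl (s : List ℕ) : List.Forall₂ (· ≤ ·) s s :=
  List.forall₂_same.2 fun _ _ => le_rfl

theorem NF_wx {n i σ M e c : ℕ} {W : Set (List ℕ)} (h : Good i M (e + 1) W) (hi : i < M)
    (hn : n + 2 = M + σ + 2 * (e + 1) + c) {l : List ℕ}
    (hl : l ∈ NF n i (σ + 2) M e (Wx i W)) :
    (i + σ) :: l ∈ NF n i σ M (e + 1) W ∨ (i + σ + 1) :: l ∈ NF n i σ M (e + 1) W := by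
  obtain ⟨h1, h2, h3⟩ := hl
  rcases h3 with ⟨s, hs, hsW, hsub⟩ | ⟨s, hs, hsub⟩
  · left
    refine ⟨List.pairwise_cons.2 ⟨fun x hx => by have := h2 x hx; omega, h1⟩, ?_, Or.inl
      ⟨i :: s, Lst_cons_iff.2 ⟨le_rfl, hi.le, hs⟩, hsW, ?_⟩⟩
    · intro x hx
      rcases List.mem_cons.1 hx with rfl | hx
      · omega
      · have := h2 x hx; omega
    · rw [phi2, if_pos hi]
      exact hsub.cons_cons _
  · right
    refine ⟨List.pairwise_cons.2 ⟨fun x hx => by have := h2 x hx; omega, h1⟩, ?_, Or.inr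
      ⟨i :: s, hs, ?_⟩⟩
    · intro x hx
      rcases List.mem_cons.1 hx with rfl | hx
      · omega
      · have := h2 x hx; omega
    · rw [intl, if_pos hi]
      exact hsub.cons_cons _

theorem NF_wn_mem {n i σ M e : ℕ} {W : Set (List ℕ)} {l : List ℕ}
    (hl : l ∈ NF n (i + 1) σ M e (Wn i W)) : l ∈ NF n i σ M e W := by
  obtain ⟨h1, h2, h3⟩ := hl
  refine ⟨h1, fun x hx => ⟨by have := h2 x hx; omega, (h2 x hx).2⟩, ?_⟩
  rcases h3 with ⟨s, hs, hsW, hsub⟩ | ⟨s, hs, hsub⟩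
  · exact Or.inl ⟨s, Lst_mono (Nat.le_succ i) hs, fun h => hsW ⟨h, fun x hx => (hs.2.2 x hx).1⟩,
      hsub⟩
  · exact Or.inr ⟨s, hs.1, hsub⟩

theorem NF_wn_cons {n i σ M e c : ℕ} {W : Set (List ℕ)} (h : Good i M (e + 1) W) (hi : i < M)
    (hn : n + 2 = M + σ + 2 * (e + 1) + c) {g : List ℕ}
    (hl : (i + σ + 1) :: g ∈ NF n (i + 1) σ M (e + 1) (Wn i W)) :
    (i + σ) :: g ∈ NF n i σ M (e + 1) W := by
  obtain ⟨h1, h2, h3⟩ := hl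
  rw [List.pairwise_cons] at h1
  refine ⟨List.pairwise_cons.2 ⟨fun x hx => by have := h1.1 x hx; omega, h1.2⟩, ?_, ?_⟩
  · intro x hx
    rcases List.mem_cons.1 hx with rfl | hx
    · omega
    · have := h2 x (List.mem_cons_of_mem _ hx); omega
  rcases h3 with ⟨s, hs, hsW, hsub⟩ | ⟨s, hs, hsub⟩
  · left
    have hsW' : s ∉ W := fun h => hsW ⟨h, fun x hx => (hs.2.2 x hx).1⟩
    rcases s with _ | ⟨x, s⟩
    · exact absurd hs.1 (by simp)
    have hs' := Lst_cons_iff.1 hs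
    by_cases hx : x = i + 1 ∧ x < M
    · refine ⟨i :: s, Lst_cons_iff.2 ⟨le_rfl, hi.le, Lst_mono (by omega) hs'.2.2⟩,
        fun hmem => hsW' (h.up _ hmem _ (Lst_mono (Nat.le_succ i) hs)
          (.cons (by omega) (Forall₂_le_refl s))), ?_⟩
      rw [phi2, if_pos hx.2, hx.1, show i + 1 + σ = i + σ + 1 by omega] at hsub
      rw [phi2, if_pos hi]
      exact (List.cons_sublist_cons.1 hsub).cons_cons _
    · refine ⟨x :: s, Lst_mono (Nat.le_succ i) hs, hsW', ?_⟩
      apply List.Sublist.cons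
      by_cases hxM : x < M
      · apply sublist_of_lt_head hsub
        intro y hy
        rw [phi2, if_pos hxM] at hy
        rcases List.mem_cons.1 hy with rfl | hy
        · omega
        · have := le_of_mem_phi2 hs'.2.2 y hy
          omega
      · rw [phi2, if_neg hxM]; simp
  · by_cases hM : i + 1 < M
    · right
      refine ⟨s, hs.1, ?_⟩
      apply List.Sublist.cons
      apply sublist_of_lt_head hsub
      intro y hy
      have := (le_of_mem_intl (h.wn.sub hs) y hy).2 hM
      omega
    · left
      have hMi : M = i + 1 := by omega
      refine ⟨List.replicate (e + 1) i, replicate_mem_Lst hi.le i le_rfl hi.le, fun hmem => ?_, ?_⟩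
      · have := List.eq_of_mem_replicate (h.top _ hmem)
        omega
      · rcases s with _ | ⟨x, s⟩
        · exact absurd (h.sub hs.1).1 (by simp)
        have hs' := Lst_cons_iff.1 (h.wn.sub hs)
        have hxM : x = i + 1 := by omega
        rw [intl, if_neg (by omega), hxM, show n + 1 - (i + 1 + σ) = n - (i + 1 + σ) + 1 by omega,
          List.range'_succ, show i + 1 + σ = i + σ + 1 by omega] at hsub
        have hsub' := List.cons_sublist_cons.1 hsub
        rw [List.replicate_succ, phi2, if_pos hi]
        apply List.Sublist.cons_cons
        refine List.Sublist.trans ?_ hsub'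
        rw [show i + σ + 1 + 1 = i + (σ + 2) by omega]
        exact phi2_replicate_sublist hi _ _ _ (by omega)

end Squeezed

namespace Squeezed
open Submodule

section AlgebraP

variable {K A : Type*} [Field K] [Ring A] [Algebra K A]

/-- Generators commuting up to scalars; for `τ = 1` they square to zero. -/
structure SignComm (K : Type*) {A : Type*} [Field K] [Ring A] [Algebra K A] (x : ℕ → A)
    (τ : ℕ) : Prop where
  comm : ∀ j k, x j * x k ∈ K ∙ (x k * x j)
  sq : τ = 0 ∨ (τ = 1 ∧ ∀ j, x j * x j = 0)

/-- The span of the generators with index in `S`. -/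
def spanOn (K : Type*) {A : Type*} [Field K] [Ring A] [Algebra K A] (x : ℕ → A) (S : Set ℕ) :
    Submodule K A :=
  span K (x '' S)

variable {x : ℕ → A} {τ : ℕ}

theorem mem_spanOn {S : Set ℕ} {j : ℕ} (hj : j ∈ S) : x j ∈ spanOn K x S :=
  subset_span ⟨j, hj, rfl⟩

theorem spanOn_mono {S T : Set ℕ} (h : S ⊆ T) : spanOn K x S ≤ spanOn K x T :=
  span_mono (Set.image_mono h)

theorem spanOn_union (S T : Set ℕ) : spanOn K x (S ∪ T) = spanOn K x S + spanOn K x T := by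
  rw [spanOn, Set.image_union, span_union]; rfl

theorem spanOn_singleton (j : ℕ) : spanOn K x {j} = K ∙ x j := by
  rw [spanOn, Set.image_singleton]

theorem spanOn_fg {S : Set ℕ} (hS : S.Finite) (r : ℕ) :
    FiniteDimensional K ↥(spanOn K x S ^ r) :=
  Module.Finite.iff_fg.2 (Submodule.FG.pow (fg_span (hS.image x)) r)

theorem SignComm.commute (hx : SignComm K x τ) (S T : Set ℕ) :
    Commute (spanOn K x S) (spanOn K x T) := by
  have key : ∀ S T : Set ℕ, spanOn K x S * spanOn K x T ≤ spanOn K x T * spanOn K x S := by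
    intro S T
    conv_lhs => rw [spanOn, spanOn, span_mul_span]
    rw [span_le]
    rintro _ ⟨_, ⟨j, hj, rfl⟩, _, ⟨k, hk, rfl⟩, rfl⟩
    obtain ⟨c, hc⟩ := mem_span_singleton.1 (hx.comm j k)
    change x j * x k ∈ _
    rw [← hc]
    exact smul_mem _ _ (mul_mem_mul (mem_spanOn hk) (mem_spanOn hj))
  exact le_antisymm (key S T) (key T S)

theorem add_pow_le_of_commute {X Y : Submodule K A} (h : Commute X Y) (r : ℕ) :
    (X + Y) ^ (r + 1) ≤ Y ^ (r + 1) ⊔ X * (X + Y) ^ r := by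
  induction r with
  | zero => simp [Submodule.add_eq_sup]
  | succ r ih =>
    rw [pow_succ' (X + Y) (r + 1), add_mul]
    refine sup_le le_sup_right ?_
    refine (mul_le_mul_right ih Y).trans ?_
    rw [Submodule.mul_sup, ← pow_succ', ← mul_assoc, ← h.eq, mul_assoc]
    refine sup_le_sup le_rfl (mul_le_mul_right ?_ X)
    rw [pow_succ']
    exact mul_le_mul_left le_sup_right _

/-- The span of the generators with index in `[a, Z]`. -/
abbrev spanIcc (K : Type*) {A : Type*} [Field K] [Ring A] [Algebra K A] (x : ℕ → A)
    (a Z : ℕ) : Submodule K A := spanOn K x (Set.Icc a Z)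

theorem spanIcc_eq {a Z : ℕ} (h : a ≤ Z) :
    spanIcc K x a Z = (K ∙ x a) + spanIcc K x (a + 1) Z := by
  have hS : Set.Icc a Z = {a} ∪ Set.Icc (a + 1) Z := by
    ext j
    simp only [Set.mem_Icc, Set.mem_union, Set.mem_singleton_iff]
    omega
  rw [← spanOn_singleton, ← spanOn_union, ← hS]

theorem SignComm.pow_le (hx : SignComm K x τ) {a Z : ℕ} (h : a ≤ Z) (r : ℕ) :
    spanIcc K x a Z ^ (r + 1) ≤ spanIcc K x (a + 1) Z ^ (r + 1) ⊔
      (K ∙ x a) * spanIcc K x a Z ^ r := by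
  have := add_pow_le_of_commute (hx.commute {a} (Set.Icc (a + 1) Z)) r
  rwa [spanOn_singleton, ← spanIcc_eq h] at this

theorem SignComm.mul_pow_le (hx : SignComm K x τ) {a Z : ℕ} (h : a ≤ Z) (r : ℕ) :
    (K ∙ x a) * spanIcc K x a Z ^ r ≤ (K ∙ x a) * spanIcc K x (a + τ) Z ^ r := by
  rcases hx.sq with rfl | ⟨rfl, hsq⟩
  · simp
  · rcases r with _ | r
    · simp
    · refine (mul_le_mul_right (hx.pow_le h r) _).trans ?_
      rw [Submodule.mul_sup, ← mul_assoc, span_mul_span, Set.singleton_mul_singleton, hsq]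
      simp

theorem SignComm.pow_le' (hx : SignComm K x τ) {a Z : ℕ} (h : a ≤ Z) (r : ℕ) :
    spanIcc K x a Z ^ (r + 1) ≤ spanIcc K x (a + 1) Z ^ (r + 1) ⊔
      (K ∙ x a) * spanIcc K x (a + τ) Z ^ r :=
  (hx.pow_le h r).trans (sup_le_sup le_rfl (hx.mul_pow_le h r))

theorem SignComm.pow_le_split (hx : SignComm K x τ) (n Z r : ℕ) (hZ : Z ≤ n) :
    spanIcc K x 1 n ^ (r + 1) ≤ spanIcc K x 1 Z ^ (r + 1) ⊔
      spanIcc K x 1 n ^ r * spanIcc K x (Z + 1) n := by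
  have := add_pow_le_of_commute (hx.commute (Set.Icc (Z + 1) n) (Set.Icc 1 Z)) r
  have h : Set.Icc (Z + 1) n ∪ Set.Icc 1 Z = Set.Icc 1 n := by
    ext j
    simp only [Set.mem_Icc, Set.mem_union]
    omega
  rw [← spanOn_union, h] at this
  rwa [((hx.commute (Set.Icc 1 n) (Set.Icc (Z + 1) n)).pow_left r).eq]

theorem spanIcc_eq_bot {a Z : ℕ} (h : Z < a) : spanIcc K x a Z = ⊥ := by
  rw [spanIcc, Set.Icc_eq_empty (by omega), spanOn]
  simp

theorem SignComm.pow_eq_bot (hx : SignComm K x 1) (N : ℕ) :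
    ∀ a Z r : ℕ, Z + 1 ≤ a + N → N < r → spanIcc K x a Z ^ r = ⊥ := by
  induction N with
  | zero =>
    intro a Z r h1 h2
    rw [spanIcc_eq_bot (by omega), Submodule.bot_pow (by omega)]
  | succ N ih =>
    intro a Z r h1 h2
    obtain ⟨r, rfl⟩ : ∃ r', r = r' + 1 := ⟨r - 1, by omega⟩
    by_cases h : a ≤ Z
    · have := hx.pow_le' h r
      rw [ih (a + 1) Z (r + 1) (by omega) (by omega), ih (a + 1) Z r (by omega) (by omega)] at this
      simpa using this
    · rw [spanIcc_eq_bot (by omega), Submodule.bot_pow (by omega)]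

theorem SignComm.pow_le_prod (hx : SignComm K x 1) (q : ℕ) :
    ∀ a Z r : ℕ, Z + 1 = a + r → q ≤ r → spanIcc K x a Z ^ r ≤
      (K ∙ ((List.range' a q).map x).prod) * spanIcc K x (a + q) Z ^ (r - q) := by
  induction q with
  | zero => intro a Z r _ _; simp [one_eq_span.symm]
  | succ q ih =>
    intro a Z r h1 h2
    obtain ⟨r, rfl⟩ : ∃ r', r = r' + 1 := ⟨r - 1, by omega⟩
    have h : a ≤ Z := by omega
    refine (hx.pow_le' h r).trans ?_
    rw [hx.pow_eq_bot r (a + 1) Z (r + 1) (by omega) (by omega), bot_sup_eq]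
    refine (mul_le_mul_right (ih (a + 1) Z r (by omega) (by omega)) _).trans ?_
    rw [← mul_assoc, span_mul_span, Set.singleton_mul_singleton, List.range'_succ, List.map_cons,
      List.prod_cons, show a + 1 + q = a + (q + 1) by omega, Nat.add_sub_add_right]

/-- The power, respectively the truncated product, of the last `b` generators up to `Z`. -/
def topProd (x : ℕ → A) (τ Z b : ℕ) : A :=
  ((List.range b).map fun j => x (Z + τ * (j + 1) - τ * b)).prod

theorem map_prod_mem_pow {ι : Type*} {L : Submodule K A} {v : ι → A} (l : List ι)
    (hv : ∀ j ∈ l, v j ∈ L) : (l.map v).prod ∈ L ^ l.length := by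
  induction l with
  | nil => simp [one_le.1 le_rfl]
  | cons a l ih =>
    rw [List.map_cons, List.prod_cons, List.length_cons, pow_succ']
    exact mul_mem_mul (hv a (by simp)) (ih fun j hj => hv j (by simp [hj]))

theorem SignComm.pow_le_topProd (hx : SignComm K x τ) {a Z r b : ℕ} (hZ : Z + τ = a + τ * r)
    (hb : b ≤ r) :
    spanIcc K x a Z ^ r ≤ spanIcc K x a Z ^ (r - b) * (K ∙ topProd x τ Z b) := by
  rcases hx.sq with rfl | ⟨rfl, -⟩
  · obtain rfl : Z = a := by omega
    have h1 : spanIcc K x Z Z = K ∙ x Z := by rw [spanIcc, Set.Icc_self, spanOn_singleton]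
    have h2 : topProd x 0 Z b = x Z ^ b := by simp [topProd]
    rw [h1, h2, span_pow, span_pow, span_mul_span]
    simp [← pow_add, hb]
  · refine (hx.pow_le_prod (r - b) a Z r (by omega) (by omega)).trans ?_
    have h1 := hx.pow_le_prod b (a + (r - b)) Z b (by omega) le_rfl
    have h2 : topProd x 1 Z b = ((List.range' (a + (r - b)) b).map x).prod := by
      rw [topProd, List.range'_eq_map_range, List.map_map]
      congr 1
      apply List.map_congr_left
      intro j _
      simp only [Function.comp_apply]
      congr 1
      omega
    rw [h2, show r - (r - b) = b by omega]
    refine mul_le_mul' ?_ (by simpa using h1)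
    rw [span_singleton_le_iff_mem]
    have := map_prod_mem_pow (K := K) (L := spanIcc K x a Z) (v := x) (List.range' a (r - b))
      (fun j hj => mem_spanOn (by rw [List.mem_range'_1] at hj; simp; omega))
    simpa using this

theorem SignComm.exists_pow_le (hx : SignComm K x τ) {a Z r : ℕ} (hZ : Z + τ = a + τ * r) :
    ∃ w : ℕ → A, (∀ j < r, w j ∈ spanIcc K x a Z) ∧ ∀ q ≤ r, spanIcc K x a Z ^ r ≤
      (K ∙ ((List.range q).map w).prod) * spanIcc K x a Z ^ (r - q) := by
  rcases hx.sq with rfl | ⟨rfl, -⟩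
  · obtain rfl : Z = a := by omega
    refine ⟨fun _ => x Z, fun j _ => mem_spanOn (by simp), fun q hq => ?_⟩
    have h1 : spanIcc K x Z Z = K ∙ x Z := by rw [spanIcc, Set.Icc_self, spanOn_singleton]
    rw [h1, span_pow, span_pow, span_mul_span]
    simp [← pow_add, hq]
  · refine ⟨fun j => x (a + j), fun j hj => mem_spanOn (by simp; omega), fun q hq => ?_⟩
    refine (hx.pow_le_prod q a Z r (by omega) hq).trans ?_
    rw [List.range'_eq_map_range, List.map_map]
    exact mul_le_mul_right (pow_le_pow_left' (spanOn_mono fun j hj => by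
      simp only [Set.mem_Icc] at hj ⊢; omega) _) _

/-- The degree `r` part of the ideal generated by the products of `v` along the lists in `N`. -/
def prodIdeal (N : Set (List ℕ)) (v : ℕ → A) (L : Submodule K A) (r : ℕ) : Submodule K A :=
  ⨆ l : {l : List ℕ // l ∈ N ∧ l.length ≤ r},
    (K ∙ (l.1.map v).prod) * L ^ (r - l.1.length)

theorem le_prodIdeal {N : Set (List ℕ)} {v : ℕ → A} {L : Submodule K A} {r : ℕ} {l : List ℕ}
    (hl : l ∈ N) (hr : l.length ≤ r) :
    (K ∙ (l.map v).prod) * L ^ (r - l.length) ≤ prodIdeal N v L r :=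
  le_iSup (fun l : {l : List ℕ // l ∈ N ∧ l.length ≤ r} =>
    (K ∙ (l.1.map v).prod) * L ^ (r - l.1.length)) ⟨l, hl, hr⟩

theorem prodIdeal_mono_right {N : Set (List ℕ)} {v : ℕ → A} {L L' : Submodule K A} {r : ℕ}
    (h : L ≤ L') : prodIdeal N v L r ≤ prodIdeal N v L' r :=
  iSup_mono fun _ => mul_le_mul_right (pow_le_pow_left' h _) _

theorem prodIdeal_le {N : Set (List ℕ)} {v : ℕ → A} {L : Submodule K A} {r : ℕ}
    (hv : ∀ j, v j ∈ L) : prodIdeal N v L r ≤ L ^ r := by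
  refine iSup_le fun ⟨l, _, hl⟩ => ?_
  calc (K ∙ (l.map v).prod) * L ^ (r - l.length) ≤ L ^ l.length * L ^ (r - l.length) :=
        mul_le_mul_left ((span_singleton_le_iff_mem _ _).2 (map_prod_mem_pow l fun j _ => hv j)) _
    _ = L ^ r := by rw [← pow_add, Nat.add_sub_cancel' hl]

theorem polyFam_prodIdeal {I : Type*} (N : Set (List ℕ)) {v : (I → K) → ℕ → A}
    (hv : ∀ j, (fun y => v y j) ∈ polyMaps K I A) (L : Submodule K A) (r : ℕ) :
    PolyFam (fun y => prodIdeal N (v y) L r) :=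
  PolyFam.iSup fun _ => (PolyFam.singleton (list_prod_mem_polyMaps _ hv)).mul (PolyFam.const _)

end AlgebraP
end Squeezed

namespace Squeezed
open Submodule

section MainP

variable {K A : Type*} [Field K] [Ring A] [Algebra K A] {x : ℕ → A} {τ : ℕ}

theorem map_prod_congr {v w : ℕ → A} {l : List ℕ} (h : ∀ j ∈ l, v j = w j) :
    (l.map v).prod = (l.map w).prod := by
  rw [List.map_congr_left h]

theorem exists_common [Infinite K] {I : Type*} {P Q : (I → K) → Prop} (hP : Gen P) (hQ : Gen Q) :
    ∃ t, P t ∧ Q t := (hP.and hQ).exists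

theorem prodIdeal_of_nil_mem {N : Set (List ℕ)} (h : [] ∈ N) (v : ℕ → A) (L : Submodule K A)
    (r : ℕ) : L ^ r ≤ prodIdeal N v L r := by
  have := le_prodIdeal (K := K) (v := v) (L := L) (r := r) h (by simp)
  simpa [one_eq_span.symm] using this

/-- The remainder term `L ^ (r - b) * ω`, present when `b ≤ r`. -/
noncomputable def restTerm (L : Submodule K A) (w : A) (r b : ℕ) : Submodule K A :=
  if b ≤ r then L ^ (r - b) * (K ∙ w) else ⊥

theorem restTerm_mono {L L' : Submodule K A} (h : L ≤ L') (w : A) (r b : ℕ) :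
    restTerm L w r b ≤ restTerm L' w r b := by
  unfold restTerm
  split_ifs
  · exact mul_le_mul_left (pow_le_pow_left' h _) _
  · exact le_rfl

theorem mul_restTerm_le {L : Submodule K A} {y : A} (hy : y ∈ L) (w : A) (r b : ℕ) :
    (K ∙ y) * restTerm L w r b ≤ restTerm L w (r + 1) b := by
  unfold restTerm
  by_cases h : b ≤ r
  · rw [if_pos h, if_pos (by omega), ← mul_assoc, Nat.sub_add_comm h, pow_succ']
    exact mul_le_mul_left (mul_le_mul_left ((span_singleton_le_iff_mem _ _).2 hy) _) _
  · rw [if_neg h]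
    simp

theorem topProd_mem (hτ : τ ≤ 1) {a Z r b : ℕ} (h : Z + τ ≥ a + τ * r) (h' : a ≤ Z) (hb : b ≤ r) :
    topProd x τ Z b ∈ spanIcc K x a Z ^ b := by
  have := map_prod_mem_pow (L := spanIcc K x a Z) (v := fun j => x (Z + τ * (j + 1) - τ * b))
    (List.range b) (fun j hj => mem_spanOn (by
      rw [List.mem_range] at hj
      rcases Nat.le_one_iff_eq_zero_or_eq_one.1 hτ with rfl | rfl
      · simp; omega
      · simp only [Set.mem_Icc]; omega))
  rw [List.length_range] at this
  exact this

theorem restTerm_le (hτ : τ ≤ 1) {a Z r b : ℕ} (h : Z + τ ≥ a + τ * r) (h' : a ≤ Z) :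
    restTerm (spanIcc K x a Z) (topProd x τ Z b) r b ≤ spanIcc K x a Z ^ r := by
  unfold restTerm
  split_ifs with hb
  · calc _ ≤ spanIcc K x a Z ^ (r - b) * spanIcc K x a Z ^ b :=
        mul_le_mul_right ((span_singleton_le_iff_mem _ _).2 (topProd_mem hτ h h' hb)) _
      _ = _ := by rw [← pow_add, Nat.sub_add_cancel hb]
  · exact bot_le

theorem mul_le_pow_succ {L : Submodule K A} {y : A} (hy : y ∈ L) {X : Submodule K A} {r : ℕ}
    (hX : X ≤ L ^ r) : (K ∙ y) * X ≤ L ^ (r + 1) := by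
  rw [pow_succ']
  exact mul_le_mul' ((span_singleton_le_iff_mem _ _).2 hy) hX

/-- Two families of linear forms can be replaced by a common one. -/
theorem exists_common_forms [Infinite K] {La Lx E E' : Submodule K A}
    {Nn Nx : Set (List ℕ)} {y : A} {vn vx : ℕ → A} {r : ℕ}
    [FiniteDimensional K ↥(La ^ (r + 1))] (hy : y ∈ La)
    (hvn : ∀ j, vn j ∈ La) (hvx : ∀ j, vx j ∈ La) (hE : E ≤ La ^ (r + 1)) (hE' : E' ≤ La ^ r)
    (hLx : Lx ≤ La)
    (h1 : La ^ (r + 1) ≤ prodIdeal Nn vn La (r + 1) ⊔ E ⊔ (K ∙ y) * Lx ^ r)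
    (h2 : (K ∙ y) * La ^ r ≤ (K ∙ y) * (prodIdeal Nx vx La r ⊔ E')) :
    ∃ u : ℕ → A, (∀ j, u j ∈ La) ∧
      La ^ (r + 1) ≤ prodIdeal Nn u La (r + 1) ⊔ E ⊔ (K ∙ y) * Lx ^ r ∧
      (K ∙ y) * La ^ r ≤ (K ∙ y) * (prodIdeal Nx u La r ⊔ E') := by
  let u : (Unit → K) → ℕ → A := fun t j => (1 - t ()) • vn j + t () • vx j
  have hu : ∀ t j, u t j ∈ La := fun t j =>
    add_mem (smul_mem _ _ (hvn j)) (smul_mem _ _ (hvx j))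
  have hup : ∀ j, (fun t => u t j) ∈ polyMaps K Unit A := fun j => by
    have h1 := coord_mem_polyMaps (1 - MvPolynomial.X () : MvPolynomial Unit K) (vn j)
    have h2 := coord_mem_polyMaps (MvPolynomial.X () : MvPolynomial Unit K) (vx j)
    convert add_mem h1 h2 using 1
    funext t
    simp [u]
  have hu0 : u (fun _ => 0) = vn := by funext j; simp [u]
  have hu1 : u (fun _ => 1) = vx := by funext j; simp [u]
  have fd : FiniteDimensional K ↥((K ∙ y) * La ^ r) :=
    Submodule.finiteDimensional_of_le (mul_le_pow_succ hy le_rfl)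
  have g1 : Gen fun t => La ^ (r + 1) ≤ prodIdeal Nn (u t) La (r + 1) ⊔ E ⊔ (K ∙ y) * Lx ^ r := by
    refine PolyFam.gen_le (((polyFam_prodIdeal Nn hup La (r + 1)).sup (.const E)).sup
      (.const _)) _ (fun t => ?_) (fun _ => 0) (by simpa [hu0] using h1)
    exact sup_le (sup_le (prodIdeal_le (hu t)) hE)
      (mul_le_pow_succ hy (pow_le_pow_left' hLx _))
  have g2 : Gen fun t => (K ∙ y) * La ^ r ≤ (K ∙ y) * (prodIdeal Nx (u t) La r ⊔ E') := by
    refine PolyFam.gen_le ((PolyFam.const _).mul ((polyFam_prodIdeal Nx hup La r).sup (.const E')))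
      _ (fun t => ?_) (fun _ => 1) (by simpa [hu1] using h2)
    exact mul_le_mul_right (sup_le (prodIdeal_le (hu t)) hE') _
  obtain ⟨t, ht1, ht2⟩ := exists_common g1 g2
  exact ⟨u t, hu t, ht1, ht2⟩

/-- The span of the products `(y - ε l • z) * u_l` times a power of `La`. -/
noncomputable def glueTerm (La : Submodule K A) (Nx : Set (List ℕ)) (y z : A) (u : ℕ → A) (r : ℕ)
    (ε : List ℕ → K) : Submodule K A :=
  ⨆ l : {l : List ℕ // l ∈ Nx ∧ l.length ≤ r},
    (K ∙ ((y - ε l.1 • z) * (l.1.map u).prod)) * La ^ (r - l.1.length)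

theorem glueTerm_le {La : Submodule K A} {Nx : Set (List ℕ)} {y z : A} {u : ℕ → A} {r : ℕ}
    (hy : y ∈ La) (hz : z ∈ La) (hu : ∀ j, u j ∈ La) (ε : List ℕ → K) :
    glueTerm La Nx y z u r ε ≤ La ^ (r + 1) := by
  refine iSup_le fun ⟨l, hl, hlr⟩ => ?_
  have hm : (y - ε l • z) * (l.map u).prod ∈ La ^ (l.length + 1) := by
    rw [pow_succ']
    exact mul_mem_mul (sub_mem hy (smul_mem _ _ hz)) (map_prod_mem_pow l fun j _ => hu j)
  calc (K ∙ ((y - ε l • z) * (l.map u).prod)) * La ^ (r - l.length)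
      ≤ La ^ (l.length + 1) * La ^ (r - l.length) :=
        mul_le_mul_left ((span_singleton_le_iff_mem _ _).2 hm) _
    _ = La ^ (r + 1) := by rw [← pow_add, show l.length + 1 + (r - l.length) = r + 1 by omega]

theorem mul_prodIdeal_le_glueTerm (La : Submodule K A) (Nx : Set (List ℕ)) (y z : A) (u : ℕ → A)
    (r : ℕ) : (K ∙ y) * prodIdeal Nx u La r ≤ glueTerm La Nx y z u r 0 := by
  rw [prodIdeal, Submodule.mul_iSup]
  refine iSup_mono fun ⟨l, hl, hlr⟩ => ?_
  rw [← mul_assoc, span_mul_span, Set.singleton_mul_singleton]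
  simp

theorem polyFam_glueTerm (La : Submodule K A) (Nx : Set (List ℕ)) (y z : A) (u : ℕ → A)
    (r : ℕ) (ε : List ℕ → K) :
    PolyFam fun s : Unit → K => glueTerm La Nx y z u r fun l => s () * ε l := by
  refine .iSup fun l => (PolyFam.singleton ?_).mul (.const _)
  refine mul_mem_polyMaps ?_ (const_mem_polyMaps _)
  have h2 := coord_mem_polyMaps (MvPolynomial.X () * MvPolynomial.C (ε l.1) :
    MvPolynomial Unit K) z
  convert sub_mem (const_mem_polyMaps (K := K) (I := Unit) y) h2 using 1
  funext s
  simp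

theorem exists_scalar [Infinite K] {La X : Submodule K A} {Nx : Set (List ℕ)} {y z : A}
    {u : ℕ → A} {r : ℕ} [FiniteDimensional K ↥(La ^ (r + 1))] (hy : y ∈ La) (hz : z ∈ La)
    (hu : ∀ j, u j ∈ La) (hX : X ≤ La ^ (r + 1))
    (h : La ^ (r + 1) ≤ X ⊔ (K ∙ y) * prodIdeal Nx u La r) (ε : List ℕ → K) :
    ∃ s : K, s ≠ 0 ∧ La ^ (r + 1) ≤ X ⊔ glueTerm La Nx y z u r fun l => s * ε l := by
  have g1 : Gen fun s : Unit → K => La ^ (r + 1) ≤ X ⊔ glueTerm La Nx y z u r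
      fun l => s () * ε l := by
    refine ((PolyFam.const X).sup (polyFam_glueTerm La Nx y z u r ε)).gen_le _
      (fun s => sup_le hX (glueTerm_le hy hz hu _)) (fun _ => 0) (h.trans (sup_le_sup le_rfl ?_))
    have := mul_prodIdeal_le_glueTerm La Nx y z u r
    simp only [zero_mul]
    exact this
  have g2 : Gen fun s : Unit → K => s () ≠ 0 :=
    ⟨MvPolynomial.X (), MvPolynomial.X_ne_zero _, fun s hs => by simpa using hs⟩
  obtain ⟨s, hs, hs0⟩ := exists_common g1 g2
  exact ⟨s (), hs0, hs⟩

theorem prodIdeal_le_prodIdeal {La : Submodule K A} {N Nn : Set (List ℕ)} {u v : ℕ → A} {r p : ℕ}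
    {s : K} (hs : s ≠ 0) (hv : v p + v (p + 1) = s • u (p + 1)) (hvu : ∀ j, p + 2 ≤ j → v j = u j)
    (hNn : ∀ l ∈ Nn, l ∈ N) (hNnp : ∀ g, (p + 1) :: g ∈ Nn → p :: g ∈ N)
    (hNnl : ∀ l ∈ Nn, l.Pairwise (· < ·) ∧ ∀ j ∈ l, p + 1 ≤ j) :
    prodIdeal Nn u La r ≤ prodIdeal N v La r := by
  have hvj : ∀ l : List ℕ, (∀ j ∈ l, p + 2 ≤ j) → (l.map v).prod = (l.map u).prod :=
    fun l hl => map_prod_congr fun j hj => hvu j (hl j hj)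
  refine iSup_le fun ⟨l, hl, hlr⟩ => ?_
  simp only at hlr ⊢
  obtain ⟨hpw, hge⟩ := hNnl l hl
  rcases l with _ | ⟨q, g⟩
  · rw [← hvj [] (by simp)]
    exact le_prodIdeal (hNn _ hl) hlr
  rw [List.pairwise_cons] at hpw
  have hq := hge q (by simp)
  have hg : ∀ j ∈ g, p + 2 ≤ j := fun j hj => by have := hpw.1 j hj; omega
  by_cases hqp : q = p + 1
  · subst hqp
    have e1 := le_prodIdeal (K := K) (v := v) (L := La) (hNn _ hl) hlr
    have e2 := le_prodIdeal (K := K) (v := v) (L := La) (r := r) (hNnp g hl) hlr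
    have : (K ∙ (((p + 1) :: g).map u).prod) ≤
        (K ∙ (((p + 1) :: g).map v).prod) ⊔ (K ∙ ((p :: g).map v).prod) := by
      rw [span_singleton_le_iff_mem]
      have : (((p + 1) :: g).map u).prod = s⁻¹ •
          ((((p + 1) :: g).map v).prod + ((p :: g).map v).prod) := by
        simp only [List.map_cons, List.prod_cons, hvj g hg]
        rw [← add_mul, add_comm (v (p + 1)), hv, smul_mul_assoc, smul_smul, inv_mul_cancel₀ hs,
          one_smul]
      rw [this]
      exact smul_mem _ _ (add_mem (mem_sup_left (mem_span_singleton_self _))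
        (mem_sup_right (mem_span_singleton_self _)))
    refine (mul_le_mul_left this _).trans ?_
    rw [Submodule.sup_mul]
    exact sup_le e1 e2
  · rw [← hvj (q :: g) fun j hj => by
      rcases List.mem_cons.1 hj with rfl | hj
      · omega
      · exact hg j hj]
    exact le_prodIdeal (hNn _ hl) hlr

theorem glueTerm_le_prodIdeal {La : Submodule K A} {N Nx : Set (List ℕ)} {y z : A}
    {u v : ℕ → A} {r p : ℕ} {ε : List ℕ → K} (hvp : v p = y)
    (hvu : ∀ j, p + 2 ≤ j → v j = u j)
    (hNx : ∀ l ∈ Nx, (p :: l ∈ N ∧ ε l = 0) ∨ ((p + 1) :: l ∈ N ∧ v (p + 1) = ε l • z - y))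
    (hNxl : ∀ l ∈ Nx, ∀ j ∈ l, p + 2 ≤ j) :
    glueTerm La Nx y z u r ε ≤ prodIdeal N v La (r + 1) := by
  refine iSup_le fun ⟨l, hl, hlr⟩ => ?_
  simp only at hlr ⊢
  have hlv : (l.map v).prod = (l.map u).prod := map_prod_congr fun j hj => hvu j (hNxl l hl j hj)
  rcases hNx l hl with ⟨hpl, hε⟩ | ⟨hpl, hε⟩
  · have e1 := le_prodIdeal (K := K) (v := v) (L := La) (r := r + 1) hpl (by simpa using hlr)
    simp only [List.map_cons, List.prod_cons, hvp, hlv, List.length_cons,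
      Nat.add_sub_add_right] at e1
    rwa [hε, zero_smul, sub_zero]
  · have e1 := le_prodIdeal (K := K) (v := v) (L := La) (r := r + 1) hpl (by simpa using hlr)
    simp only [List.map_cons, List.prod_cons, hε, hlv, List.length_cons,
      Nat.add_sub_add_right] at e1
    refine le_trans (mul_le_mul_left ?_ _) e1
    rw [span_singleton_le_iff_mem, mem_span_singleton]
    exact ⟨-1, by rw [← smul_mul_assoc, neg_one_smul, neg_sub]⟩

/-- The gluing step: from the two smaller families to the larger one. -/
theorem exists_glued_forms [Infinite K] {La E E' Lx : Submodule K A}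
    {N Nn Nx : Set (List ℕ)} {y : A} {u : ℕ → A} {r p : ℕ}
    [FiniteDimensional K ↥(La ^ (r + 1))] (hy : y ∈ La) (hu : ∀ j, u j ∈ La)
    (hE : E ≤ La ^ (r + 1)) (hEE : (K ∙ y) * E' ≤ E) (hLx : Lx ≤ La)
    (h1 : La ^ (r + 1) ≤ prodIdeal Nn u La (r + 1) ⊔ E ⊔ (K ∙ y) * Lx ^ r)
    (h2 : (K ∙ y) * La ^ r ≤ (K ∙ y) * (prodIdeal Nx u La r ⊔ E'))
    (hNn : ∀ l ∈ Nn, l ∈ N) (hNnp : ∀ g, (p + 1) :: g ∈ Nn → p :: g ∈ N)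
    (hNnl : ∀ l ∈ Nn, l.Pairwise (· < ·) ∧ ∀ j ∈ l, p + 1 ≤ j)
    (hNx : ∀ l ∈ Nx, p :: l ∈ N ∨ (p + 1) :: l ∈ N)
    (hNxl : ∀ l ∈ Nx, ∀ j ∈ l, p + 2 ≤ j) :
    ∃ v : ℕ → A, (∀ j, v j ∈ La) ∧ La ^ (r + 1) ≤ prodIdeal N v La (r + 1) ⊔ E := by
  obtain ⟨ε, hε⟩ : ∃ ε : List ℕ → K, ∀ l ∈ Nx,
      (p :: l ∈ N ∧ ε l = 0) ∨ ((p + 1) :: l ∈ N ∧ ε l = 1) := by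
    have : ∀ l, ∃ c : K, l ∈ Nx → (p :: l ∈ N ∧ c = 0) ∨ ((p + 1) :: l ∈ N ∧ c = 1) := fun l => by
      by_cases hl : l ∈ Nx
      · rcases hNx l hl with h | h
        · exact ⟨0, fun _ => .inl ⟨h, rfl⟩⟩
        · exact ⟨1, fun _ => .inr ⟨h, rfl⟩⟩
      · exact ⟨0, fun h => absurd h hl⟩
    choose ε hε using this
    exact ⟨ε, hε⟩
  have hX : La ^ (r + 1) ≤ prodIdeal Nn u La (r + 1) ⊔ E ⊔ (K ∙ y) * prodIdeal Nx u La r := by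
    refine h1.trans (sup_le le_sup_left ?_)
    refine (mul_le_mul_right (pow_le_pow_left' hLx _) _).trans (h2.trans ?_)
    rw [Submodule.mul_sup]
    exact sup_le le_sup_right (hEE.trans (le_sup_right.trans le_sup_left))
  obtain ⟨s, hs0, hs⟩ := exists_scalar (z := u (p + 1)) hy (hu _) hu
    (sup_le (prodIdeal_le hu) hE) hX ε
  obtain ⟨v, hvp, hvp1, hvu, hv⟩ : ∃ v : ℕ → A, v p = y ∧ v (p + 1) = s • u (p + 1) - y ∧
      (∀ j, p + 2 ≤ j → v j = u j) ∧ ∀ j, v j ∈ La := by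
    refine ⟨fun j => if j = p then y else if j = p + 1 then s • u (p + 1) - y else u j,
      by simp, by simp, fun j hj => by simp only; rw [if_neg (by omega), if_neg (by omega)],
      fun j => ?_⟩
    simp only
    split_ifs
    · exact hy
    · exact sub_mem (smul_mem _ _ (hu _)) hy
    · exact hu j
  refine ⟨v, hv, hs.trans (sup_le (sup_le ?_ le_sup_right) ?_)⟩
  · exact (prodIdeal_le_prodIdeal hs0 (by rw [hvp, hvp1]; abel) hvu hNn hNnp hNnl).trans le_sup_left
  · refine (glueTerm_le_prodIdeal hvp hvu (fun l hl => ?_) hNxl).trans le_sup_left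
    rcases hε l hl with ⟨h, h'⟩ | ⟨h, h'⟩
    · exact .inl ⟨h, by rw [h', mul_zero]⟩
    · exact .inr ⟨h, by rw [h', mul_one, hvp1]⟩

theorem exists_forms [Infinite K] (hx : SignComm K x τ) (n M c b : ℕ) :
    ∀ (k e i σ r a Z : ℕ) (W : Set (List ℕ)), k = M - i + e → Good i M e W → i ≤ M →
      n + 2 = M + σ + 2 * e + c → 2 * r + 2 = b + 2 * e + c → Z + τ = a + (M - i) + τ * r →
      ∃ v : ℕ → A, (∀ j, v j ∈ spanIcc K x a Z) ∧ spanIcc K x a Z ^ r ≤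
        prodIdeal (NF n i σ M e W) v (spanIcc K x a Z) r ⊔
          restTerm (spanIcc K x a Z) (topProd x τ Z b) r b := by
  have hτ : τ ≤ 1 := by rcases hx.sq with h | h <;> omega
  intro k
  induction k with
  | zero =>
    intro e i σ r a Z W hk hW hi hn hr hZ
    have hnil : [] ∈ NF n i σ M e W := by
      refine ⟨by simp, by simp, Or.inl ⟨[], ⟨by simp; omega, by simp, by simp⟩, fun h => ?_, ?_⟩⟩
      · exact absurd (hW.top _ h) (by simp)
      · simp [phi2]
    exact ⟨0, fun j => zero_mem _, (prodIdeal_of_nil_mem hnil _ _ _).trans le_sup_left⟩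
  | succ k ih =>
    intro e i σ r a Z W hk hW hi hn hr hZ
    by_cases hMW : List.replicate e M ∈ W
    swap
    · have hnil : [] ∈ NF n i σ M e W := by
        refine ⟨by simp, by simp, Or.inl ⟨_, replicate_mem_Lst hi M hi le_rfl, hMW, ?_⟩⟩
        cases e <;> simp [phi2, List.replicate_succ]
      exact ⟨0, fun j => zero_mem _, (prodIdeal_of_nil_mem hnil _ _ _).trans le_sup_left⟩
    obtain ⟨e, rfl⟩ : ∃ e', e = e' + 1 := ⟨e - 1, by
      rcases e with _ | e
      · exact absurd (hW.top _ hMW) (by simp)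
      · rfl⟩
    by_cases hb0 : b = 0
    · subst hb0
      refine ⟨0, fun j => zero_mem _, le_trans ?_ le_sup_right⟩
      simp [restTerm, topProd, one_eq_span.symm]
    obtain ⟨r, rfl⟩ : ∃ r', r = r' + 1 := ⟨r - 1, by omega⟩
    by_cases hiM : i < M
    · have haZ : a ≤ Z := by
        have : τ * (r + 1) ≥ τ := by rw [mul_add]; omega
        omega
      have hmul : τ * (r + 1) = τ * r + τ := by ring
      obtain ⟨vn, hvn, hn1⟩ := ih (e + 1) (i + 1) σ (r + 1) (a + 1) Z (Wn i W) (by omega) hW.wn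
        (by omega) hn hr (by omega)
      obtain ⟨vx, hvx, hx1⟩ := ih e i (σ + 2) r (a + τ) Z (Wx i W) (by omega) (hW.wx hiM)
        (by omega) (by omega) (by omega) (by omega)
      have hle1 : spanIcc K x (a + 1) Z ≤ spanIcc K x a Z :=
        spanOn_mono (Set.Icc_subset_Icc_left (by omega))
      have hleτ : spanIcc K x (a + τ) Z ≤ spanIcc K x a Z :=
        spanOn_mono (Set.Icc_subset_Icc_left (by omega))
      have hy : x a ∈ spanIcc K x a Z := mem_spanOn ⟨le_rfl, haZ⟩
      have hE : restTerm (spanIcc K x a Z) (topProd x τ Z b) (r + 1) b ≤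
          spanIcc K x a Z ^ (r + 1) := restTerm_le hτ (by omega) haZ
      have hE' : restTerm (spanIcc K x a Z) (topProd x τ Z b) r b ≤ spanIcc K x a Z ^ r :=
        restTerm_le hτ (by omega) haZ
      have := spanOn_fg (K := K) (x := x) (Set.finite_Icc a Z) (r + 1)
      obtain ⟨u, hu, hu1, hu2⟩ := exists_common_forms (La := spanIcc K x a Z)
        (Lx := spanIcc K x (a + τ) Z) hy (fun j => hle1 (hvn j))
        (fun j => hleτ (hvx j)) hE hE' hleτ
        ((hx.pow_le' haZ r).trans (sup_le_sup (hn1.trans (sup_le_sup (prodIdeal_mono_right hle1)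
          (restTerm_mono hle1 _ _ _))) le_rfl))
        ((hx.mul_pow_le haZ r).trans (mul_le_mul_right (hx1.trans (sup_le_sup
          (prodIdeal_mono_right hleτ) (restTerm_mono hleτ _ _ _))) _))
      refine exists_glued_forms (p := i + σ) hy hu hE (mul_restTerm_le hy _ _ _) hleτ hu1 hu2
        (fun l hl => NF_wn_mem hl) (fun g hg => NF_wn_cons hW hiM hn hg)
        (fun l hl => ⟨hl.1, fun j hj => ?_⟩) (fun l hl => NF_wx hW hiM hn hl)
        (fun l hl j hj => ?_)
      · have := (hl.2.1 j hj).1; omega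
      · have := (hl.2.1 j hj).1; omega
    · obtain rfl : i = M := by omega
      have hZ' : Z + τ = a + τ * (r + 1) := by omega
      by_cases hbr : b ≤ r + 1
      · refine ⟨0, fun j => zero_mem _, le_trans ?_ le_sup_right⟩
        rw [restTerm, if_pos hbr]
        exact hx.pow_le_topProd hZ' hbr
      · obtain ⟨w, hw, hwr⟩ := hx.exists_pow_le hZ'
        have hq : 2 * e + c + 1 ≤ r + 1 := by omega
        refine ⟨fun j => if j - (i + σ) < r + 1 then w (j - (i + σ)) else 0, fun j => ?_, ?_⟩
        · simp only
          split_ifs with hj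
          · exact hw _ hj
          · exact zero_mem _
        · refine le_trans (le_trans (hwr _ hq) ?_) le_sup_left
          have hmem : List.range' (i + σ) (2 * e + c + 1) ∈ NF n i σ i (e + 1) W := by
            refine ⟨List.pairwise_lt_range', fun y hy => ?_, Or.inr ⟨_, hMW, ?_⟩⟩
            · rw [List.mem_range'_1] at hy; omega
            · rw [List.replicate_succ, intl, if_neg (lt_irrefl _),
                show n + 1 - (i + σ) = 2 * e + c + 1 by omega]
          have := le_prodIdeal (K := K)
            (v := fun j => if j - (i + σ) < r + 1 then w (j - (i + σ)) else 0)
            (L := spanIcc K x a Z) (r := r + 1) hmem (by simpa using hq)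
          rw [List.length_range'] at this
          convert this using 4
          rw [List.range'_eq_map_range, List.map_map]
          refine congrArg List.prod (List.map_congr_left fun j hj => ?_)
          rw [List.mem_range] at hj
          simp only [Function.comp_apply, Nat.add_sub_cancel_left]
          rw [if_pos (by omega)]

end MainP
end Squeezed

namespace Squeezed

/-- The union of the pairs `{a_l + σ + 2 l, a_l + σ + 2 l + 1}`, truncated at `n`. -/
def fac (n : ℕ) : ℕ → List ℕ → Finset ℕ
  | _, [] => ∅
  | σ, a :: s => ({a + σ, a + σ + 1} : Finset ℕ).filter (· ≤ n) ∪ fac n (σ + 2) s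

/-- The boundary of a family of facets with `k + 1` elements. -/
def bd (k : ℕ) (𝓕 : Set (Finset ℕ)) : Set (Finset ℕ) :=
  {G | ∃ R, G ⊆ R ∧ R.card = k ∧ ∃! H, H ∈ 𝓕 ∧ R ⊆ H}

theorem mem_fac_cons {n σ a y : ℕ} {s : List ℕ} :
    y ∈ fac n σ (a :: s) ↔ ((y = a + σ ∨ y = a + σ + 1) ∧ y ≤ n) ∨ y ∈ fac n (σ + 2) s := by
  simp [fac]

theorem le_of_mem_fac {n M : ℕ} {t : List ℕ} {i σ e : ℕ} (h : t ∈ Lst i M e) {y : ℕ}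
    (hy : y ∈ fac n σ t) : i + σ ≤ y ∧ y ≤ n := by
  induction t generalizing i σ e with
  | nil => simp [fac] at hy
  | cons a t ih =>
    obtain ⟨e, rfl⟩ : ∃ e', e = e' + 1 := ⟨t.length, h.1.symm⟩
    have h' := Lst_cons_iff.1 h
    rcases mem_fac_cons.1 hy with hy | hy
    · omega
    · have := ih h'.2.2 hy
      omega

theorem fac_card_le (n : ℕ) (t : List ℕ) (σ : ℕ) : (fac n σ t).card ≤ 2 * t.length := by
  induction t generalizing σ with
  | nil => simp [fac]
  | cons a t ih =>
    rw [fac, List.length_cons]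
    refine (Finset.card_union_le _ _).trans ?_
    have := ih (σ + 2)
    have h1 := Finset.card_filter_le ({a + σ, a + σ + 1} : Finset ℕ) (· ≤ n)
    have h2 := Finset.card_le_two (a := a + σ) (b := a + σ + 1)
    omega

theorem eq_replicate_of_mem_Lst {M e : ℕ} {t : List ℕ} (h : t ∈ Lst M M e) :
    t = List.replicate e M :=
  List.eq_replicate_iff.2 ⟨h.1, fun b hb => le_antisymm (h.2.2 b hb).2 (h.2.2 b hb).1⟩

theorem Lst_le_replicate {i M e : ℕ} {t s : List ℕ} (h : t ∈ Lst i M e) (hs : s ∈ Lst M M e) :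
    List.Forall₂ (· ≤ ·) t s := by
  induction t generalizing i e s with
  | nil =>
    have := h.1
    have h2 := hs.1
    rcases s with _ | _
    · exact .nil
    · simp at this h2; omega
  | cons a t ih =>
    obtain ⟨e, rfl⟩ : ∃ e', e = e' + 1 := ⟨t.length, h.1.symm⟩
    rcases s with _ | ⟨b, s⟩
    · exact absurd hs.1 (by simp)
    have h' := Lst_cons_iff.1 h
    have hs' := Lst_cons_iff.1 hs
    exact .cons (by omega) (ih h'.2.2 (Lst_mono hs'.1 hs'.2.2))

theorem fac_replicate {n M : ℕ} (e σ c : ℕ) (hc : c ≤ 1) (hn : n + 2 = M + σ + 2 * e + c) :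
    fac n σ (List.replicate e M) = Finset.Icc (M + σ) n := by
  induction e generalizing σ with
  | zero =>
    simp only [List.replicate_zero, fac]
    rw [Finset.Icc_eq_empty]
    omega
  | succ e ih =>
    ext y
    rw [List.replicate_succ, mem_fac_cons, ih (σ + 2) (by omega)]
    simp only [Finset.mem_Icc]
    omega

theorem fac_card {n M i c : ℕ} {t : List ℕ} (e σ : ℕ) (hc : c ≤ 1)
    (hn : n + 2 = M + σ + 2 * e + c) (ht : t ∈ Lst i M e) (hM : M ∈ t) :
    (fac n σ t).card + 1 = 2 * e + c := by
  induction t generalizing i σ e with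
  | nil => simp at hM
  | cons a t ih =>
    obtain ⟨e, rfl⟩ : ∃ e', e = e' + 1 := ⟨t.length, ht.1.symm⟩
    have h' := Lst_cons_iff.1 ht
    by_cases haM : a = M
    · subst haM
      have := eq_replicate_of_mem_Lst (Lst_cons_iff.2 ⟨le_rfl, le_rfl, h'.2.2⟩)
      rw [this, fac_replicate _ _ c hc hn, Nat.card_Icc]
      omega
    · have hMt : M ∈ t := (List.mem_cons.1 hM).resolve_left (Ne.symm haM)
      have he : 0 < e := by rw [← h'.2.2.1]; exact List.length_pos_of_mem hMt
      have := ih e (σ + 2) (by omega) h'.2.2 hMt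
      rw [fac, Finset.card_union_of_disjoint, Finset.filter_true_of_mem, Finset.card_pair]
      · omega
      · omega
      · intro y hy
        simp only [Finset.mem_insert, Finset.mem_singleton] at hy
        omega
      · rw [Finset.disjoint_left]
        intro y hy hy'
        have := le_of_mem_fac h'.2.2 hy'
        simp only [Finset.mem_filter, Finset.mem_insert, Finset.mem_singleton] at hy
        omega

theorem le_of_phi2_subset {n M : ℕ} {s t : List ℕ} (i σ e : ℕ) (hs : s ∈ Lst i M e)
    (ht : t ∈ Lst i M e) (h : ∀ y ∈ phi2 M σ s, y ∈ fac n σ t) : List.Forall₂ (· ≤ ·) t s := by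
  induction s generalizing i σ e t with
  | nil =>
    have h1 := hs.1
    have h2 := ht.1
    rcases t with _ | _
    · exact .nil
    · simp at h1 h2; omega
  | cons b s ih =>
    obtain ⟨e, rfl⟩ : ∃ e', e = e' + 1 := ⟨s.length, hs.1.symm⟩
    rcases t with _ | ⟨a, t⟩
    · exact absurd ht.1 (by simp)
    have hs' := Lst_cons_iff.1 hs
    have ht' := Lst_cons_iff.1 ht
    by_cases hb : b < M
    · rw [phi2, if_pos hb] at h
      have hab : a ≤ b := by
        have := (le_of_mem_fac (Lst_cons_iff.2 ⟨le_rfl, ht'.2.1, ht'.2.2⟩) (h (b + σ) (by simp))).1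
        omega
      refine .cons hab (ih i (σ + 2) e (Lst_mono hs'.1 hs'.2.2) (Lst_mono ht'.1 ht'.2.2)
        fun y hy => ?_)
      have := le_of_mem_phi2 hs'.2.2 y hy
      rcases mem_fac_cons.1 (h y (by simp [hy])) with h | h
      · omega
      · exact h
    · exact Lst_le_replicate ht (Lst_cons_iff.2 ⟨by omega, by omega, Lst_mono (by omega) hs'.2.2⟩)

theorem not_intl_subset {n M c : ℕ} {s t : List ℕ} (i j σ e : ℕ) (hc : c ≤ 1)
    (hn : n + 2 = M + σ + 2 * (e + 1) + c) (hs : s ∈ Lst i M (e + 1)) (ht : t ∈ Lst j M e)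
    (h : ∀ y ∈ intl M n σ s, y ∈ fac n (σ + 2) t) : False := by
  induction s generalizing i j σ e t with
  | nil => exact absurd hs.1 (by simp)
  | cons b s ih =>
    have hs' := Lst_cons_iff.1 hs
    rw [intl] at h
    by_cases hb : b < M
    · rw [if_pos hb] at h
      rcases t with _ | ⟨a, t⟩
      · exact absurd (h (b + σ + 1) List.mem_cons_self) (by simp [fac])
      obtain ⟨e, rfl⟩ : ∃ e', e = e' + 1 := ⟨t.length, ht.1.symm⟩
      have ht' := Lst_cons_iff.1 ht
      have hab := (le_of_mem_fac (Lst_cons_iff.2 ⟨le_rfl, ht'.2.1, ht'.2.2⟩)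
        (h (b + σ + 1) (by simp))).1
      refine ih b a (σ + 2) e (by omega) hs'.2.2 ht'.2.2 fun y hy => ?_
      have := (le_of_mem_intl hs'.2.2 y hy).2 hb
      rcases mem_fac_cons.1 (h y (by simp [hy])) with h | h
      · omega
      · exact h
    · rw [if_neg hb] at h
      have hsub : Finset.Icc (M + σ) n ⊆ fac n (σ + 2) t := fun y hy => h y (by
        rw [List.mem_range'_1]; rw [Finset.mem_Icc] at hy; omega)
      have h1 := Finset.card_le_card hsub
      have h2 := fac_card_le n t (σ + 2)
      rw [Nat.card_Icc, ht.1] at *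
      omega

/-- Raise the initial run of entries equal to the head. -/
theorem exists_raise {n M : ℕ} {t : List ℕ} (a σ e : ℕ) (ht : a :: t ∈ Lst a M (e + 1))
    (ha : a < M) : ∃ t2 ∈ Lst (a + 1) M (e + 1), List.Forall₂ (· ≤ ·) (a :: t) t2 ∧
      (fac n σ (a :: t)).erase (a + σ) ⊆ fac n σ t2 := by
  induction t generalizing σ e with
  | nil =>
    have h0 : e = 0 := by have := ht.1; simp at this; omega
    subst h0
    refine ⟨[a + 1], ⟨by simp, by simp, by simp; omega⟩, by simp, fun y hy => ?_⟩
    rw [Finset.mem_erase, mem_fac_cons] at hy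
    rw [mem_fac_cons]
    simp only [fac, Finset.notMem_empty, or_false] at hy ⊢
    omega
  | cons b t ih =>
    obtain ⟨e, rfl⟩ : ∃ e', e = e' + 1 := ⟨t.length, by have := ht.1; simp at this; omega⟩
    have ht' := Lst_cons_iff.1 ht
    have hb' := Lst_cons_iff.1 ht'.2.2
    by_cases hb : b = a
    · subst hb
      obtain ⟨t2, h1, h2, h3⟩ := ih (σ + 2) e ht'.2.2
      refine ⟨(b + 1) :: t2, Lst_cons_iff.2 ⟨le_rfl, ha, h1⟩, .cons (by omega) h2, fun y hy => ?_⟩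
      rw [Finset.mem_erase, mem_fac_cons] at hy
      rw [mem_fac_cons]
      rcases hy with ⟨hne, hy | hy⟩
      · left; omega
      · by_cases hyb : y = b + (σ + 2)
        · have := le_of_mem_fac ht'.2.2 hy
          left; omega
        · exact .inr (h3 (Finset.mem_erase.2 ⟨hyb, hy⟩))
    · refine ⟨(a + 1) :: b :: t, Lst_cons_iff.2 ⟨le_rfl, ha, Lst_cons_iff.2
        ⟨by omega, hb'.2.1, hb'.2.2⟩⟩, .cons (by omega) (Forall₂_le_refl _), fun y hy => ?_⟩
      rw [Finset.mem_erase, mem_fac_cons] at hy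
      rw [mem_fac_cons]
      rcases hy with ⟨hne, hy | hy⟩
      · left; omega
      · exact .inr hy

theorem le_of_forall₂ {a : ℕ} {s t : List ℕ} (hs : ∀ x ∈ s, a ≤ x)
    (h : List.Forall₂ (· ≤ ·) s t) : ∀ x ∈ t, a ≤ x := by
  induction h with
  | nil => simp
  | cons h1 h2 ih =>
    simp only [List.mem_cons, forall_eq_or_imp] at hs ⊢
    exact ⟨hs.1.trans h1, ih hs.2⟩

theorem Forall₂_le_succ_refl (s : List ℕ) : List.Forall₂ (fun a b => a ≤ b + 1) s s :=
  List.forall₂_same.2 fun _ _ => by omega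

theorem mem_tail_of_mem_Lst {i M e a : ℕ} {t : List ℕ} (ht : a :: t ∈ Lst i M (e + 1))
    (hM : M ∈ a :: t) (he : e ≠ 0) : M ∈ t := by
  have h' := Lst_cons_iff.1 ht
  rcases List.mem_cons.1 hM with rfl | h
  · rw [eq_replicate_of_mem_Lst h'.2.2]
    exact List.mem_replicate.2 ⟨he, rfl⟩
  · exact h

theorem le_of_intl {n M c : ℕ} {s t : List ℕ} (i σ e : ℕ) (hc : c ≤ 1)
    (hn : n + 2 = M + σ + 2 * e + c) (hs : s ∈ Lst i M e) (ht : t ∈ Lst i M e)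
    (hM : e ≠ 0 → M ∈ t) (h : ∀ y ∈ intl M n σ s, y ∈ fac n σ t) :
    List.Forall₂ (· ≤ ·) s t := by
  induction s generalizing i σ e t with
  | nil =>
    have h1 := hs.1
    have h2 := ht.1
    rcases t with _ | _
    · exact .nil
    · simp at h1 h2; omega
  | cons b s ih =>
    obtain ⟨e, rfl⟩ : ∃ e', e = e' + 1 := ⟨s.length, hs.1.symm⟩
    rcases t with _ | ⟨a, t⟩
    · exact absurd ht.1 (by simp)
    have hs' := Lst_cons_iff.1 hs
    have ht' := Lst_cons_iff.1 ht
    by_cases hb : b < M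
    · have hba : b ≤ a := by
        by_contra hlt
        refine not_intl_subset b a σ e hc (by omega) (Lst_cons_iff.2 ⟨le_rfl, hs'.2.1, hs'.2.2⟩)
          ht'.2.2 (fun y hy => ?_)
        have := (le_of_mem_intl (Lst_cons_iff.2 ⟨le_rfl, hs'.2.1, hs'.2.2⟩) y hy).2 hb
        rcases mem_fac_cons.1 (h y hy) with h | h
        · omega
        · exact h
      refine .cons hba (ih b (σ + 2) e (by omega) hs'.2.2 (Lst_mono hba ht'.2.2)
        (mem_tail_of_mem_Lst ht (hM (by omega))) fun y hy => ?_)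
      rw [intl, if_pos hb] at h
      have h1 := (le_of_mem_intl hs'.2.2 y hy).2 hb
      have h0 := le_of_mem_fac (Lst_cons_iff.2 ⟨le_rfl, ht'.2.1, ht'.2.2⟩) (h (b + σ + 1) (by simp))
      rcases mem_fac_cons.1 (h y (by simp [hy])) with h2 | h2
      · omega
      · exact h2
    · rw [intl, if_neg hb] at h
      have hsub : Finset.Icc (M + σ) n ⊆ fac n σ (a :: t) := fun y hy => h y (by
        rw [List.mem_range'_1]; rw [Finset.mem_Icc] at hy; omega)
      have hcard := fac_card (e + 1) σ hc hn ht (hM (by omega))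
      have heq := Finset.eq_of_subset_of_card_le hsub (by rw [Nat.card_Icc]; omega)
      have ha : a + σ ∈ Finset.Icc (M + σ) n := by
        rw [heq, mem_fac_cons]
        omega
      rw [Finset.mem_Icc] at ha
      exact Lst_le_replicate hs (Lst_cons_iff.2 ⟨by omega, ht'.2.1, Lst_mono (by omega) ht'.2.2⟩)

theorem exists_exchange {n M c : ℕ} {s t : List ℕ} (i σ e p : ℕ) (hc : c ≤ 1)
    (hn : n + 2 = M + σ + 2 * e + c) (hs : s ∈ Lst i M e) (ht : t ∈ Lst i M e)
    (hM : e ≠ 0 → M ∈ t) (hp : p ∈ fac n σ t)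
    (h : ∀ y ∈ intl M n σ s, y ∈ fac n σ t ∧ y ≠ p) :
    ∃ t2 ∈ Lst i M e, p ∉ fac n σ t2 ∧ (fac n σ t).erase p ⊆ fac n σ t2 ∧
      (List.Forall₂ (· ≤ ·) t t2 ∨
        List.Forall₂ (· ≤ ·) s t2 ∧ List.Forall₂ (fun a b => a ≤ b + 1) t t2) := by
  induction s generalizing i σ e t with
  | nil =>
    have h1 := hs.1
    have h2 := ht.1
    rcases t with _ | _
    · simp [fac] at hp
    · simp at h1 h2; omega
  | cons b s ih =>
    obtain ⟨e, rfl⟩ : ∃ e', e = e' + 1 := ⟨s.length, hs.1.symm⟩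
    rcases t with _ | ⟨a, t⟩
    · exact absurd ht.1 (by simp)
    have hs' := Lst_cons_iff.1 hs
    have ht' := Lst_cons_iff.1 ht
    have hta : a :: t ∈ Lst a M (e + 1) := Lst_cons_iff.2 ⟨le_rfl, ht'.2.1, ht'.2.2⟩
    by_cases hb : b < M
    swap
    · rw [intl, if_neg hb] at h
      have hsub : Finset.Icc (M + σ) n ⊆ (fac n σ (a :: t)).erase p := fun y hy => by
        have := h y (by rw [List.mem_range'_1]; rw [Finset.mem_Icc] at hy; omega)
        exact Finset.mem_erase.2 ⟨this.2, this.1⟩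
      have h1 := Finset.card_le_card hsub
      have h2 := fac_card (e + 1) σ hc hn ht (hM (by omega))
      rw [Finset.card_erase_of_mem hp, Nat.card_Icc] at h1
      omega
    have hMt := mem_tail_of_mem_Lst ht (hM (by omega))
    have hh := h
    rw [intl, if_pos hb] at h
    have hab : a ≤ b + 1 := by
      have := (le_of_mem_fac hta (h (b + σ + 1) (by simp)).1).1
      omega
    have hba : b ≤ a := by
      by_contra hlt
      refine not_intl_subset b a σ e hc (by omega) (Lst_cons_iff.2 ⟨le_rfl, hs'.2.1, hs'.2.2⟩)
        ht'.2.2 (fun y hy => ?_)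
      have := (le_of_mem_intl (Lst_cons_iff.2 ⟨le_rfl, hs'.2.1, hs'.2.2⟩) y hy).2 hb
      rcases mem_fac_cons.1 (hh y hy).1 with h | h
      · omega
      · exact h
    have hrest : ∀ y ∈ intl M n (σ + 2) s, y ∈ fac n (σ + 2) t ∧ y ≠ p := fun y hy => by
      have h1 := (le_of_mem_intl hs'.2.2 y hy).2 hb
      have h2 := h y (by simp [hy])
      rcases mem_fac_cons.1 h2.1 with h | h
      · omega
      · exact ⟨h, h2.2⟩
    have hbp := (h (b + σ + 1) (by simp)).2
    rcases mem_fac_cons.1 hp with ⟨rfl | rfl, hpn⟩ | hp'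
    · obtain ⟨t2, h1, h2, h3⟩ := exists_raise (n := n) a σ e hta (by omega)
      refine ⟨t2, Lst_mono (by omega) h1, fun hmem => ?_, h3, .inl h2⟩
      have := le_of_mem_fac h1 hmem
      omega
    · obtain rfl : a = b + 1 := by omega
      refine ⟨b :: t, Lst_cons_iff.2 ⟨by omega, hb.le, Lst_mono (by omega) ht'.2.2⟩, fun hmem => ?_,
        fun y hy => ?_, .inr ⟨.cons le_rfl ?_, .cons le_rfl (Forall₂_le_succ_refl t)⟩⟩
      · rcases mem_fac_cons.1 hmem with h | h
        · omega
        · have := le_of_mem_fac ht'.2.2 h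
          omega
      · rw [Finset.mem_erase, mem_fac_cons] at hy
        rw [mem_fac_cons]
        rcases hy with ⟨hne, hy | hy⟩
        · left; omega
        · exact .inr hy
      · exact le_of_intl b (σ + 2) e hc (by omega) hs'.2.2 (Lst_mono (by omega) ht'.2.2) hMt
          fun y hy => (hrest y hy).1
    · obtain ⟨t2, h1, h2, h3, h4⟩ := ih i (σ + 2) e (by omega) (Lst_mono hs'.1 hs'.2.2)
        (Lst_mono ht'.1 ht'.2.2) hMt hp' hrest
      have hpa := le_of_mem_fac ht'.2.2 hp'
      have key : (∀ x ∈ t2, a ≤ x) → a :: t2 ∈ Lst i M (e + 1) ∧ p ∉ fac n σ (a :: t2) ∧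
          (fac n σ (a :: t)).erase p ⊆ fac n σ (a :: t2) := fun hx => by
        refine ⟨Lst_cons_iff.2 ⟨ht'.1, ht'.2.1, h1.1, h1.2.1, fun x hx' => ⟨hx x hx', (h1.2.2 x hx').2⟩⟩,
          fun hmem => ?_, fun y hy => ?_⟩
        · rcases mem_fac_cons.1 hmem with h | h
          · omega
          · exact h2 h
        · rw [Finset.mem_erase, mem_fac_cons] at hy
          rw [mem_fac_cons]
          rcases hy with ⟨hne, hy | hy⟩
          · exact .inl hy
          · exact .inr (h3 (Finset.mem_erase.2 ⟨hne, hy⟩))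
      rcases h4 with h4 | ⟨h4, h5⟩
      · have hx := le_of_forall₂ (fun x hx => (ht'.2.2.2.2 x hx).1) h4
        obtain ⟨k1, k2, k3⟩ := key hx
        exact ⟨a :: t2, k1, k2, k3, .inl (.cons le_rfl h4)⟩
      · by_cases hx : ∀ x ∈ t2, a ≤ x
        · obtain ⟨k1, k2, k3⟩ := key hx
          exact ⟨a :: t2, k1, k2, k3, .inr ⟨.cons hba h4, .cons (by omega) h5⟩⟩
        · rcases h5 with _ | @⟨a1, a2, t', t2', h5, h5'⟩
          · simp at hx
          rcases h4 with _ | @⟨b1, _, s', _, h4, h4'⟩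
          obtain ⟨e, rfl⟩ : ∃ e', e = e' + 1 := ⟨t2'.length, by have := h1.1; simp at this; omega⟩
          have g1 := Lst_cons_iff.1 h1
          have gt := Lst_cons_iff.1 ht'.2.2
          have gs := Lst_cons_iff.1 hs'.2.2
          have ha2 : a2 < a := by
            by_contra hcon
            refine hx fun x hx => ?_
            rcases List.mem_cons.1 hx with rfl | hx
            · omega
            · have := (g1.2.2.2.2 x hx).1
              omega
          refine ⟨a2 :: a2 :: t2', Lst_cons_iff.2 ⟨g1.1, g1.2.1, Lst_cons_iff.2
            ⟨le_rfl, g1.2.1, g1.2.2⟩⟩, fun hmem => ?_, fun y hy => ?_, .inr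
            ⟨.cons (by omega) (.cons h4 h4'), .cons (by omega) (.cons h5 h5')⟩⟩
          · rcases mem_fac_cons.1 hmem with h | h
            · omega
            · exact h2 h
          · rw [Finset.mem_erase, mem_fac_cons] at hy
            rw [mem_fac_cons]
            rcases hy with ⟨hne, hy | hy⟩
            · rcases hy with ⟨rfl | rfl, hyn⟩
              · left; omega
              · right
                rw [mem_fac_cons]
                left; omega
            · exact .inr (h3 (Finset.mem_erase.2 ⟨hne, hy⟩))
end Squeezed

namespace Squeezed

theorem mem_list_toFinset_subset {l : List ℕ} {R : Finset ℕ} {g : List ℕ} (h : l.Sublist g)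
    (hR : g.toFinset ⊆ R) : ∀ y ∈ l, y ∈ R := fun y hy => hR (List.mem_toFinset.2 (h.subset hy))

theorem NF_notMem_bd {n M i σ e c k : ℕ} {W : Set (List ℕ)} {l : List ℕ} (hc : c ≤ 1)
    (hW : Good i M e W) (hn : n + 2 = M + σ + 2 * e + c) (hk : k + 2 = 2 * e + c)
    (hl : l ∈ NF n i σ M e W) : l.toFinset ∉ bd k (fac n σ '' W) := by
  rintro ⟨R, hlR, hRk, H, ⟨⟨t, ht, rfl⟩, hRt⟩, huniq⟩
  obtain ⟨-, -, ⟨s, hs, hsW, hsl⟩ | ⟨s, hs, hsl⟩⟩ := hl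
  · exact hsW (hW.up t ht s hs (le_of_phi2_subset i σ e hs (hW.sub ht) fun y hy =>
      hRt (mem_list_toFinset_subset hsl hlR y hy)))
  · have hcard := fac_card e σ hc hn (hW.sub ht) (hW.top t ht)
    obtain ⟨p, hp, hpR⟩ : ∃ p ∈ fac n σ t, p ∉ R := by
      by_contra! hcon
      have := Finset.card_le_card hcon
      omega
    have hR : R = (fac n σ t).erase p := by
      refine Finset.eq_of_subset_of_card_le (fun y hy => Finset.mem_erase.2 ⟨?_, hRt hy⟩) ?_
      · rintro rfl; exact hpR hy
      · rw [Finset.card_erase_of_mem hp]; omega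
    obtain ⟨t2, h1, h2, h3, h4⟩ := exists_exchange i σ e p hc hn (hW.sub hs) (hW.sub ht)
      (fun _ => hW.top t ht) hp fun y hy => by
        have := mem_list_toFinset_subset hsl hlR y hy
        exact ⟨hRt this, fun h => hpR (h ▸ this)⟩
    have ht2 : t2 ∈ W := h4.elim (hW.up t ht t2 h1) fun h => hW.up s hs t2 h1 h.1
    have := huniq _ ⟨⟨t2, ht2, rfl⟩, hR ▸ h3⟩
    exact h2 (this ▸ hp)

/-- The condition `b_l + τ (q + l) ≤ n` for all `l`. -/
def Vald (τ n : ℕ) : ℕ → List ℕ → Prop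
  | _, [] => True
  | q, a :: b => a + τ * q ≤ n ∧ Vald τ n (q + 1) b

/-- Sorted lists with entries `≥ a`, valid at offset `q`, of length at most `r - q`. -/
def Vl (τ n r a q : ℕ) : Set (List ℕ) :=
  {b | b.Pairwise (· ≤ ·) ∧ (∀ x ∈ b, a ≤ x) ∧ Vald τ n q b ∧ q + b.length ≤ r}

theorem cons_mem_Vl {τ n r a q x : ℕ} {b : List ℕ} :
    x :: b ∈ Vl τ n r a q ↔ a ≤ x ∧ x + τ * q ≤ n ∧ b ∈ Vl τ n r x (q + 1) := by
  simp only [Vl, Set.mem_ofPred_eq, List.pairwise_cons, List.mem_cons, forall_eq_or_imp, Vald,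
    List.length_cons]
  constructor
  · rintro ⟨⟨h1, h2⟩, ⟨h3, h4⟩, ⟨h5, h6⟩, h7⟩
    exact ⟨h3, h5, h2, h1, h6, by omega⟩
  · rintro ⟨h3, h5, h2, h1, h6, h7⟩
    exact ⟨⟨h1, h2⟩, ⟨h3, fun x hx => h3.trans (h1 x hx)⟩, ⟨h5, h6⟩, by omega⟩

theorem Vl_succ_of {τ n r a q : ℕ} {b : List ℕ} (h : b ∈ Vl τ n r a q)
    (h' : ∀ x ∈ b, a + 1 ≤ x) : b ∈ Vl τ n r (a + 1) q := ⟨h.1, h', h.2.2⟩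

theorem Vl_cases {τ n r a q : ℕ} {b : List ℕ} (h : b ∈ Vl τ n r a q) :
    b ∈ Vl τ n r (a + 1) q ∨ ∃ b', b = a :: b' ∧ a + τ * q ≤ n ∧ b' ∈ Vl τ n r a (q + 1) := by
  rcases b with _ | ⟨x, b⟩
  · exact .inl (Vl_succ_of h (by simp))
  · have h' := cons_mem_Vl.1 h
    rcases h'.1.eq_or_lt with rfl | hlt
    · exact .inr ⟨b, rfl, h'.2.1, h'.2.2⟩
    · exact .inl (cons_mem_Vl.2 ⟨hlt, h'.2⟩)

theorem encard_cons_image (a : ℕ) (S : Set (List ℕ)) : (List.cons a '' S).encard = S.encard :=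
  (List.cons_injective).encard_image S

theorem encard_Vl_le {τ n r : ℕ} {η : ℕ → ℕ → ℕ} (h1 : ∀ a q, q ≤ r → 1 ≤ η a q)
    (h2 : ∀ a q, a + τ * q ≤ n → q < r → η a (q + 1) + η (a + 1) q ≤ η a q) (N a q : ℕ)
    (hN : n + 1 - a + (r - q) = N) : (Vl τ n r a q).encard ≤ η a q := by
  induction N using Nat.strong_induction_on generalizing a q with
  | _ N ih =>
    by_cases h : a + τ * q ≤ n ∧ q < r
    · have hsub : Vl τ n r a q ⊆ List.cons a '' Vl τ n r a (q + 1) ∪ Vl τ n r (a + 1) q := by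
        intro b hb
        rcases Vl_cases hb with hb | ⟨b', rfl, -, hb⟩
        · exact .inr hb
        · exact .inl ⟨b', hb, rfl⟩
      have han : a ≤ n := by have := h.1; exact le_trans (Nat.le_add_right _ _) this
      have i1 := ih _ (by omega) a (q + 1) rfl
      have i2 := ih _ (by omega) (a + 1) q rfl
      refine (Set.encard_le_encard hsub).trans ((Set.encard_union_le _ _).trans ?_)
      rw [encard_cons_image]
      refine (add_le_add i1 i2).trans ?_
      exact_mod_cast h2 a q h.1 h.2
    · by_cases hq : q ≤ r
      · have hsub : Vl τ n r a q ⊆ {[]} := by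
          intro b hb
          rcases b with _ | ⟨x, b⟩
          · rfl
          · have h' := cons_mem_Vl.1 hb
            have := h'.2.2.2.2.2
            exact absurd ⟨by omega, by omega⟩ h
        refine (Set.encard_le_encard hsub).trans ?_
        rw [Set.encard_singleton]
        exact_mod_cast h1 a q hq
      · have : Vl τ n r a q = ∅ := by
          ext b
          simp only [Set.mem_empty_iff_false, iff_false]
          intro hb
          have := hb.2.2.2
          omega
        simp [this]

/-- Standard lists at a stage of the recursion. -/
def Std (τ n r i q M e dd : ℕ) (W : Set (List ℕ)) : Set (List ℕ) :=
  {b | b ∈ Vl τ n r i q ∧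
    b.filter (· < M) ++ List.replicate (e - (b.filter (· < M)).length) M ∈ W ∧
    b.count M + 2 * (b.filter (· < M)).length ≤ dd}

theorem encard_top_le {τ n r M : ℕ} {η : ℕ → ℕ → ℕ}
    (hη : ∀ a q, (Vl τ n r a q).encard ≤ η a q) (m q : ℕ) :
    {b | b ∈ Vl τ n r M q ∧ b.count M ≤ m}.encard ≤
      (∑ j ∈ Finset.range (m + 1), η (M + 1) (q + j) : ℕ) := by
  induction m generalizing q with
  | zero =>
    refine (Set.encard_le_encard ?_).trans ((hη (M + 1) q).trans (by simp))
    rintro b ⟨hb, hc⟩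
    refine Vl_succ_of hb fun x hx => ?_
    rcases (hb.2.1 x hx).eq_or_lt with rfl | h
    · have := List.count_pos_iff.2 hx
      omega
    · exact h
  | succ m ih =>
    rw [Finset.sum_range_succ']
    have hsub : {b | b ∈ Vl τ n r M q ∧ b.count M ≤ m + 1} ⊆
        List.cons M '' {b | b ∈ Vl τ n r M (q + 1) ∧ b.count M ≤ m} ∪ Vl τ n r (M + 1) q := by
      rintro b ⟨hb, hc⟩
      rcases Vl_cases hb with hb | ⟨b', rfl, -, hb⟩
      · exact .inr hb
      · refine .inl ⟨b', ⟨hb, ?_⟩, rfl⟩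
        simpa using hc
    refine (Set.encard_le_encard hsub).trans ((Set.encard_union_le _ _).trans ?_)
    rw [encard_cons_image]
    refine (add_le_add (ih (q + 1)) (hη (M + 1) q)).trans ?_
    simp only [add_zero, Nat.cast_add, add_assoc, add_comm 1]
    rfl

theorem Std_subset {τ n r i q M e dd : ℕ} {W : Set (List ℕ)} (hi : i < M) :
    Std τ n r i q M (e + 1) (dd + 2) W ⊆
      List.cons i '' Std τ n r i (q + 1) M e dd (Wx i W) ∪
        Std τ n r (i + 1) q M (e + 1) (dd + 2) (Wn i W) := by
  rintro b ⟨hb, h1, h2⟩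
  rcases Vl_cases hb with hb | ⟨b', rfl, -, hb⟩
  · refine .inr ⟨hb, ⟨h1, fun x hx => ?_⟩, h2⟩
    rcases List.mem_append.1 hx with hx | hx
    · exact hb.2.1 x (List.mem_of_mem_filter hx)
    · rw [List.eq_of_mem_replicate hx]; exact hi
  · refine .inl ⟨b', ⟨hb, ?_, ?_⟩, rfl⟩
    · simpa [Wx, hi] using h1
    · simp [hi, hi.ne] at h2
      omega

theorem bd_mono {k : ℕ} {𝓕 : Set (Finset ℕ)} {G R : Finset ℕ} (h : G ⊆ R) (hR : R ∈ bd k 𝓕) :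
    G ∈ bd k 𝓕 := by
  obtain ⟨R', h1, h2⟩ := hR
  exact ⟨R', h.trans h1, h2⟩

theorem fac_cons_eq {n σ a : ℕ} {s : List ℕ} (h : a + σ + 1 ≤ n) :
    fac n σ (a :: s) = insert (a + σ) (insert (a + σ + 1) (fac n (σ + 2) s)) := by
  ext y
  rw [mem_fac_cons]
  simp only [Finset.mem_insert]
  grind

theorem insert_mem_bd_of_Wx {n M i σ e k : ℕ} {W : Set (List ℕ)} {G : Finset ℕ}
    (hW : Good i M (e + 1) W) (hi : i < M) (hn : i + σ + 1 ≤ n)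
    (hG : G ∈ bd k (fac n (σ + 2) '' Wx i W)) :
    insert (i + σ) (insert (i + σ + 1) G) ∈ bd (k + 2) (fac n σ '' W) := by
  obtain ⟨R, hGR, hRk, H, ⟨⟨t, ht, rfl⟩, hRt⟩, huniq⟩ := hG
  have hge : ∀ y ∈ R, i + σ + 2 ≤ y := fun y hy => by
    have := le_of_mem_fac ((hW.wx hi).sub ht) (hRt hy); omega
  refine ⟨insert (i + σ) (insert (i + σ + 1) R), by gcongr, ?_, fac n σ (i :: t),
    ⟨⟨_, ht, rfl⟩, ?_⟩, ?_⟩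
  · rw [Finset.card_insert_of_notMem, Finset.card_insert_of_notMem, hRk]
    · intro h; have := hge _ h; omega
    · intro h
      rcases Finset.mem_insert.1 h with h | h
      · omega
      · have := hge _ h; omega
  · rw [fac_cons_eq hn]
    gcongr
  · rintro H ⟨⟨s, hs, rfl⟩, hsub⟩
    obtain ⟨a, s, rfl⟩ : ∃ a s', s = a :: s' := by
      rcases s with _ | ⟨a, s⟩
      · exact absurd (hW.top _ hs) (by simp)
      · exact ⟨a, s, rfl⟩
    have hs' := Lst_cons_iff.1 (hW.sub hs)
    have hai : a = i := by
      have := (le_of_mem_fac (Lst_cons_iff.2 ⟨le_rfl, hs'.2⟩) (hsub (Finset.mem_insert_self _ _))).1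
      omega
    subst hai
    rw [fac_cons_eq hn, fac_cons_eq hn]
    have := huniq (fac n (σ + 2) s) ⟨⟨s, hs, rfl⟩, fun y hy => by
      have h1 := hsub (Finset.mem_insert_of_mem (Finset.mem_insert_of_mem hy))
      have h2 := hge y hy
      rcases mem_fac_cons.1 h1 with h | h
      · omega
      · exact h⟩
    rw [this]

theorem mem_bd_of_Wn {n M i σ e c k : ℕ} {W : Set (List ℕ)} {R : Finset ℕ} (hc : c ≤ 1)
    (hW : Good i M (e + 1) W) (hi : i < M) (hn : n + 2 = M + σ + 2 * (e + 1) + c)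
    (hk : k = 2 * e + c) (hRk : R.card = k) (hR : ∃! H, H ∈ fac n σ '' Wn i W ∧ R ⊆ H) :
    R ∈ bd k (fac n σ '' W) ∨
      i + σ + 1 ∈ R ∧ insert (i + σ) (R.erase (i + σ + 1)) ∈ bd k (fac n σ '' W) := by
  have hin : i + σ + 1 ≤ n := by omega
  obtain ⟨H, ⟨⟨t, ht, rfl⟩, hRt⟩, huniq⟩ := hR
  have hge : ∀ y ∈ R, i + σ + 1 ≤ y := fun y hy => by
    have := le_of_mem_fac (hW.wn.sub ht) (hRt hy); omega
  -- a facet through `i` meets `R` in a facet of the link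
  have hx : ∀ s, i :: s ∈ W → R.erase (i + σ + 1) ⊆ fac n σ (i :: s) →
      R.erase (i + σ + 1) = fac n (σ + 2) s ∧ i + σ + 1 ∈ R := fun s hs hsub => by
    have hsub' : R.erase (i + σ + 1) ⊆ fac n (σ + 2) s := fun y hy => by
      have := hge y (Finset.mem_of_mem_erase hy)
      have h2 := (Finset.mem_erase.1 hy).1
      rcases mem_fac_cons.1 (hsub hy) with h | h
      · omega
      · exact h
    have hcard := fac_card (n := n) e (σ + 2) hc (by omega) ((hW.wx hi).sub hs) ((hW.wx hi).top s hs)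
    have h1 := Finset.card_le_card hsub'
    have h2 := Finset.card_erase_add_one (s := R) (a := i + σ + 1)
    by_cases hmem : i + σ + 1 ∈ R
    · have h2 := h2 hmem
      exact ⟨Finset.eq_of_subset_of_card_le hsub' (by omega), hmem⟩
    · rw [Finset.erase_eq_of_notMem hmem] at h1
      omega
  have hWn : ∀ s ∈ W, s ∈ Wn i W ∨ ∃ s', s = i :: s' := fun s hs => by
    rcases s with _ | ⟨a, s⟩
    · exact absurd (hW.top _ hs) (by simp)
    · have hs' := Lst_cons_iff.1 (hW.sub hs)
      rcases hs'.1.eq_or_lt with rfl | h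
      · exact .inr ⟨s, rfl⟩
      · refine .inl ⟨hs, fun x hx => ?_⟩
        rcases List.mem_cons.1 hx with rfl | hx
        · exact h
        · have := (hs'.2.2.2.2 x hx).1; omega
  by_cases hex : ∃ s, i :: s ∈ W ∧ R.erase (i + σ + 1) ⊆ fac n σ (i :: s)
  · obtain ⟨s, hs, hsub⟩ := hex
    obtain ⟨h1, h2⟩ := hx s hs hsub
    refine .inr ⟨h2, _, subset_rfl, ?_, fac n σ (i :: s), ⟨⟨_, hs, rfl⟩, ?_⟩, ?_⟩
    · rw [Finset.card_insert_of_notMem, Finset.card_erase_add_one h2, hRk]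
      intro h
      have := hge _ (Finset.mem_of_mem_erase h)
      omega
    · rw [h1, fac_cons_eq hin]
      intro y; simp only [Finset.mem_insert]; tauto
    · rintro H ⟨⟨s', hs', rfl⟩, hsub'⟩
      rcases hWn s' hs' with h | ⟨s', rfl⟩
      · have := le_of_mem_fac (hW.wn.sub h) (hsub' (Finset.mem_insert_self _ _))
        omega
      · have := (hx s' hs' ((Finset.subset_insert _ _).trans hsub')).1
        rw [fac_cons_eq hin, fac_cons_eq hin, ← h1, ← this]
  · refine .inl ⟨R, subset_rfl, hRk, fac n σ t, ⟨⟨t, ht.1, rfl⟩, hRt⟩, ?_⟩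
    rintro H ⟨⟨s', hs', rfl⟩, hsub'⟩
    rcases hWn s' hs' with h | ⟨s', rfl⟩
    · exact huniq _ ⟨⟨s', h, rfl⟩, hsub'⟩
    · exact absurd ⟨s', hs', (Finset.erase_subset _ _).trans hsub'⟩ hex
end Squeezed

namespace Squeezed

open Classical in
/-- The weighted number of subsets of `A` in `S`. -/
noncomputable def wsum (θ : ℕ → ℕ) (S : Set (Finset ℕ)) (A : Finset ℕ) : ℕ :=
  ∑ F ∈ A.powerset, if F ∈ S then θ F.card else 0

open Classical in
theorem wsum_step {θ θ' : ℕ → ℕ} {S Sn Sx : Set (Finset ℕ)} {B : Finset ℕ} {p : ℕ}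
    (hp : p ∉ B) (hp' : p + 1 ∉ B) (hθ : ∀ s, θ' s ≤ θ (s + 1) + θ (s + 2))
    (hS : ∀ F ∈ S, ∀ G ⊆ F, G ∈ S)
    (hx : ∀ G ∈ Sx, insert p (insert (p + 1) G) ∈ S)
    (hn : ∀ G ∈ Sn, G ∈ S ∨ p + 1 ∈ G ∧ insert p (G.erase (p + 1)) ∈ S) :
    wsum θ Sn (insert (p + 1) B) + wsum θ' Sx B ≤ wsum θ S (insert p (insert (p + 1) B)) := by
  have hp2 : p ∉ insert (p + 1) B := by simp [hp]
  unfold wsum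
  rw [Finset.sum_powerset_insert hp2, Finset.sum_powerset_insert hp', Finset.sum_powerset_insert hp',
    Finset.sum_powerset_insert hp']
  simp only [← Finset.sum_add_distrib]
  refine Finset.sum_le_sum fun G hG => ?_
  rw [Finset.mem_powerset] at hG
  have h1 : p ∉ G := fun h => hp (hG h)
  have h2 : p + 1 ∉ G := fun h => hp' (hG h)
  have c1 : (insert p G).card = G.card + 1 := Finset.card_insert_of_notMem h1
  have c2 : (insert (p + 1) G).card = G.card + 1 := Finset.card_insert_of_notMem h2
  have h3 : p ∉ insert (p + 1) G := by simp [h1]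
  have c3 : (insert p (insert (p + 1) G)).card = G.card + 2 := by
    rw [Finset.card_insert_of_notMem h3, c2]
  rw [c1, c2, c3]
  have a1 : G ∈ Sn → G ∈ S := fun h => (hn G h).elim id fun h => absurd h.1 h2
  have a2 : insert (p + 1) G ∈ Sn → insert (p + 1) G ∈ S ∨ insert p G ∈ S := fun h =>
    (hn _ h).imp id fun h => by simpa [h2] using h.2
  have a3 : G ∈ Sx → insert p (insert (p + 1) G) ∈ S ∧ insert p G ∈ S ∧ insert (p + 1) G ∈ S :=
    fun h => ⟨hx G h, hS _ (hx G h) _ (Finset.insert_subset_insert _ (Finset.subset_insert _ _)),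
      hS _ (hx G h) _ (Finset.subset_insert _ _)⟩
  have a4 : insert (p + 1) G ∈ S → G ∈ S := fun h => hS _ h _ (Finset.subset_insert _ _)
  have h5 := hθ G.card
  by_cases b1 : G ∈ Sx
  · obtain ⟨b2, b3, b4⟩ := a3 b1
    simp only [b1, b2, b3, b4, a4 b4, if_true]
    split_ifs <;> omega
  · simp only [b1, if_false]
    by_cases b2 : G ∈ Sn <;> by_cases b3 : insert (p + 1) G ∈ Sn
    · have := a1 b2
      rcases a2 b3 with h | h <;> simp only [b2, b3, h, this, if_true] <;> split_ifs <;> omega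
    · have := a1 b2
      simp only [b2, b3, this, if_true, if_false]
      omega
    · rcases a2 b3 with h | h <;> simp only [b2, b3, h, if_true, if_false] <;> split_ifs <;> omega
    · simp only [b2, b3, if_false]
      omega

theorem insert_insert_Icc {p n : ℕ} (h : p + 1 ≤ n) :
    Finset.Icc p n = insert p (insert (p + 1) (Finset.Icc (p + 2) n)) := by
  ext y; simp only [Finset.mem_insert, Finset.mem_Icc]; omega

theorem insert_Icc {p n : ℕ} (h : p ≤ n) :
    Finset.Icc p n = insert p (Finset.Icc (p + 1) n) := by
  ext y; simp only [Finset.mem_insert, Finset.mem_Icc]; omega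

open Classical in
theorem encard_Std_le {τ n r M d c : ℕ} {θ : ℕ → ℕ → ℕ} {η : ℕ → ℕ → ℕ} (hc : c ≤ 1)
    (hn : n = M + d) (hη : ∀ a q, (Vl τ n r a q).encard ≤ η a q)
    (hθ : ∀ k s, θ (k + 1) s ≤ θ k (s + 1) + θ k (s + 2))
    (hb : ∀ k dd, dd + 2 * k = d → ∑ j ∈ Finset.range (dd + 1), η (M + 1) (k + j) ≤
      ∑ s ∈ Finset.range (dd + 1), (dd + 1).choose s * θ k s) (N : ℕ) :
    ∀ (i e k dd : ℕ) (W : Set (List ℕ)), N = M - i + e → Good i M e W → i ≤ M →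
      dd + 2 = 2 * e + c → dd + 2 * k = d →
      (Std τ n r i k M e dd W).encard ≤
        wsum (θ k) (bd dd (fac n (2 * k) '' W)) (Finset.Icc (i + 2 * k) n) := by
  induction N with
  | zero =>
    intro i e k dd W hN _ _ h1
    omega
  | succ N ih =>
    intro i e k dd W hN hW hiM hdd hk
    by_cases hne : W = ∅
    · subst hne
      have : Std τ n r i k M e dd ∅ = ∅ := by
        ext b; simp [Std]
      simp [this]
    obtain ⟨e, rfl⟩ : ∃ e', e = e' + 1 := ⟨e - 1, by omega⟩
    rcases hiM.eq_or_lt with rfl | hi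
    · have hWeq : W = {List.replicate (e + 1) i} := by
        obtain ⟨s, hs⟩ := Set.nonempty_iff_ne_empty.2 hne
        refine Set.eq_singleton_iff_unique_mem.2 ⟨?_, fun t ht => eq_replicate_of_mem_Lst (hW.sub ht)⟩
        rw [← eq_replicate_of_mem_Lst (hW.sub hs)]
        exact hs
      have hsub : Std τ n r i k i (e + 1) dd W ⊆ {b | b ∈ Vl τ n r i k ∧ b.count i ≤ dd} :=
        fun b hb => ⟨hb.1, le_trans (Nat.le_add_right _ _) hb.2.2⟩
      refine (Set.encard_le_encard hsub).trans ((encard_top_le hη dd k).trans ?_)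
      refine Nat.cast_le.2 ((hb k dd hk).trans ?_)
      have hcard : (Finset.Icc (i + 2 * k) n).card = dd + 1 := by rw [Nat.card_Icc]; omega
      have heq : wsum (θ k) (bd dd (fac n (2 * k) '' W)) (Finset.Icc (i + 2 * k) n) =
          ∑ F ∈ (Finset.Icc (i + 2 * k) n).powerset,
            (fun m => if m ≤ dd then θ k m else 0) F.card := by
        refine Finset.sum_congr rfl fun F hF => ?_
        rw [Finset.mem_powerset] at hF
        have hiff : F ∈ bd dd (fac n (2 * k) '' W) ↔ F.card ≤ dd := by
          rw [hWeq, Set.image_singleton, fac_replicate (e + 1) (2 * k) c hc (by omega)]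
          constructor
          · rintro ⟨R, h1, h2, -⟩
            exact h2 ▸ Finset.card_le_card h1
          · intro h
            obtain ⟨R, h1, h2, h3⟩ := Finset.exists_subsuperset_card_eq hF h (by omega)
            exact ⟨R, h1, h3, _, ⟨rfl, h2⟩, fun H hH => hH.1⟩
        simp only [hiff]
      rw [heq, Finset.sum_powerset_apply_card (fun m => if m ≤ dd then θ k m else 0), hcard, Finset.sum_range_succ _ (dd + 1)]
      refine le_trans (le_of_eq ?_) (Nat.le_add_right _ _)
      refine Finset.sum_congr rfl fun s hs => ?_
      rw [Finset.mem_range] at hs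
      rw [if_pos (by omega), smul_eq_mul]
    · have hp : i + 2 * k + 1 ≤ n := by omega
      have hdown : ∀ F ∈ bd dd (fac n (2 * k) '' W), ∀ G ⊆ F, G ∈ bd dd (fac n (2 * k) '' W) :=
        fun F hF G hG => bd_mono hG hF
      have hnn : ∀ G ∈ bd dd (fac n (2 * k) '' Wn i W), G ∈ bd dd (fac n (2 * k) '' W) ∨
          i + 2 * k + 1 ∈ G ∧
            insert (i + 2 * k) (G.erase (i + 2 * k + 1)) ∈ bd dd (fac n (2 * k) '' W) := by
        rintro G ⟨R, hGR, hRk, hR⟩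
        rcases mem_bd_of_Wn hc hW hi (by omega) (by omega) hRk hR with h | ⟨h1, h2⟩
        · exact .inl (bd_mono hGR h)
        · by_cases hmem : i + 2 * k + 1 ∈ G
          · exact .inr ⟨hmem, bd_mono (by gcongr) h2⟩
          · refine .inl (bd_mono (fun y hy => Finset.mem_insert_of_mem
              (Finset.mem_erase.2 ⟨?_, hGR hy⟩)) h2)
            rintro rfl; exact hmem hy
      have ihn := ih (i + 1) (e + 1) k dd (Wn i W) (by omega) hW.wn hi hdd hk
      rcases e with _ | e
      · have hx : Wx i W = ∅ := by
          ext s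
          simp only [Set.mem_empty_iff_false, iff_false]
          intro hs
          have h1 := ((hW.wx hi).sub hs).1
          have h2 := (hW.wx hi).top s hs
          rw [List.length_eq_zero_iff.1 h1] at h2
          simp at h2
        have hsub : Std τ n r i k M 1 dd W ⊆ Std τ n r (i + 1) k M 1 dd (Wn i W) := by
          rintro b ⟨hb, h1, h2⟩
          rcases Vl_cases hb with hb | ⟨b', rfl, -, hb⟩
          · refine ⟨hb, ⟨h1, fun x hx => ?_⟩, h2⟩
            rcases List.mem_append.1 hx with hx | hx
            · exact hb.2.1 x (List.mem_of_mem_filter hx)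
            · rw [List.eq_of_mem_replicate hx]; exact hi
          · have : List.filter (· < M) b' ++
              List.replicate (0 - (List.filter (· < M) b').length) M ∈ Wx i W := by
              simpa [Wx, hi] using h1
            rw [hx] at this
            exact absurd this (Set.notMem_empty _)
        refine (Set.encard_le_encard hsub).trans (ihn.trans (Nat.cast_le.2 ?_))
        have := wsum_step (θ := θ k) (θ' := fun _ => 0) (Sx := ∅) (p := i + 2 * k)
          (B := Finset.Icc (i + 2 * k + 2) n) (by simp) (by simp) (fun _ => Nat.zero_le _) hdown
          (by simp) hnn
        rw [insert_insert_Icc hp, show i + 1 + 2 * k = i + 2 * k + 1 by ring, insert_Icc hp]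
        exact (Nat.le_add_right _ _).trans this
      · obtain ⟨dd, rfl⟩ : ∃ dd', dd = dd' + 2 := ⟨dd - 2, by omega⟩
        have ihx := ih i (e + 1) (k + 1) dd (Wx i W) (by omega) (hW.wx hi) hi.le (by omega) (by omega)
        refine (Set.encard_le_encard (Std_subset hi)).trans ((Set.encard_union_le _ _).trans ?_)
        rw [encard_cons_image]
        refine (add_le_add ihx ihn).trans ?_
        rw [← Nat.cast_add, Nat.cast_le, add_comm]
        have := wsum_step (θ := θ k) (θ' := θ (k + 1)) (p := i + 2 * k)
          (Sx := bd dd (fac n (2 * (k + 1)) '' Wx i W))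
          (B := Finset.Icc (i + 2 * k + 2) n) (by simp) (by simp) (hθ k) hdown
          (fun G hG => insert_mem_bd_of_Wx hW hi hp (by simpa [mul_add] using hG)) hnn
        rw [insert_insert_Icc hp, show i + 1 + 2 * k = i + 2 * k + 1 by ring, insert_Icc hp,
          show i + 2 * (k + 1) = i + 2 * k + 2 by ring]
        exact this
end Squeezed

namespace Squeezed

theorem sum_pow_two (m k : ℕ) :
    ∑ j ∈ Finset.range (m + 1), 2 ^ (m + k - j) = ∑ s ∈ Finset.range (m + 1), (m + 1).choose s * 2 ^ k := by
  rw [← Finset.sum_mul]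
  have h1 := Nat.sum_range_choose (m + 1)
  rw [Finset.sum_range_succ, Nat.choose_self] at h1
  have h2 : ∀ m, ∑ j ∈ Finset.range (m + 1), 2 ^ (m + k - j) + 2 ^ k = 2 ^ (m + 1) * 2 ^ k := by
    intro m
    induction m with
    | zero => simp; ring
    | succ m ih =>
      rw [Finset.sum_range_succ']
      have : ∀ j, m + 1 + k - (j + 1) = m + k - j := fun j => by omega
      simp only [this, Nat.sub_zero]
      rw [add_right_comm, ih]
      ring
  have h3 := h2 m
  rw [← h1, add_mul, one_mul] at h3
  omega

theorem sum_choose_mul_choose (m x y : ℕ) :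
    ∑ s ∈ Finset.range (m + 1), m.choose s * x.choose (s + y) = (m + x).choose (m + y) := by
  rw [Nat.add_choose_eq, Finset.Nat.sum_antidiagonal_eq_sum_range_succ
    (fun i j => m.choose i * x.choose j), ← Finset.sum_range_reflect]
  have hsub : Finset.range (m + 1) ⊆ Finset.range (m + y).succ := by
    intro a; simp only [Finset.mem_range]; omega
  rw [← Finset.sum_subset hsub]
  · refine Finset.sum_congr rfl fun s hs => ?_
    rw [Finset.mem_range] at hs
    rw [show m + 1 - 1 - s = m - s by omega, Nat.choose_symm (by omega),
      show m - s + y = m + y - s by omega]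
  · intro s _ hs
    rw [Finset.mem_range] at hs
    rw [Nat.choose_eq_zero_of_lt (by omega), zero_mul]

theorem sum_choose_add (y d m : ℕ) (hm : m ≤ y + 1) :
    ∑ j ∈ Finset.range m, (y - j + d).choose d + (y + 1 - m + d).choose (d + 1) =
      (y + 1 + d).choose (d + 1) := by
  induction m with
  | zero => simp
  | succ m ih =>
    rw [← ih (by omega), Finset.sum_range_succ, add_assoc]
    congr 1
    rw [show y + 1 - (m + 1) = y - m by omega, show y + 1 - m + d = (y - m + d) + 1 by omega,
      Nat.choose_succ_succ' (y - m + d) d]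

/-- The stretched list `b_l + τ (q + l)`. -/
def tl (τ : ℕ) : ℕ → List ℕ → List ℕ
  | _, [] => []
  | q, a :: b => (a + τ * q) :: tl τ (q + 1) b

theorem tl_zero (q : ℕ) (b : List ℕ) : tl 0 q b = b := by
  induction b generalizing q with
  | nil => rfl
  | cons a b ih => simp [tl, ih]

theorem choose_le_encard (r : ℕ) (f : List ℕ) (hf : f.Pairwise (· < ·)) :
    (r.choose f.length : ℕ∞) ≤
      {b : List ℕ | b.Pairwise (· ≤ ·) ∧ b.toFinset = f.toFinset ∧ b.length ≤ r}.encard := by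
  induction r generalizing f with
  | zero =>
    rcases f with _ | ⟨a, f⟩
    · have : {b : List ℕ | b.Pairwise (· ≤ ·) ∧ b.toFinset = ([] : List ℕ).toFinset ∧ b.length ≤ 0} =
          {[]} := by
        ext b; simp; rintro rfl; simp
      rw [this]; simp
    · simp
  | succ r ih =>
    rcases f with _ | ⟨a, f⟩
    · rw [List.length_nil, Nat.choose_zero_right, Nat.cast_one, Set.one_le_encard_iff_nonempty]
      exact ⟨[], by simp⟩
    · have hf' := List.pairwise_cons.1 hf
      set A := {b : List ℕ | b.Pairwise (· ≤ ·) ∧ b.toFinset = (a :: f).toFinset ∧ b.length ≤ r}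
      set B := {b : List ℕ | b.Pairwise (· ≤ ·) ∧ b.toFinset = f.toFinset ∧ b.length ≤ r}
      have hdis : Disjoint A B := by
        rw [Set.disjoint_left]
        rintro b ⟨-, h1, -⟩ ⟨-, h2, -⟩
        have : a ∈ f.toFinset := by rw [← h2, h1]; simp
        exact absurd (hf'.1 a (List.mem_toFinset.1 this)) (lt_irrefl a)
      have hsub : List.cons a '' (A ∪ B) ⊆
          {b : List ℕ | b.Pairwise (· ≤ ·) ∧ b.toFinset = (a :: f).toFinset ∧ b.length ≤ r + 1} := by
        rintro _ ⟨b, hb, rfl⟩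
        have hb' : b.Pairwise (· ≤ ·) ∧ insert a b.toFinset = insert a f.toFinset ∧ b.length ≤ r := by
          rcases hb with hb | hb
          · exact ⟨hb.1, by rw [hb.2.1]; simp, hb.2.2⟩
          · exact ⟨hb.1, by rw [hb.2.1], hb.2.2⟩
        refine ⟨List.pairwise_cons.2 ⟨fun x hx => ?_, hb'.1⟩, by simpa using hb'.2.1, by
          simpa using hb'.2.2⟩
        have : x ∈ insert a f.toFinset := by
          rw [← hb'.2.1]; simp [hx]
        rcases Finset.mem_insert.1 this with rfl | h
        · exact le_rfl
        · exact (hf'.1 x (List.mem_toFinset.1 h)).le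
      refine le_trans ?_ (Set.encard_le_encard hsub)
      rw [encard_cons_image, Set.encard_union_eq hdis, List.length_cons, Nat.choose_succ_succ,
        Nat.cast_add, add_comm]
      exact add_le_add (ih _ hf) (ih _ hf'.2)

theorem exists_tl_one (f : List ℕ) (a q : ℕ) (hf : f.Pairwise (· < ·)) (ha : ∀ x ∈ f, a + q ≤ x) :
    ∃ b : List ℕ, b.Pairwise (· ≤ ·) ∧ (∀ x ∈ b, a ≤ x) ∧ tl 1 q b = f := by
  induction f generalizing a q with
  | nil => exact ⟨[], by simp, by simp, rfl⟩
  | cons x f ih =>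
    have hf' := List.pairwise_cons.1 hf
    have hx := ha x (by simp)
    obtain ⟨b, h1, h2, h3⟩ := ih (x - q) (q + 1) hf'.2 fun y hy => by
      have := hf'.1 y hy; omega
    refine ⟨(x - q) :: b, List.pairwise_cons.2 ⟨h2, h1⟩, fun y hy => ?_, ?_⟩
    · rcases List.mem_cons.1 hy with rfl | hy
      · omega
      · have := h2 y hy; omega
    · rw [tl, h3, one_mul, Nat.sub_add_cancel (by omega)]

theorem Vald_iff {τ n q : ℕ} {b : List ℕ} : Vald τ n q b ↔ ∀ x ∈ tl τ q b, x ≤ n := by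
  induction b generalizing q with
  | nil => simp [Vald, tl]
  | cons a b ih => simp [Vald, tl, ih]

theorem tl_length (τ q : ℕ) (b : List ℕ) : (tl τ q b).length = b.length := by
  induction b generalizing q with
  | nil => rfl
  | cons a b ih => simp [tl, ih]

theorem sum_le_encard {θ : Finset ℕ → ℕ} {V : Set (List ℕ)} {g : List ℕ → Finset ℕ}
    (P : Finset (Finset ℕ)) (h : ∀ F ∈ P, (θ F : ℕ∞) ≤ {b | b ∈ V ∧ g b = F}.encard) :
    ((∑ F ∈ P, θ F : ℕ) : ℕ∞) ≤ {b | b ∈ V ∧ g b ∈ P}.encard := by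
  induction P using Finset.induction_on with
  | empty => simp
  | insert F P hF ih =>
    rw [Finset.sum_insert hF, Nat.cast_add]
    have heq : {b | b ∈ V ∧ g b ∈ insert F P} = {b | b ∈ V ∧ g b = F} ∪ {b | b ∈ V ∧ g b ∈ P} := by
      ext b; simp only [Finset.mem_insert, Set.mem_union, Set.mem_ofPred_eq]; tauto
    rw [heq, Set.encard_union_eq]
    · exact add_le_add (h F (by simp)) (ih fun G hG => h G (by simp [hG]))
    · rw [Set.disjoint_left]
      rintro b ⟨-, h1⟩ ⟨-, h2⟩
      exact hF (h1 ▸ h2)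

open Classical in
theorem encard_Std_le_encard {τ n r M d c e : ℕ} {W : Set (List ℕ)} (hτ : τ = 0 ∨ τ = 1)
    (hc : c ≤ 1) (hn : n = M + d) (hd : d + 2 = 2 * e + c) (hr : n + 1 ≤ r) (hM : 1 ≤ M)
    (hW : Good 1 M e W) : (Std τ n r 1 0 M e d W).encard ≤
      {b | b ∈ Vl τ n r 1 0 ∧ (tl τ 0 b).toFinset ∈ bd d (fac n 0 '' W)}.encard := by
  have key : ∀ θ : ℕ → ℕ, (∀ F ∈ (Finset.Icc 1 n).powerset, (θ F.card : ℕ∞) ≤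
      {b | b ∈ Vl τ n r 1 0 ∧ (tl τ 0 b).toFinset = F}.encard) →
      (wsum θ (bd d (fac n 0 '' W)) (Finset.Icc 1 n) : ℕ∞) ≤
        {b | b ∈ Vl τ n r 1 0 ∧ (tl τ 0 b).toFinset ∈ bd d (fac n 0 '' W)}.encard := by
    intro θ h
    unfold wsum
    rw [← Finset.sum_filter]
    refine (sum_le_encard _ fun F hF => h F (Finset.mem_filter.1 hF).1).trans
      (Set.encard_le_encard ?_)
    rintro b ⟨h1, h2⟩
    exact ⟨h1, (Finset.mem_filter.1 h2).2⟩
  rcases hτ with rfl | rfl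
  · refine (encard_Std_le (θ := fun k s => (r + k).choose (s + 2 * k))
      (η := fun a q => (r - q + (n + 1 - a)).choose (n + 1 - a)) hc hn
      (fun a q => encard_Vl_le
        (η := fun a q => (r - q + (n + 1 - a)).choose (n + 1 - a)) (fun a q _ => Nat.choose_pos (Nat.le_add_left _ _))
        (fun a q h1 h2 => ?_) _ a q rfl) (fun k s => ?_) (fun k dd hk => ?_)
      (M - 1 + e) 1 e 0 d W rfl hW hM hd (by omega)).trans (key _ fun F hF => ?_)
    · obtain ⟨u, hu⟩ : ∃ u, r - q = u + 1 := ⟨r - q - 1, by omega⟩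
      obtain ⟨v, hv⟩ : ∃ v, n + 1 - a = v + 1 := ⟨n - a, by omega⟩
      simp only [hu, hv, show r - (q + 1) = u by omega, show n + 1 - (a + 1) = v by omega]
      rw [show u + 1 + (v + 1) = (u + 1 + v) + 1 by ring, Nat.choose_succ_succ',
        show u + (v + 1) = u + 1 + v by ring, add_comm]
    · rw [show r + (k + 1) = (r + k) + 1 by ring, show s + 2 * (k + 1) = (s + 1 + 2 * k) + 1 by ring,
        Nat.choose_succ_succ', show s + 1 + 2 * k + 1 = s + 2 + 2 * k by ring]
    · have h1 := sum_choose_mul_choose (dd + 1) (r + k) (2 * k)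
      rw [Finset.sum_range_succ, Nat.choose_self, one_mul] at h1
      have h2 := sum_choose_add (r - k) d (dd + 1) (by omega)
      have h3 : ∀ j, r - (k + j) + (n + 1 - (M + 1)) = r - k - j + d := fun j => by omega
      have h4 : n + 1 - (M + 1) = d := by omega
      simp only [h3]
      simp only [h4]
      rw [show r - k + 1 - (dd + 1) + d = r + k by omega,
        show r - k + 1 + d = dd + 1 + (r + k) by omega, show d + 1 = dd + 1 + 2 * k by omega] at h2
      omega
    · have := choose_le_encard r (F.sort (· ≤ ·)) (Finset.sortedLT_sort F).pairwise
      simp only [Finset.length_sort, Finset.sort_toFinset] at this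
      simp only [tl_zero, mul_zero, add_zero]
      refine this.trans (Set.encard_le_encard ?_)
      rintro b ⟨h1, rfl, h3⟩
      have hb : ∀ x ∈ b, 1 ≤ x ∧ x ≤ n := fun x hx => Finset.mem_Icc.1
        (Finset.mem_powerset.1 hF (List.mem_toFinset.2 hx))
      exact ⟨⟨h1, fun x hx => (hb x hx).1, Vald_iff.2 fun x hx => (hb x (by rwa [tl_zero] at hx)).2,
        by omega⟩, rfl⟩
  · refine (encard_Std_le (θ := fun k _ => 2 ^ k) (η := fun a q => 2 ^ (n + 1 - a - q)) hc hn
      (fun a q => encard_Vl_le (η := fun a q => 2 ^ (n + 1 - a - q)) (fun a q _ => Nat.one_le_two_pow)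
        (fun a q h1 h2 => ?_) _ a q rfl) (fun k s => ?_) (fun k dd hk => ?_)
      (M - 1 + e) 1 e 0 d W rfl hW hM hd (by omega)).trans (key _ fun F hF => ?_)
    · simp only [show n + 1 - a - (q + 1) = n - a - q by omega,
        show n + 1 - (a + 1) - q = n - a - q by omega,
        show n + 1 - a - q = (n - a - q) + 1 by omega, pow_succ]
      omega
    · simp only [pow_succ]; omega
    · rw [← sum_pow_two]
      refine le_of_eq (Finset.sum_congr rfl fun j hj => ?_)
      rw [Finset.mem_range] at hj
      congr 1
      omega
    · rw [pow_zero, Nat.cast_one, Set.one_le_encard_iff_nonempty]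
      have hF' : ∀ x ∈ F.sort (· ≤ ·), 1 ≤ x ∧ x ≤ n := fun x hx => Finset.mem_Icc.1
        (Finset.mem_powerset.1 hF ((Finset.mem_sort _).1 hx))
      obtain ⟨b, h1, h2, h3⟩ := exists_tl_one (F.sort (· ≤ ·)) 1 0
        (Finset.sortedLT_sort F).pairwise fun x hx => (hF' x hx).1
      refine ⟨b, ⟨h1, h2, Vald_iff.2 fun x hx => (hF' x (h3 ▸ hx)).2, ?_⟩, by rw [h3]; simp⟩
      have hlen := tl_length 1 0 b
      rw [h3, Finset.length_sort] at hlen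
      have := Finset.card_le_card (Finset.mem_powerset.1 hF)
      rw [Nat.card_Icc] at this
      omega
end Squeezed

namespace Squeezed
open Submodule

theorem tl_append (τ q : ℕ) (b b' : List ℕ) :
    tl τ q (b ++ b') = tl τ q b ++ tl τ (q + b.length) b' := by
  induction b generalizing q with
  | nil => simp [tl]
  | cons a b ih => simp [tl, ih, add_assoc, add_comm 1]

theorem tl_snoc (τ q c : ℕ) (b : List ℕ) :
    tl τ q (b ++ [c]) = tl τ q b ++ [c + τ * (q + b.length)] := by
  rw [tl_append]; simp [tl]

theorem tl_injective (τ q : ℕ) : Function.Injective (tl τ q) := by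
  intro b b' h
  induction b generalizing q b' with
  | nil =>
    rcases b' with _ | ⟨a', b'⟩
    · rfl
    · simp [tl] at h
  | cons a b ih =>
    rcases b' with _ | ⟨a', b'⟩
    · simp [tl] at h
    · simp only [tl, List.cons.injEq, Nat.add_right_cancel_iff] at h
      rw [h.1, ih _ h.2]

theorem le_of_mem_tl {τ q a y : ℕ} {b : List ℕ} (hb : ∀ x ∈ b, a ≤ x) (hy : y ∈ tl τ q b) :
    a + τ * q ≤ y := by
  induction b generalizing q with
  | nil => simp [tl] at hy
  | cons c b ih =>
    rcases List.mem_cons.1 hy with rfl | hy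
    · have := hb c (by simp)
      omega
    · have := ih (fun x hx => hb x (by simp [hx])) hy
      have h2 : τ * (q + 1) = τ * q + τ := by ring
      omega

theorem tl_pairwise {τ q : ℕ} {b : List ℕ} (hb : b.Pairwise (· ≤ ·)) :
    (tl τ q b).Pairwise (fun x y => x + τ ≤ y) := by
  induction b generalizing q with
  | nil => simp [tl]
  | cons a b ih =>
    have hb' := List.pairwise_cons.1 hb
    refine List.pairwise_cons.2 ⟨fun y hy => ?_, ih hb'.2⟩
    have := le_of_mem_tl hb'.1 hy
    have h2 : τ * (q + 1) = τ * q + τ := by ring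
    omega

theorem tl_sorted {τ q : ℕ} {b : List ℕ} (hb : b.Pairwise (· ≤ ·)) :
    (tl τ q b).Pairwise (· ≤ ·) :=
  (tl_pairwise hb).imp fun h => by omega

/-- Sorted lists of length `r` with positive entries whose stretching stays in `[1, n]`. -/
def Vn (τ n r : ℕ) : Set (List ℕ) :=
  {b | b.Pairwise (· ≤ ·) ∧ (∀ x ∈ b, 1 ≤ x) ∧ (∀ x ∈ tl τ 0 b, x ≤ n) ∧ b.length = r}

theorem snoc_mem_Vn {τ n r c : ℕ} {b : List ℕ} (h : b ++ [c] ∈ Vn τ n (r + 1)) :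
    b ∈ Vn τ n r ∧ (∀ x ∈ b, x ≤ c) ∧ 1 ≤ c ∧ c + τ * r ≤ n := by
  obtain ⟨h1, h2, h3, h4⟩ := h
  have hr : b.length = r := by simpa using h4
  rw [List.pairwise_append] at h1
  refine ⟨⟨h1.1, fun x hx => h2 x (by simp [hx]), fun x hx => h3 x (by
    rw [tl_snoc]; simp [hx]), hr⟩, fun x hx => h1.2.2 x hx c (by simp), h2 c (by simp), ?_⟩
  refine h3 _ ?_
  rw [tl_snoc]; simp [hr]

theorem mem_Vn_of_append {τ n r : ℕ} {b s : List ℕ} (h : b ++ s ∈ Vn τ n r) :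
    b ∈ Vn τ n b.length := by
  obtain ⟨h1, h2, h3, h4⟩ := h
  exact ⟨(List.pairwise_append.1 h1).1, fun x hx => h2 x (by simp [hx]), fun x hx => h3 x (by
    rw [tl_append]; simp [hx]), rfl⟩

theorem Vn_snoc_cases {τ n r : ℕ} {b : List ℕ} (h : b ∈ Vn τ n (r + 1)) :
    ∃ b' c, b = b' ++ [c] := by
  rcases List.eq_nil_or_concat b with rfl | ⟨b', c, rfl⟩
  · simp [Vn] at h
  · exact ⟨b', c, by simp⟩

theorem Vn_finite (τ n r : ℕ) : (Vn τ n r).Finite := by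
  induction r with
  | zero =>
    refine (Set.finite_singleton []).subset fun b hb => ?_
    simpa using hb.2.2.2
  | succ r ih =>
    refine ((ih.prod (Set.finite_Iic n)).image fun p => p.1 ++ [p.2]).subset fun b hb => ?_
    obtain ⟨b', c, rfl⟩ := Vn_snoc_cases hb
    have := snoc_mem_Vn hb
    exact ⟨(b', c), ⟨this.1, by simp; omega⟩, rfl⟩

theorem reverse_snoc_lt {b b' : List ℕ} {c c' : ℕ} :
    (b ++ [c]).reverse < (b' ++ [c']).reverse ↔ c < c' ∨ (c = c' ∧ b.reverse < b'.reverse) := by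
  simp [List.cons_lt_cons_iff]

theorem exists_tl {τ : ℕ} (hτ : τ = 0 ∨ τ = 1) {n : ℕ} {f : List ℕ}
    (hf : f.Pairwise (fun x y => x + τ ≤ y)) (h1 : ∀ x ∈ f, 1 ≤ x ∧ x ≤ n) :
    ∃ b ∈ Vn τ n f.length, tl τ 0 b = f := by
  rcases hτ with rfl | rfl
  · exact ⟨f, ⟨hf, fun x hx => (h1 x hx).1, fun x hx => (h1 x (by rwa [tl_zero] at hx)).2, rfl⟩,
      tl_zero 0 f⟩
  · obtain ⟨b, h2, h3, h4⟩ := exists_tl_one f 1 0 hf fun x hx => (h1 x hx).1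
    refine ⟨b, ⟨h2, h3, fun x hx => (h1 x (by rwa [h4] at hx)).2, ?_⟩, h4⟩
    rw [← h4, tl_length]

section Alg

variable {K A : Type*} [Field K] [Ring A] [Algebra K A] {x : ℕ → A} {τ : ℕ}

theorem SignComm.prod_perm (hx : SignComm K x τ) {l l' : List ℕ} (h : l.Perm l') :
    (l.map x).prod ∈ K ∙ (l'.map x).prod := by
  induction h with
  | nil => simp
  | cons a _ ih =>
    obtain ⟨k, hk⟩ := mem_span_singleton.1 ih
    exact mem_span_singleton.2 ⟨k, by simp [← hk]⟩
  | swap a b l =>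
    obtain ⟨k, hk⟩ := mem_span_singleton.1 (hx.comm b a)
    exact mem_span_singleton.2 ⟨k, by simp [← mul_assoc, ← hk]⟩
  | trans _ _ ih1 ih2 =>
    obtain ⟨k, hk⟩ := mem_span_singleton.1 ih1
    obtain ⟨k', hk'⟩ := mem_span_singleton.1 ih2
    exact mem_span_singleton.2 ⟨k * k', by rw [← hk, ← hk', smul_smul]⟩

/-- The monomial attached to a list of exponents. -/
def mp (x : ℕ → A) (τ : ℕ) (b : List ℕ) : A := ((tl τ 0 b).map x).prod

theorem SignComm.prod_cases (hx : SignComm K x τ) {n : ℕ} {l : List ℕ}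
    (hl : ∀ j ∈ l, 1 ≤ j ∧ j ≤ n) :
    (l.map x).prod = 0 ∨
      ∃ b ∈ Vn τ n l.length, (tl τ 0 b).Perm l ∧ (l.map x).prod ∈ K ∙ mp x τ b := by
  have hs := List.mergeSort_perm l (· ≤ ·)
  set f := l.mergeSort (· ≤ ·) with hf
  have hsort : f.Pairwise (· ≤ ·) := by
    simpa using List.pairwise_mergeSort (le := fun a b : ℕ => decide (a ≤ b))
      (by simp; intros; omega) (by simp; intros; omega) l
  have hfl : f.length = l.length := hs.length_eq
  have key : f.Pairwise (fun x y => x + τ ≤ y) →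
      ∃ b ∈ Vn τ n l.length, (tl τ 0 b).Perm l ∧ (l.map x).prod ∈ K ∙ mp x τ b := fun h => by
    have hτ : τ = 0 ∨ τ = 1 := by rcases hx.sq with h | h <;> [exact .inl h; exact .inr h.1]
    obtain ⟨b, hb, hbf⟩ := exists_tl hτ h fun j hj => hl j (hs.mem_iff.1 hj)
    refine ⟨b, hfl ▸ hb, hbf ▸ hs, ?_⟩
    rw [mp, hbf]
    exact hx.prod_perm hs.symm
  rcases hx.sq with rfl | ⟨rfl, hsq⟩
  · exact .inr (key hsort)
  · by_cases hnd : l.Nodup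
    · have hfn : f.Nodup := hs.nodup_iff.2 hnd
      exact .inr (key (hsort.imp₂ (fun a b h1 h2 => Nat.lt_of_le_of_ne h1 h2) hfn))
    · left
      rw [List.nodup_iff_sublist] at hnd
      push Not at hnd
      obtain ⟨a, ha⟩ := hnd
      obtain ⟨l', hl'⟩ := ha.exists_perm_append
      have := hx.prod_perm hl'
      simpa [← mul_assoc, hsq] using this

theorem mp_snoc (b : List ℕ) (c : ℕ) : mp x τ (b ++ [c]) = mp x τ b * x (c + τ * b.length) := by
  simp [mp, tl_snoc]

theorem pow_eq_span (n r : ℕ) : spanIcc K x 1 n ^ r =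
    span K {y | ∃ l : List ℕ, l.length = r ∧ (∀ j ∈ l, 1 ≤ j ∧ j ≤ n) ∧ y = (l.map x).prod} := by
  apply le_antisymm
  · induction r with
    | zero =>
      rw [pow_zero, one_eq_span]
      exact span_mono (by rintro _ rfl; exact ⟨[], by simp⟩)
    | succ r ih =>
      rw [pow_succ]
      refine (mul_le_mul_left ih _).trans ?_
      rw [spanIcc, spanOn, span_mul_span, span_le]
      rintro _ ⟨_, ⟨l, h1, h2, rfl⟩, _, ⟨j, hj, rfl⟩, rfl⟩
      refine subset_span ⟨l ++ [j], by simp [h1], fun y hy => ?_, by simp⟩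
      rcases List.mem_append.1 hy with h | h
      · exact h2 y h
      · rw [List.mem_singleton.1 h]; exact hj
  · rw [span_le]
    rintro _ ⟨l, rfl, h2, rfl⟩
    exact map_prod_mem_pow l fun j hj => mem_spanOn (h2 j hj)

theorem SignComm.pow_le_span_mp (hx : SignComm K x τ) (n r : ℕ) :
    spanIcc K x 1 n ^ r ≤ span K (mp x τ '' Vn τ n r) := by
  rw [pow_eq_span, span_le]
  rintro _ ⟨l, rfl, h2, rfl⟩
  rcases hx.prod_cases h2 with h | ⟨b, hb, -, h⟩
  · rw [h]; exact zero_mem _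
  · exact span_mono (by simpa using ⟨b, hb, rfl⟩) h

theorem tl_mem_Icc {n r : ℕ} {b : List ℕ} (hb : b ∈ Vn τ n r) :
    ∀ j ∈ tl τ 0 b, 1 ≤ j ∧ j ≤ n := fun j hj =>
  ⟨by have := le_of_mem_tl hb.2.1 hj; omega, hb.2.2.1 j hj⟩

theorem mp_mem_pow {n r : ℕ} {b : List ℕ} (hb : b ∈ Vn τ n r) :
    mp x τ b ∈ spanIcc K x 1 n ^ r := by
  rw [pow_eq_span]
  exact subset_span ⟨tl τ 0 b, by rw [tl_length, hb.2.2.2], tl_mem_Icc hb, rfl⟩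

/-- The span of the monomials below `b` in reverse lexicographic order. -/
def Lw (K : Type*) {A : Type*} [Field K] [Ring A] [Algebra K A] (x : ℕ → A) (τ n : ℕ)
    (b : List ℕ) : Submodule K A :=
  span K (mp x τ '' {b' | b' ∈ Vn τ n b.length ∧ b.reverse < b'.reverse})

/-- `b` is the leading exponent of some element of `V`. -/
def Lead (V : Submodule K A) (x : ℕ → A) (τ n : ℕ) (b : List ℕ) : Prop :=
  mp x τ b ∈ V ⊔ Lw K x τ n b

theorem SignComm.mem_Lw (hx : SignComm K x τ) {n : ℕ} {b l : List ℕ} (hl : l.length = b.length)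
    (h1 : ∀ j ∈ l, 1 ≤ j ∧ j ≤ n)
    (h : ∀ b' ∈ Vn τ n b.length, (tl τ 0 b').Perm l → b.reverse < b'.reverse) :
    (l.map x).prod ∈ Lw K x τ n b := by
  rcases hx.prod_cases h1 with h0 | ⟨b', hb', hp, hm⟩
  · rw [h0]; exact zero_mem _
  · rw [hl] at hb'
    exact span_mono (by simpa using ⟨b', ⟨hb', h b' hb' hp⟩, rfl⟩) hm

theorem last_ge {n r : ℕ} {b : List ℕ} {c z : ℕ} (hb : b ++ [c] ∈ Vn τ n (r + 1))
    (hz : z ∈ tl τ 0 (b ++ [c])) : z ≤ c + τ * r := by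
  have hr := (snoc_mem_Vn hb).1.2.2.2
  have hs := tl_sorted (τ := τ) (q := 0) hb.1
  rw [tl_snoc, hr, zero_add] at hz hs
  rw [List.pairwise_append] at hs
  rcases List.mem_append.1 hz with h | h
  · exact hs.2.2 z h _ (by simp)
  · exact (List.mem_singleton.1 h).le

theorem lt_of_tl_perm_snoc {n r c : ℕ} {b b' β : List ℕ}
    (hb : b ++ [c] ∈ Vn τ n (r + 1)) (hb' : b' ∈ Vn τ n r) (hlt : b.reverse < b'.reverse)
    (hβ : β ∈ Vn τ n (r + 1)) (hp : (tl τ 0 β).Perm (tl τ 0 b' ++ [c + τ * r])) :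
    (b ++ [c]).reverse < β.reverse := by
  obtain ⟨β, c', rfl⟩ := Vn_snoc_cases hβ
  rw [reverse_snoc_lt]
  have h1 := last_ge hβ (hp.mem_iff.2 (by simp) : c + τ * r ∈ _)
  rcases (show c ≤ c' by omega).lt_or_eq with h | rfl
  · exact .inl h
  · refine .inr ⟨rfl, ?_⟩
    have hβ' := (snoc_mem_Vn hβ).1
    rw [tl_snoc, hβ'.2.2.2, zero_add, List.perm_append_right_iff] at hp
    have := hp.eq_of_pairwise' (tl_sorted hβ'.1) (tl_sorted hb'.1)
    rwa [tl_injective τ 0 this]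

theorem Lead.snoc (hx : SignComm K x τ) {n r c : ℕ} {b : List ℕ} {V V' : Submodule K A}
    (hV : ∀ j, 1 ≤ j → j ≤ n → V * (K ∙ x j) ≤ V') (hb : b ++ [c] ∈ Vn τ n (r + 1))
    (h : Lead V x τ n b) : Lead V' x τ n (b ++ [c]) := by
  obtain ⟨hb1, -, hc, hcn⟩ := snoc_mem_Vn hb
  have hr := hb1.2.2.2
  rw [Lead, mp_snoc, hr]
  have h2 : mp x τ b * x (c + τ * r) ∈ (V ⊔ Lw K x τ n b) * (K ∙ x (c + τ * r)) :=
    mul_mem_mul h (mem_span_singleton_self _)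
  rw [Submodule.sup_mul] at h2
  refine sup_le_sup (hV _ (by omega) hcn) ?_ h2
  rw [Lw, span_mul_span, span_le]
  rintro _ ⟨_, ⟨b', ⟨hb', hlt⟩, rfl⟩, _, rfl, rfl⟩
  rw [hr] at hb'
  have := hx.mem_Lw (n := n) (b := b ++ [c]) (l := tl τ 0 b' ++ [c + τ * r])
    (by simp [tl_length, hb'.2.2.2, hr]) (fun j hj => by
      rcases List.mem_append.1 hj with h | h
      · exact tl_mem_Icc hb' j h
      · rw [List.mem_singleton.1 h]; omega) (fun β hβ hp => by
      simp only [List.length_append, List.length_singleton, hr] at hβ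
      exact lt_of_tl_perm_snoc hb hb' hlt hβ hp)
  simpa [mp] using this

theorem Lead.append (hx : SignComm K x τ) {n : ℕ} {V : ℕ → Submodule K A}
    (hV : ∀ r j, 1 ≤ j → j ≤ n → V r * (K ∙ x j) ≤ V (r + 1)) {b s : List ℕ}
    (hb : b ++ s ∈ Vn τ n (b ++ s).length)
    (h : Lead (V b.length) x τ n b) : Lead (V (b ++ s).length) x τ n (b ++ s) := by
  induction s using List.reverseRecOn with
  | nil => simpa using h
  | append_singleton s c ih =>
    rw [← List.append_assoc] at hb ⊢
    have hl : (b ++ s ++ [c]).length = (b ++ s).length + 1 := by simp [add_assoc]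
    rw [hl] at hb ⊢
    exact Lead.snoc hx (hV _) hb (ih (mem_Vn_of_append hb))

theorem lt_of_top {n β : ℕ} : ∀ {r Z M' : ℕ} {b b' js : List ℕ}, b ∈ Vn τ n r → b' ∈ Vn τ n r →
    Z + τ = M' + τ * r → 1 ≤ M' → (hτ : τ ≤ 1) →
    (∀ y ∈ b, y ≤ M') → b.count M' < β →
    (tl τ 0 b').Perm (js ++ (List.range β).map fun j => Z + τ * (j + 1) - τ * β) →
    b.reverse < b'.reverse := by
  induction β with
  | zero => intro _ _ _ _ _ _ _ _ _ _ _ _ h; simp at h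
  | succ β ih =>
    intro r Z M' b b' js hb hb' hZ hM hτ hle hc hp
    have hlen := hp.length_eq
    simp only [tl_length, hb'.2.2.2, List.length_append, List.length_map, List.length_range] at hlen
    obtain ⟨r, rfl⟩ : ∃ r', r = r' + 1 := ⟨r - 1, by omega⟩
    obtain ⟨b, c, rfl⟩ := Vn_snoc_cases hb
    obtain ⟨b', c', rfl⟩ := Vn_snoc_cases hb'
    rw [mul_add] at hZ
    rw [List.range_succ, List.map_append, ← List.append_assoc] at hp
    simp only [List.map_cons, List.map_nil, Nat.add_sub_cancel] at hp
    have h1 := last_ge hb' (hp.mem_iff.2 (by simp) : Z ∈ _)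
    have h2 := hle c (by simp)
    rw [reverse_snoc_lt]
    by_cases h3 : c < c'
    · exact .inl h3
    obtain rfl : c = M' := by omega
    obtain rfl : c' = c := by omega
    refine .inr ⟨rfl, ?_⟩
    have hb1 := (snoc_mem_Vn hb).1
    have hb1' := (snoc_mem_Vn hb').1
    rw [tl_snoc, hb1'.2.2.2, zero_add, show c' + τ * r = Z by omega,
      List.perm_append_right_iff] at hp
    have hc' : b.count c' < β := by simpa using hc
    refine ih (Z := Z - τ) hb1 hb1' ?_ hM hτ (fun y hy => hle y (by simp [hy])) hc' (js := js) ?_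
    · obtain ⟨r, rfl⟩ : ∃ r', r = r' + 1 := ⟨r - 1, by omega⟩
      rw [mul_add] at hZ ⊢
      omega
    · convert hp using 2
      refine List.map_congr_left fun j hj => ?_
      rw [mul_add, mul_add, mul_one]
      have : τ * r ≥ 0 := by omega
      rcases Nat.le_one_iff_eq_zero_or_eq_one.1 hτ with rfl | rfl <;> omega

/-- The generic spanning condition. -/
def SpanCond (K : Type*) {A : Type*} [Field K] [Ring A] [Algebra K A] (x : ℕ → A) (τ n : ℕ)
    (v : ℕ → A) (N : Set (List ℕ)) (r Z β : ℕ) : Prop :=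
  spanIcc K x 1 n ^ r ≤ prodIdeal N v (spanIcc K x 1 n) r ⊔
    (spanIcc K x 1 n ^ (r - 1) * spanIcc K x (Z + 1) n ⊔
      restTerm (spanIcc K x 1 n) (topProd x τ Z β) r β)

theorem lead_of_spanCond (hx : SignComm K x τ) {n : ℕ} {v : ℕ → A} {N : Set (List ℕ)}
    {r Z β M' : ℕ} (hZ : Z + τ = M' + τ * r) (hM : 1 ≤ M') (hr : 1 ≤ r) (hZn : Z ≤ n)
    (h : SpanCond K x τ n v N r Z β) {V : Submodule K A}
    (hV : prodIdeal N v (spanIcc K x 1 n) r ≤ V) {b : List ℕ} (hb : b ∈ Vn τ n r)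
    (hle : ∀ y ∈ b, y ≤ M') (hc : b.count M' < β) : Lead V x τ n b := by
  have hτ : τ ≤ 1 := by rcases hx.sq with h | h <;> omega
  refine sup_le_sup hV (sup_le ?_ ?_) (h (mp_mem_pow hb))
  · rw [pow_eq_span, spanIcc, spanOn, span_mul_span, span_le]
    rintro _ ⟨_, ⟨l, hl, h2, rfl⟩, _, ⟨z, hz, rfl⟩, rfl⟩
    have := hx.mem_Lw (n := n) (b := b) (l := l ++ [z]) (by simp [hl, hb.2.2.2]; omega)
      (fun j hj => by
        rcases List.mem_append.1 hj with h | h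
        · exact h2 j h
        · rw [List.mem_singleton.1 h]; have := hz.1; have := hz.2; omega) (fun b' hb' hp => by
        rw [hb.2.2.2] at hb'
        obtain ⟨r, rfl⟩ : ∃ r', r = r' + 1 := ⟨r - 1, by omega⟩
        obtain ⟨b, c, rfl⟩ := Vn_snoc_cases hb
        obtain ⟨b', c', rfl⟩ := Vn_snoc_cases hb'
        rw [reverse_snoc_lt]
        have h1 := last_ge hb' (hp.mem_iff.2 (by simp) : z ∈ _)
        have := hle c (by simp)
        have := hz.1
        rw [mul_add] at hZ
        left; omega)
    simpa using this
  · unfold restTerm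
    split_ifs with hβ
    · rw [pow_eq_span, span_mul_span, span_le]
      rintro _ ⟨_, ⟨l, hl, h2, rfl⟩, _, rfl, rfl⟩
      have := hx.mem_Lw (n := n) (b := b)
        (l := l ++ (List.range β).map fun j => Z + τ * (j + 1) - τ * β)
        (by simp [hl, hb.2.2.2]; omega)
        (fun j hj => by
          rcases List.mem_append.1 hj with h | h
          · exact h2 j h
          · obtain ⟨i, hi, rfl⟩ := List.mem_map.1 h
            rw [List.mem_range] at hi
            rcases Nat.le_one_iff_eq_zero_or_eq_one.1 hτ with rfl | rfl <;> omega)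
        (fun b' hb' hp => by
          rw [hb.2.2.2] at hb'
          exact lt_of_top hb hb' hZ hM hτ hle hc hp)
      simpa [topProd, Function.comp_def] using this
    · exact bot_le

end Alg
end Squeezed

namespace Squeezed
open Submodule

section Alg

variable {K A : Type*} [Field K] [Ring A] [Algebra K A] {x v : ℕ → A} {τ : ℕ}

/-- The degree `r` part of the face ideal of `S` in the coordinates `v`. -/
def Jd (K : Type*) {A : Type*} [Field K] [Ring A] [Algebra K A] (v : ℕ → A) (n : ℕ)
    (S : Set (Finset ℕ)) (r : ℕ) : Submodule K A :=
  span K {y | ∃ l : List ℕ, l.length = r ∧ (∀ j ∈ l, 1 ≤ j ∧ j ≤ n) ∧ l.toFinset ∉ S ∧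
    y = (l.map v).prod}

theorem Jd_mul_le {n : ℕ} {S : Set (Finset ℕ)} (hS : ∀ F ∈ S, ∀ G ⊆ F, G ∈ S) (r : ℕ) :
    Jd K v n S r * spanIcc K v 1 n ≤ Jd K v n S (r + 1) := by
  rw [Jd, spanIcc, spanOn, span_mul_span, span_le]
  rintro _ ⟨_, ⟨l, h1, h2, h3, rfl⟩, _, ⟨j, hj, rfl⟩, rfl⟩
  refine subset_span ⟨l ++ [j], by simp [h1], fun y hy => ?_, fun h => h3 (hS _ h _ ?_), by simp⟩
  · rcases List.mem_append.1 hy with h | h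
    · exact h2 y h
    · rw [List.mem_singleton.1 h]; exact hj
  · intro y hy; simp at hy ⊢; exact .inr hy

theorem prodIdeal_le_Jd {n r : ℕ} {S : Set (Finset ℕ)} (hS : ∀ F ∈ S, ∀ G ⊆ F, G ∈ S)
    {N : Set (List ℕ)}
    (hN : ∀ l ∈ N, l.length ≤ r → l.toFinset ∉ S ∧ ∀ j ∈ l, 1 ≤ j ∧ j ≤ n) :
    prodIdeal N v (spanIcc K v 1 n) r ≤ Jd K v n S r := by
  refine iSup_le fun ⟨l, hl, hlr⟩ => ?_
  obtain ⟨h1, h2⟩ := hN l hl hlr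
  rw [pow_eq_span, span_mul_span, span_le]
  rintro _ ⟨_, rfl, _, ⟨l', h3, h4, rfl⟩, rfl⟩
  refine subset_span ⟨l ++ l', by simp [h3, hlr], fun y hy => ?_, fun h => h1 (hS _ h _ ?_),
    by simp⟩
  · rcases List.mem_append.1 hy with h | h
    exacts [h2 y h, h4 y h]
  · intro y hy; simp at hy ⊢; exact .inl hy

theorem Jd_le_pow (n r : ℕ) (S : Set (Finset ℕ)) : Jd K v n S r ≤ spanIcc K v 1 n ^ r := by
  rw [pow_eq_span]
  exact span_mono fun y ⟨l, h1, h2, _, h3⟩ => ⟨l, h1, h2, h3⟩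

instance Jd_finite (n r : ℕ) (S : Set (Finset ℕ)) : FiniteDimensional K (Jd K v n S r) := by
  have := spanOn_fg (K := K) (x := v) (Set.finite_Icc 1 n) r
  exact Submodule.finiteDimensional_of_le (Jd_le_pow n r S)

theorem finrank_span_image_le {f : List ℕ → A} {s : Set (List ℕ)} (hs : s.Finite) :
    Module.finrank K (span K (f '' s)) ≤ s.ncard := by
  classical
  have := finrank_span_finset_le_card (R := K) (hs.toFinset.image f)
  rw [Finset.coe_image, hs.coe_toFinset] at this
  refine this.trans (Finset.card_image_le.trans ?_)
  rw [Set.ncard_eq_toFinset_card s hs]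

theorem finrank_span_image {f : List ℕ → A} {s : Set (List ℕ)} (hs : s.Finite)
    (hf : LinearIndepOn K f s) : Module.finrank K (span K (f '' s)) = s.ncard := by
  have := hs.fintype
  have h := finrank_span_eq_card (R := K) (b := fun i : s => f i) hf
  rw [Set.ncard_eq_toFinset_card' s, Set.toFinset_card, ← h, Set.range_comp', Subtype.range_coe]

theorem SignComm.finrank_Jd_le (hv : SignComm K v τ) (n r : ℕ) (S : Set (Finset ℕ)) :
    Module.finrank K (Jd K v n S r) ≤ {b | b ∈ Vn τ n r ∧ (tl τ 0 b).toFinset ∉ S}.ncard := by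
  have hfin : {b | b ∈ Vn τ n r ∧ (tl τ 0 b).toFinset ∉ S}.Finite :=
    (Vn_finite τ n r).subset fun b hb => hb.1
  refine le_trans ?_ (finrank_span_image_le (K := K) (f := mp v τ) hfin)
  have : FiniteDimensional K
      (span K (mp v τ '' {b | b ∈ Vn τ n r ∧ (tl τ 0 b).toFinset ∉ S})) :=
    FiniteDimensional.span_of_finite K (hfin.image _)
  refine finrank_mono ?_
  rw [Jd, span_le]
  rintro _ ⟨l, rfl, h2, h3, rfl⟩
  rcases hv.prod_cases h2 with h | ⟨b, hb, hp, h⟩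
  · rw [h]; exact zero_mem _
  · refine span_mono ?_ h
    rintro _ rfl
    exact ⟨b, ⟨hb, by rwa [List.toFinset_eq_of_perm _ _ hp]⟩, rfl⟩

theorem span_le_sup_nonlead {n r : ℕ} (V : Submodule K A) :
    ∀ b ∈ Vn τ n r,
      mp x τ b ∈ V ⊔ span K (mp x τ '' {b | b ∈ Vn τ n r ∧ ¬ Lead V x τ n b}) := by
  by_contra hcon
  push Not at hcon
  set X := V ⊔ span K (mp x τ '' {b | b ∈ Vn τ n r ∧ ¬ Lead V x τ n b})
  have hfin : {b | b ∈ Vn τ n r ∧ mp x τ b ∉ X}.Finite :=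
    (Vn_finite τ n r).subset fun b hb => hb.1
  obtain ⟨b, hb, hmax⟩ := hfin.exists_maximalFor List.reverse _ hcon
  by_cases hl : Lead V x τ n b
  · refine hb.2 ((sup_le le_sup_left ?_ : V ⊔ Lw K x τ n b ≤ X) hl)
    rw [Lw, span_le]
    rintro _ ⟨b', ⟨h1, h2⟩, rfl⟩
    rw [hb.1.2.2.2] at h1
    by_contra h3
    exact absurd (hmax ⟨h1, h3⟩ h2.le) (not_le.2 h2)
  · exact hb.2 (le_sup_right (a := V) (subset_span ⟨b, ⟨hb.1, hl⟩, rfl⟩))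

theorem ncard_lead_add {n r : ℕ} (V : Submodule K A) :
    {b | b ∈ Vn τ n r ∧ Lead V x τ n b}.ncard + {b | b ∈ Vn τ n r ∧ ¬ Lead V x τ n b}.ncard =
      (Vn τ n r).ncard := by
  rw [← Set.ncard_union_eq _ ((Vn_finite τ n r).subset fun b hb => hb.1)
    ((Vn_finite τ n r).subset fun b hb => hb.1)]
  · congr 1
    ext b
    by_cases h : Lead V x τ n b <;> simp [h]
  · rw [Set.disjoint_left]
    exact fun b h1 h2 => h2.2 h1.2

theorem ncard_lead_le_finrank {n r : ℕ} (hind : LinearIndepOn K (mp x τ) (Vn τ n r))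
    (V : Submodule K A) [FiniteDimensional K V] :
    {b | b ∈ Vn τ n r ∧ Lead V x τ n b}.ncard ≤ Module.finrank K V := by
  have h1 := ncard_lead_add (n := n) (r := r) (x := x) (τ := τ) V
  have hfin : {b | b ∈ Vn τ n r ∧ ¬ Lead V x τ n b}.Finite :=
    (Vn_finite τ n r).subset fun b hb => hb.1
  set Y := span K (mp x τ '' {b | b ∈ Vn τ n r ∧ ¬ Lead V x τ n b})
  have : FiniteDimensional K Y := FiniteDimensional.span_of_finite K (hfin.image _)
  have h2 : span K (mp x τ '' Vn τ n r) ≤ V ⊔ Y := by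
    rw [span_le]
    rintro _ ⟨b, hb, rfl⟩
    exact span_le_sup_nonlead V b hb
  have h3 := finrank_mono h2
  rw [finrank_span_image (Vn_finite τ n r) hind] at h3
  have h4 := finrank_add_le_finrank_add_finrank V Y
  have h5 : Module.finrank K Y ≤ _ := finrank_span_image_le (K := K) (f := mp x τ) hfin
  omega

theorem finrank_le_ncard_lead {n r : ℕ} (hind : LinearIndepOn K (mp x τ) (Vn τ n r))
    (V : Submodule K A) (hV : V ≤ span K (mp x τ '' Vn τ n r)) :
    Module.finrank K V ≤ {b | b ∈ Vn τ n r ∧ Lead V x τ n b}.ncard := by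
  classical
  have h1 := ncard_lead_add (n := n) (r := r) (x := x) (τ := τ) V
  set NL := {b | b ∈ Vn τ n r ∧ ¬ Lead V x τ n b}
  have hfin : NL.Finite := (Vn_finite τ n r).subset fun b hb => hb.1
  have : FiniteDimensional K (span K (mp x τ '' Vn τ n r)) :=
    FiniteDimensional.span_of_finite K ((Vn_finite τ n r).image _)
  have : FiniteDimensional K V := Submodule.finiteDimensional_of_le hV
  set Y := span K (mp x τ '' NL) with hY
  have hYle : Y ≤ span K (mp x τ '' Vn τ n r) := span_mono (Set.image_mono fun b hb => hb.1)
  have : FiniteDimensional K Y := Submodule.finiteDimensional_of_le hYle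
  have hdis : V ⊓ Y = ⊥ := by
    rw [eq_bot_iff]
    rintro y ⟨hyV, hyY⟩
    rw [mem_bot]
    by_contra hy0
    have hyY' : y ∈ span K (mp x τ '' (hfin.toFinset : Set (List ℕ))) := by
      rwa [hfin.coe_toFinset]
    rw [Submodule.mem_span_image_finset_iff_exists_fun'] at hyY'
    obtain ⟨c, hc⟩ := hyY'
    have hne : (hfin.toFinset.filter fun b => c b ≠ 0).Nonempty := by
      rw [Finset.nonempty_iff_ne_empty]
      intro h
      rw [Finset.filter_eq_empty_iff] at h
      apply hy0
      rw [← hc]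
      exact Finset.sum_eq_zero fun b hb => by
        have := h hb; push Not at this; rw [this, zero_smul]
    obtain ⟨b, hb, hmin⟩ := Finset.exists_min_image _ List.reverse hne
    rw [Finset.mem_filter, hfin.mem_toFinset] at hb
    refine hb.1.2 ?_
    have h2 : c b • mp x τ b = y - ∑ b' ∈ hfin.toFinset.erase b, c b' • mp x τ b' := by
      rw [← hc, ← Finset.add_sum_erase _ _ (hfin.mem_toFinset.2 hb.1)]
      abel
    have h3 : c b • mp x τ b ∈ V ⊔ Lw K x τ n b := by
      rw [h2]
      refine sub_mem (le_sup_left (b := Lw K x τ n b) hyV) (le_sup_right (a := V) (sum_mem ?_))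
      intro b' hb'
      rw [Finset.mem_erase, hfin.mem_toFinset] at hb'
      by_cases h0 : c b' = 0
      · rw [h0, zero_smul]; exact zero_mem _
      · refine smul_mem _ _ (subset_span ⟨b', ⟨?_, ?_⟩, rfl⟩)
        · rw [hb.1.1.2.2.2]; exact hb'.2.1
        · refine lt_of_le_of_ne (hmin b' ?_) fun h => hb'.1 (List.reverse_injective h).symm
          rw [Finset.mem_filter, hfin.mem_toFinset]
          exact ⟨hb'.2, h0⟩
    have := smul_mem _ (c b)⁻¹ h3
    rwa [smul_smul, inv_mul_cancel₀ hb.2, one_smul] at this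
  have h2 := finrank_sup_add_finrank_inf_eq V Y
  rw [hdis, finrank_bot, add_zero] at h2
  have h3 := finrank_mono (sup_le hV hYle)
  rw [finrank_span_image (Vn_finite τ n r) hind] at h3
  have h4 : Module.finrank K Y = NL.ncard := finrank_span_image hfin (hind.mono fun b hb => hb.1)
  omega

theorem SignComm.linearIndepOn_of_span_eq (hv : SignComm K v τ) (hx : SignComm K x τ) {n r : ℕ}
    (hind : LinearIndepOn K (mp x τ) (Vn τ n r)) (h : spanIcc K v 1 n = spanIcc K x 1 n) :
    LinearIndepOn K (mp v τ) (Vn τ n r) := by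
  have hspan : span K (mp v τ '' Vn τ n r) = span K (mp x τ '' Vn τ n r) := by
    have key : ∀ {w : ℕ → A}, SignComm K w τ →
        span K (mp w τ '' Vn τ n r) = spanIcc K w 1 n ^ r := fun hw =>
      le_antisymm (span_le.2 (by rintro _ ⟨b, hb, rfl⟩; exact mp_mem_pow hb))
        (hw.pow_le_span_mp n r)
    rw [key hv, key hx, h]
  have := (Vn_finite τ n r).fintype
  refine linearIndependent_iff_card_eq_finrank_span.2 ?_
  have h1 := finrank_span_image (Vn_finite τ n r) hind
  rw [Set.finrank, Set.range_comp', Subtype.range_coe, hspan, h1, ← Set.toFinset_card,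
    Set.ncard_eq_toFinset_card']

/-- The exponent lists which survive for `W`. -/
def StdB (M e d : ℕ) (W : Set (List ℕ)) (b : List ℕ) : Prop :=
  b.filter (· < M) ++ List.replicate (e - (b.filter (· < M)).length) M ∈ W ∧
    b.count M + 2 * (b.filter (· < M)).length ≤ d

theorem mem_Vl_iff {n r : ℕ} {b : List ℕ} : b ∈ Vl τ n r 1 0 ↔ b.length ≤ r ∧ b ∈ Vn τ n b.length := by
  simp [Vl, Vn, Vald_iff]
  tauto

theorem ncard_eq_of_le {X Y : Set (List ℕ)} {R r : ℕ} (hX : X.Finite) (hY : Y.Finite)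
    (hXR : ∀ b ∈ X, b.length ≤ R) (hYR : ∀ b ∈ Y, b.length ≤ R)
    (h : X.ncard ≤ Y.ncard)
    (hle : ∀ q, {b | b ∈ Y ∧ b.length = q}.ncard ≤ {b | b ∈ X ∧ b.length = q}.ncard) (hr : r ≤ R) :
    {b | b ∈ X ∧ b.length = r}.ncard ≤ {b | b ∈ Y ∧ b.length = r}.ncard := by
  classical
  have key : ∀ {X : Set (List ℕ)}, X.Finite → (∀ b ∈ X, b.length ≤ R) →
      X.ncard = ∑ q ∈ Finset.range (R + 1), {b | b ∈ X ∧ b.length = q}.ncard := by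
    intro X hX hXR
    rw [Set.ncard_eq_toFinset_card X hX, Finset.card_eq_sum_card_fiberwise (f := List.length)
      (t := Finset.range (R + 1))]
    · refine Finset.sum_congr rfl fun q _ => ?_
      rw [← Set.ncard_coe_finset]
      congr 1
      ext b
      simp
    · intro b hb
      have := hXR b (by simpa using hb)
      simp; omega
  rw [key hX hXR, key hY hYR] at h
  by_contra hlt
  push Not at hlt
  exact absurd h (not_le.2 (Finset.sum_lt_sum (fun q _ => hle q)
    ⟨r, Finset.mem_range.2 (by omega), hlt⟩))

theorem lead_iff_of_nonstd {n d e c M : ℕ} {W : Set (List ℕ)}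
    (hv : SignComm K v τ) (hτ : τ = 0 ∨ τ = 1)
    (hind : ∀ r, LinearIndepOn K (mp x τ) (Vn τ n r)) (hc : c ≤ 1) (hn : n = M + d)
    (hd : d + 2 = 2 * e + c) (hM : 1 ≤ M) (hW : Good 1 M e W)
    (h : ∀ r, ∀ b ∈ Vn τ n r, ¬ StdB M e d W b →
      Lead (Jd K v n (bd d (fac n 0 '' W)) r) x τ n b) {r : ℕ} {b : List ℕ} (hb : b ∈ Vn τ n r) :
    Lead (Jd K v n (bd d (fac n 0 '' W)) r) x τ n b ↔ ¬ StdB M e d W b := by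
  set S := bd d (fac n 0 '' W)
  have hfin : ∀ r (P : List ℕ → Prop), {b | b ∈ Vn τ n r ∧ P b}.Finite := fun r P =>
    (Vn_finite τ n r).subset fun b hb => hb.1
  have hadd : ∀ r (P : List ℕ → Prop), {b | b ∈ Vn τ n r ∧ P b}.ncard +
      {b | b ∈ Vn τ n r ∧ ¬ P b}.ncard = (Vn τ n r).ncard := by
    intro r P
    rw [← Set.ncard_union_eq _ (hfin _ _) (hfin _ _)]
    · congr 1
      ext b
      by_cases h : P b <;> simp [h]
    · rw [Set.disjoint_left]
      exact fun b h1 h2 => h2.2 h1.2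
  have h1 : ∀ r, {b | b ∈ Vn τ n r ∧ ¬ StdB M e d W b}.ncard ≤
      {b | b ∈ Vn τ n r ∧ Lead (Jd K v n S r) x τ n b}.ncard := fun r =>
    Set.ncard_le_ncard (fun b hb => ⟨hb.1, h r b hb.1 hb.2⟩) (hfin _ _)
  have h2 : ∀ r, {b | b ∈ Vn τ n r ∧ Lead (Jd K v n S r) x τ n b}.ncard ≤
      {b | b ∈ Vn τ n r ∧ (tl τ 0 b).toFinset ∉ S}.ncard := fun r =>
    (ncard_lead_le_finrank (hind r) _).trans (hv.finrank_Jd_le n r S)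
  have h3 : ∀ r, {b | b ∈ Vn τ n r ∧ (tl τ 0 b).toFinset ∈ S}.ncard ≤
      {b | b ∈ Vn τ n r ∧ StdB M e d W b}.ncard := fun r => by
    have := h1 r; have := h2 r
    have := hadd r (StdB M e d W); have := hadd r (fun b => (tl τ 0 b).toFinset ∈ S)
    omega
  set R := max r (n + 1)
  have hfinR : (Vl τ n R 1 0).Finite := by
    refine ((Set.finite_Iic R).biUnion fun q _ => Vn_finite τ n q).subset fun b hb => ?_
    rw [mem_Vl_iff] at hb
    simp only [Set.mem_iUnion]
    exact ⟨b.length, hb.1, hb.2⟩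
  have h4 := encard_Std_le_encard hτ hc hn hd (le_max_right r (n + 1)) hM hW
  have hfX : (Std τ n R 1 0 M e d W).Finite := hfinR.subset fun b hb => hb.1
  have hfY : {b | b ∈ Vl τ n R 1 0 ∧ (tl τ 0 b).toFinset ∈ S}.Finite :=
    hfinR.subset fun b hb => hb.1
  rw [← hfX.cast_ncard_eq, ← hfY.cast_ncard_eq, Nat.cast_le] at h4
  have hX : ∀ q ≤ R, {b | b ∈ Std τ n R 1 0 M e d W ∧ b.length = q} =
      {b | b ∈ Vn τ n q ∧ StdB M e d W b} := by
    intro q hq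
    ext b
    simp only [Std, Set.mem_ofPred_eq, mem_Vl_iff, StdB]
    constructor
    · rintro ⟨⟨h1, h2⟩, rfl⟩; exact ⟨h1.2, h2⟩
    · rintro ⟨h1, h2⟩
      obtain rfl := h1.2.2.2
      exact ⟨⟨⟨hq, h1⟩, h2⟩, rfl⟩
  have hY : ∀ q ≤ R, {b | b ∈ {b | b ∈ Vl τ n R 1 0 ∧ (tl τ 0 b).toFinset ∈ S} ∧ b.length = q} =
      {b | b ∈ Vn τ n q ∧ (tl τ 0 b).toFinset ∈ S} := by
    intro q hq
    ext b
    simp only [Set.mem_ofPred_eq, mem_Vl_iff]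
    constructor
    · rintro ⟨⟨h1, h2⟩, rfl⟩; exact ⟨h1.2, h2⟩
    · rintro ⟨h1, h2⟩
      obtain rfl := h1.2.2.2
      exact ⟨⟨⟨hq, h1⟩, h2⟩, rfl⟩
  have h5 := ncard_eq_of_le (r := r) hfX hfY (fun b hb => (mem_Vl_iff.1 hb.1).1)
    (fun b hb => (mem_Vl_iff.1 hb.1).1) h4 (fun q => by
      by_cases hq : q ≤ R
      · rw [hX q hq, hY q hq]; exact h3 q
      · rw [show {b | b ∈ {b | b ∈ Vl τ n R 1 0 ∧ (tl τ 0 b).toFinset ∈ S} ∧ b.length = q} = ∅ from ?_]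
        · simp
        · ext b
          simp only [Set.mem_ofPred_eq, mem_Vl_iff, Set.mem_empty_iff_false, iff_false]
          rintro ⟨⟨h, -⟩, rfl⟩
          exact hq h.1) (le_max_left r _)
  rw [hX r (le_max_left r _), hY r (le_max_left r _)] at h5
  have h6 : {b | b ∈ Vn τ n r ∧ ¬ StdB M e d W b} =
      {b | b ∈ Vn τ n r ∧ Lead (Jd K v n S r) x τ n b} := by
    refine Set.eq_of_subset_of_ncard_le (fun b hb => ⟨hb.1, h r b hb.1 hb.2⟩) ?_ (hfin _ _)
    have := h2 r
    have := hadd r (StdB M e d W); have := hadd r (fun b => (tl τ 0 b).toFinset ∈ S)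
    omega
  have h7 := Set.ext_iff.1 h6 b
  simp only [Set.mem_ofPred_eq, hb, true_and] at h7
  exact h7.symm

end Alg
end Squeezed

namespace Squeezed
open Submodule

/-- Pad a list to length `e` with entries `M`. -/
def pad (M e : ℕ) (p : List ℕ) : List ℕ := p ++ List.replicate (e - p.length) M

theorem sorted_decomp (M : ℕ) {b : List ℕ} (hb : b.Pairwise (· ≤ ·)) :
    ∃ s, b = b.filter (· < M) ++ (List.replicate (b.count M) M ++ s) := by
  induction b with
  | nil => exact ⟨[], by simp⟩
  | cons a b ih =>
    have hb' := List.pairwise_cons.1 hb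
    obtain ⟨s, hs⟩ := ih hb'.2
    rcases lt_trichotomy a M with h | rfl | h
    · refine ⟨s, ?_⟩
      rw [List.filter_cons_of_pos (by simpa using h), List.count_cons_of_ne (by simpa using h.ne)]
      rw [List.cons_append, ← hs]
    · refine ⟨s, ?_⟩
      have h0 : b.filter (· < a) = [] := by
        rw [List.filter_eq_nil_iff]
        intro y hy; have := hb'.1 y hy; simp; omega
      rw [List.filter_cons_of_neg (by simp), List.count_cons_self, h0, List.nil_append,
        List.replicate_succ, List.cons_append]
      rw [h0, List.nil_append] at hs
      rw [← hs]
    · refine ⟨a :: b, ?_⟩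
      have h0 : b.filter (· < M) = [] := by
        rw [List.filter_eq_nil_iff]
        intro y hy; have := hb'.1 y hy; simp; omega
      have h1 : b.count M = 0 := by
        rw [List.count_eq_zero]; intro hy; have := hb'.1 M hy; omega
      rw [List.filter_cons_of_neg (by simp; omega), List.count_cons_of_ne (by omega), h0, h1]
      simp

theorem exists_le_of_forall₂ {s t : List ℕ} (h : List.Forall₂ (· ≤ ·) s t) {y : ℕ} (hy : y ∈ s) :
    ∃ y' ∈ t, y ≤ y' := by
  induction h with
  | nil => simp at hy
  | cons h1 _ ih =>
    rcases List.mem_cons.1 hy with rfl | hy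
    · exact ⟨_, by simp, h1⟩
    · obtain ⟨y', h2, h3⟩ := ih hy
      exact ⟨y', by simp [h2], h3⟩

/-- The lists with fewer than `l` entries bounded by `N`. -/
def Wnl (M e N l : ℕ) : Set (List ℕ) :=
  {s | s ∈ Lst 1 M e ∧ M ∈ s ∧ ∃ y ∈ s.take l, N < y}

theorem good_Wnl (M e N l : ℕ) : Good 1 M e (Wnl M e N l) where
  sub _ hs := hs.1
  top _ hs := hs.2.1
  up s hs t ht hst := by
    obtain ⟨y, hy, hy'⟩ := exists_le_of_forall₂ hst hs.2.1
    refine ⟨ht, le_antisymm (ht.2.2 y hy).2 hy' ▸ hy, ?_⟩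
    obtain ⟨y, hy, hN⟩ := hs.2.2
    obtain ⟨y', h1, h2⟩ := exists_le_of_forall₂ (List.forall₂_take l hst) hy
    exact ⟨y', h1, hN.trans_le h2⟩

/-- The lists in `Lst 1 M e` which contain `M`. -/
def Wall (M e : ℕ) : Set (List ℕ) := {s | s ∈ Lst 1 M e ∧ M ∈ s}

theorem good_Wall (M e : ℕ) : Good 1 M e (Wall M e) where
  sub _ hs := hs.1
  top _ hs := hs.2
  up s hs t ht hst := by
    obtain ⟨y, hy, hy'⟩ := exists_le_of_forall₂ hst hs.2
    exact ⟨ht, le_antisymm (ht.2.2 y hy).2 hy' ▸ hy⟩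

theorem pad_length {M e : ℕ} {p : List ℕ} (h : p.length ≤ e) : (pad M e p).length = e := by
  simp [pad]; omega

theorem pad_mem_Lst {M e : ℕ} {p : List ℕ} (h : p.length ≤ e) (hM : 1 ≤ M)
    (hp : p.Pairwise (· ≤ ·)) (h1 : ∀ y ∈ p, 1 ≤ y ∧ y ≤ M) : pad M e p ∈ Lst 1 M e := by
  refine ⟨pad_length h, ?_, fun y hy => ?_⟩
  · rw [pad, List.pairwise_append]
    refine ⟨hp, List.pairwise_replicate.2 (by simp), fun a ha b hb => ?_⟩
    rw [(List.mem_replicate.1 hb).2]; exact (h1 a ha).2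
  · rcases List.mem_append.1 hy with hy | hy
    · exact h1 y hy
    · rw [(List.mem_replicate.1 hy).2]; exact ⟨hM, le_rfl⟩

theorem mem_pad {M e : ℕ} {p : List ℕ} (h : p.length < e) : M ∈ pad M e p := by
  simp [pad]; omega

theorem phi2_pad {M σ j m : ℕ} {q : List ℕ} (hσ : σ = 2 * j) (hq : ∀ y ∈ q, y < M) :
    phi2 M σ (q ++ List.replicate m M) = tl 2 j q := by
  induction q generalizing σ j with
  | nil => rcases m with _ | m <;> simp [phi2, tl, List.replicate_succ]
  | cons a q ih =>
    rw [List.cons_append, phi2, if_pos (hq a (by simp)), tl, hσ,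
      ih (j := j + 1) (by ring) fun y hy => hq y (by simp [hy])]

theorem phi2_of_lt {M N σ j : ℕ} {q : List ℕ} (hσ : σ = 2 * j) (hq : ∀ y ∈ q, y < M) :
    phi2 M σ q = tl 2 j q := by
  simpa using phi2_pad (m := 0) hσ hq

theorem lt_length_intl {n M : ℕ} : ∀ {s : List ℕ} {i e σ : ℕ}, s ∈ Lst i M e → M ∈ s →
    n + 1 = M + σ + 2 * e → e < (intl M n σ s).length := by
  intro s
  induction s with
  | nil => intro _ _ _ _ h; simp at h
  | cons a s ih =>
    intro i e σ hs hM hn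
    obtain ⟨e, rfl⟩ : ∃ e', e = e' + 1 := ⟨s.length, by rw [← hs.1]; rfl⟩
    rw [Lst_cons_iff] at hs
    rw [intl]
    split_ifs with h
    · have := ih hs.2.2 (by
        rcases List.mem_cons.1 hM with h' | h'
        · omega
        · exact h') (show n + 1 = M + (σ + 2) + 2 * e by omega)
      simp; omega
    · simp; omega

theorem bd_down {k : ℕ} {𝓕 : Set (Finset ℕ)} : ∀ F ∈ bd k 𝓕, ∀ G ⊆ F, G ∈ bd k 𝓕 :=
  fun _ hF _ hG => bd_mono hG hF

section Alg

variable {K A : Type*} [Field K] [Ring A] [Algebra K A] {x v : ℕ → A} {τ : ℕ}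

theorem Jd_mul_x {n : ℕ} {S : Set (Finset ℕ)} (hspan : spanIcc K v 1 n = spanIcc K x 1 n)
    (hS : ∀ F ∈ S, ∀ G ⊆ F, G ∈ S) (r j : ℕ) (h1 : 1 ≤ j) (h2 : j ≤ n) :
    Jd K v n S r * (K ∙ x j) ≤ Jd K v n S (r + 1) := by
  refine le_trans (mul_le_mul_right ?_ _) (Jd_mul_le hS r)
  rw [hspan, span_singleton_le_iff_mem]
  exact mem_spanOn ⟨h1, h2⟩

theorem Lead.mono {V V' : Submodule K A} (hV : V ≤ V') {n : ℕ} {b : List ℕ}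
    (h : Lead V x τ n b) : Lead V' x τ n b :=
  sup_le_sup hV le_rfl h

/-- The generic spanning conditions for the nonfaces attached to `W`. -/
def GenCond (K : Type*) {A : Type*} [Field K] [Ring A] [Algebra K A] (x : ℕ → A) (τ n d e M : ℕ)
    (v : ℕ → A) (W : Set (List ℕ)) : Prop :=
  ∀ r ≤ d + 1, d < 2 * r →
    SpanCond K x τ n v (NF n 1 0 M e W) r (M + τ * (r - 1)) (2 * r - d)

theorem entries_NF {n M e : ℕ} {W : Set (List ℕ)} {l : List ℕ} (h : l ∈ NF n 1 0 M e W) :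
    ∀ j ∈ l, 1 ≤ j ∧ j ≤ n := fun j hj => h.2.1 j hj

theorem lead_of_not_stdB {n d e c M : ℕ} {W : Set (List ℕ)} (hx : SignComm K x τ)
    (hspan : spanIcc K v 1 n = spanIcc K x 1 n) (hc : c ≤ 1) (hn : n = M + d)
    (hd : d + 2 = 2 * e + c) (hM : 1 ≤ M) (hW : Good 1 M e W)
    (hgen : GenCond K x τ n d e M v W)
    (hpre : ∀ p ∈ Vn τ n p.length, p.length < e → (∀ y ∈ p, y < M) → pad M e p ∉ W →
      Lead (Jd K v n (bd d (fac n 0 '' W)) p.length) x τ n p) {r : ℕ} {b : List ℕ}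
    (hb : b ∈ Vn τ n r) (hnb : ¬ StdB M e d W b) :
    Lead (Jd K v n (bd d (fac n 0 '' W)) r) x τ n b := by
  have hτ : τ ≤ 1 := by rcases hx.sq with h | h <;> omega
  obtain rfl := hb.2.2.2
  have hext : ∀ p s, b = p ++ s → Lead (Jd K v n (bd d (fac n 0 '' W)) p.length) x τ n p →
      Lead (Jd K v n (bd d (fac n 0 '' W)) b.length) x τ n b := by
    rintro p s rfl h
    exact Lead.append hx (fun r j => Jd_mul_x hspan bd_down r j) hb h
  have hsp : ∀ p s r, b = p ++ s → r ≤ d + 1 → d < 2 * r → p.length = r → (∀ y ∈ p, y ≤ M) →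
      p.count M < 2 * r - d → Lead (Jd K v n (bd d (fac n 0 '' W)) b.length) x τ n b := by
    rintro p s r hbp hr hr' rfl hp hcount
    refine hext p s hbp ?_
    obtain ⟨r, hr0⟩ : ∃ r', p.length = r' + 1 := ⟨p.length - 1, by omega⟩
    refine lead_of_spanCond hx (M' := M) (Z := M + τ * (p.length - 1)) ?_ hM (by omega) ?_
      (hgen _ hr hr') ?_ (mem_Vn_of_append (s := s) (hbp ▸ hb)) hp hcount
    · rw [hr0, Nat.add_sub_cancel, mul_add]; omega
    · rcases Nat.le_one_iff_eq_zero_or_eq_one.1 hτ with rfl | rfl <;> omega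
    · rw [← hspan]
      refine prodIdeal_le_Jd bd_down fun l hl _ => ⟨?_, entries_NF hl⟩
      exact NF_notMem_bd hc hW (by omega) (by omega) hl
  obtain ⟨s, hs⟩ := sorted_decomp M hb.1
  set f := b.filter (· < M) with hf
  have hfM : ∀ y ∈ f, y < M := fun y hy => by simpa using List.of_mem_filter hy
  rcases lt_or_ge f.length e with hlt | hge
  · by_cases hpad : pad M e f ∈ W
    · have hq : ¬ (b.count M + 2 * f.length ≤ d) := fun h => hnb ⟨hpad, h⟩
      refine hsp (f ++ List.replicate (d + 1 - 2 * f.length) M)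
        (List.replicate (b.count M - (d + 1 - 2 * f.length)) M ++ s) (d + 1 - f.length) ?_ ?_ ?_
        ?_ ?_ ?_
      · conv_lhs => rw [hs]
        rw [List.append_assoc, ← List.append_assoc (List.replicate _ M), List.replicate_append_replicate]
        rw [Nat.add_sub_cancel' (by omega)]
      · omega
      · omega
      · simp; omega
      · intro y hy
        rcases List.mem_append.1 hy with h | h
        · exact (hfM y h).le
        · exact (List.mem_replicate.1 h).2.le
      · rw [List.count_append, List.count_eq_zero.2 (fun h => (hfM M h).false),
          List.count_replicate_self]
        omega
    · refine hext f _ hs (hpre f (mem_Vn_of_append (hs ▸ hb)) hlt hfM hpad)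
  · refine hsp (f.take e) (f.drop e ++ (List.replicate (b.count M) M ++ s)) e ?_ (by omega)
      (by omega) (by simp; omega) (fun y hy => (hfM y (List.mem_of_mem_take hy)).le) ?_
    · rw [← List.append_assoc, List.take_append_drop]; exact hs
    · rw [List.count_eq_zero.2 (fun h => (hfM M (List.mem_of_mem_take h)).false)]
      omega

theorem lead_of_le {n d e c M N l : ℕ} (hx : SignComm K x τ)
    (hspan : spanIcc K v 1 n = spanIcc K x 1 n) (hn : n = M + d)
    (hd : d + 2 = 2 * e + c) (hN : N < M) (hl : 1 ≤ l) (hle : l < e)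
    (hgen : SpanCond K x τ n v (NF (N + 2 * l) 1 0 (N + 1) l (Wall (N + 1) l)) l
      (N + 1 + τ * (l - 1)) 1) {b : List ℕ} (hb : b ∈ Vn τ n l) (hbN : ∀ y ∈ b, y ≤ N) :
    Lead (Jd K v n (bd d (fac n 0 '' Wnl M e N l)) l) x τ n b := by
  have hτ : τ ≤ 1 := by rcases hx.sq with h | h <;> omega
  refine lead_of_spanCond hx (M' := N + 1) (Z := N + 1 + τ * (l - 1)) ?_ (by omega) hl ?_ hgen ?_ hb
    (fun y hy => (hbN y hy).trans (Nat.le_succ N)) ?_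
  · obtain ⟨l, rfl⟩ : ∃ l', l = l' + 1 := ⟨l - 1, by omega⟩
    rw [Nat.add_sub_cancel, mul_add]; omega
  · rcases Nat.le_one_iff_eq_zero_or_eq_one.1 hτ with rfl | rfl <;> omega
  · rw [← hspan]
    refine prodIdeal_le_Jd bd_down fun l' hl' hlen =>
      ⟨?_, fun j hj => ⟨(entries_NF hl' j hj).1, (entries_NF hl' j hj).2.trans (by omega)⟩⟩
    obtain ⟨-, -, ⟨s, hs, hsW, hsl⟩ | ⟨s, hs, hsl⟩⟩ := hl'
    · have hsN : ∀ y ∈ s, y < N + 1 := fun y hy =>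
        lt_of_le_of_ne (hs.2.2 y hy).2 fun h => hsW ⟨hs, h ▸ hy⟩
      rintro ⟨R, hlR, -, H, ⟨⟨t, ht, rfl⟩, hRt⟩, -⟩
      have hs' : pad M e s ∈ Lst 1 M e := pad_mem_Lst (by rw [hs.1]; omega) (by omega) hs.2.1
        fun y hy => ⟨(hs.2.2 y hy).1, by have := hsN y hy; omega⟩
      have hphi : phi2 M 0 (pad M e s) = phi2 (N + 1) 0 s := by
        rw [pad, phi2_pad (j := 0) rfl fun y hy => by have := hsN y hy; omega,
          phi2_of_lt (j := 0) (N := N) rfl hsN]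
      have h1 := le_of_phi2_subset (n := n) 1 0 e hs' ht.1 (fun y hy => hRt (hlR (by
        rw [hphi] at hy; simpa using hsl.subset hy)))
      obtain ⟨y, hy, hNy⟩ := ht.2.2
      obtain ⟨y', hy', hyy⟩ := exists_le_of_forall₂ (List.forall₂_take l h1) hy
      rw [pad, List.take_append_of_le_length (by rw [hs.1])] at hy'
      have := hsN y' (List.mem_of_mem_take hy')
      omega
    · have h1 := lt_length_intl (n := N + 2 * l) (σ := 0) hs.1 hs.2 (by omega)
      have h2 := hsl.length_le
      omega
  · rw [List.count_eq_zero.2 fun h => by have := hbN _ h; omega]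
    exact one_pos

/-- All the generic conditions needed for `W`. -/
def AllCond (K : Type*) {A : Type*} [Field K] [Ring A] [Algebra K A] (x : ℕ → A) (τ n d e M : ℕ)
    (v : ℕ → A) (W : Set (List ℕ)) : Prop :=
  GenCond K x τ n d e M v W ∧ ∀ N ∈ Finset.range M, ∀ l ∈ Finset.range e, 1 ≤ l →
    GenCond K x τ n d e M v (Wnl M e N l) ∧
    SpanCond K x τ n v (NF (N + 2 * l) 1 0 (N + 1) l (Wall (N + 1) l)) l
      (N + 1 + τ * (l - 1)) 1

theorem lead_iff_Wnl {n d e c M N l : ℕ} {W : Set (List ℕ)} (hx : SignComm K x τ)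
    (hv : SignComm K v τ) (hspan : spanIcc K v 1 n = spanIcc K x 1 n)
    (hind : ∀ r, LinearIndepOn K (mp x τ) (Vn τ n r)) (hc : c ≤ 1) (hn : n = M + d)
    (hd : d + 2 = 2 * e + c) (hM : 1 ≤ M) (hgen : AllCond K x τ n d e M v W) (hN : N < M)
    (hl : 1 ≤ l) (hle : l < e) {r : ℕ} {b : List ℕ} (hb : b ∈ Vn τ n r) :
    Lead (Jd K v n (bd d (fac n 0 '' Wnl M e N l)) r) x τ n b ↔ ¬ StdB M e d (Wnl M e N l) b := by
  have hτ : τ = 0 ∨ τ = 1 := by rcases hx.sq with h | h <;> omega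
  obtain ⟨h1, h2⟩ := hgen.2 N (by simpa using hN) l (by simpa using hle) hl
  refine lead_iff_of_nonstd hv hτ hind hc hn hd hM (good_Wnl M e N l) (fun r b hb hnb => ?_) hb
  refine lead_of_not_stdB hx hspan hc hn hd hM (good_Wnl M e N l) h1 ?_ hb hnb
  intro p hp hpe hpM hpad
  have hpN : l ≤ p.length ∧ ∀ y ∈ p.take l, y ≤ N := by
    have h3 : ∀ y ∈ (pad M e p).take l, y ≤ N := by
      by_contra hcon
      push Not at hcon
      exact hpad ⟨pad_mem_Lst hpe.le hM hp.1 fun y hy => ⟨hp.2.1 y hy, (hpM y hy).le⟩,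
        mem_pad hpe, hcon⟩
    have h4 : l ≤ p.length := by
      by_contra hlt
      have := h3 M (by
        rw [pad, List.take_append, List.mem_append]
        right
        rw [List.take_replicate, List.mem_replicate]
        exact ⟨by omega, rfl⟩)
      omega
    rw [pad, List.take_append_of_le_length h4] at h3
    exact ⟨h4, h3⟩
  have htl : (p.take l).length = l := by simp [hpN.1]
  have hpe' : p = p.take l ++ p.drop l := (List.take_append_drop l p).symm
  have h5 := lead_of_le hx hspan hn hd hN hl hle h2 (b := p.take l)
    (by have := mem_Vn_of_append (hpe' ▸ hp); rwa [htl] at this) hpN.2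
  have h6 := Lead.append (V := Jd K v n (bd d (fac n 0 '' Wnl M e N l))) (b := p.take l)
    (s := p.drop l) hx (fun r j => Jd_mul_x hspan bd_down r j)
    (by rw [← hpe']; exact hp) (by rw [htl]; exact h5)
  rwa [← hpe'] at h6

end Alg
end Squeezed

namespace Squeezed
open Submodule

section Alg

variable {K A : Type*} [Field K] [Ring A] [Algebra K A] {x v : ℕ → A} {τ : ℕ}

theorem tl_le_of_mem {M τ q : ℕ} {b : List ℕ} (hb : ∀ y ∈ b, y < M) {y : ℕ} (hy : y ∈ tl τ q b) :
    y + 1 + τ ≤ M + τ * (q + b.length) := by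
  induction b generalizing q with
  | nil => simp [tl] at hy
  | cons a b ih =>
    have ha := hb a (by simp)
    rcases List.mem_cons.1 hy with rfl | hy
    · simp [mul_add]; omega
    · have := ih (fun y hy => hb y (by simp [hy])) hy
      rwa [List.length_cons, show q + (b.length + 1) = q + 1 + b.length by omega]

/-- The sorted lists of positive integers dominated by `p`. -/
def Dom (p : List ℕ) : Set (List ℕ) :=
  {q | q.Pairwise (· ≤ ·) ∧ (∀ y ∈ q, 1 ≤ y) ∧ List.Forall₂ (· ≤ ·) q p}

theorem Dom.lt {p q : List ℕ} {M : ℕ} (hq : q ∈ Dom p) (hp : ∀ y ∈ p, y < M) : ∀ y ∈ q, y < M :=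
  fun y hy => by
    obtain ⟨y', h1, h2⟩ := exists_le_of_forall₂ hq.2.2 hy
    exact h2.trans_lt (hp y' h1)

theorem Dom.tl_notMem {n d e c M : ℕ} {W : Set (List ℕ)} {p q : List ℕ} (hc : c ≤ 1)
    (hn : n = M + d) (hd : d + 2 = 2 * e + c) (hM : 1 ≤ M) (hW : Good 1 M e W)
    (hp : ∀ y ∈ p, y < M) (hpe : p.length < e) (hq : q ∈ Dom p) (hqW : pad M e q ∉ W) :
    (tl 2 0 q).toFinset ∉ bd d (fac n 0 '' W) := by
  have hlen : q.length = p.length := hq.2.2.length_eq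
  have hqM := Dom.lt hq hp
  refine NF_notMem_bd hc hW (by omega) (by omega) (l := tl 2 0 q) ⟨(tl_pairwise hq.1).imp
    fun h => by omega, fun y hy => ⟨?_, ?_⟩, Or.inl ⟨pad M e q, pad_mem_Lst (by omega) hM hq.1
    fun y hy => ⟨hq.2.1 y hy, (hqM y hy).le⟩, hqW, ?_⟩⟩
  · have := le_of_mem_tl hq.2.1 hy; omega
  · have := tl_le_of_mem hqM hy
    omega
  · rw [pad, phi2_pad (j := 0) rfl hqM]

theorem lead_of_pad_notMem {n d e c M : ℕ} {W : Set (List ℕ)} (hx : SignComm K x τ)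
    (hv : SignComm K v τ) (hspan : spanIcc K v 1 n = spanIcc K x 1 n)
    (hind : ∀ r, LinearIndepOn K (mp x τ) (Vn τ n r)) (hc : c ≤ 1) (hn : n = M + d)
    (hd : d + 2 = 2 * e + c) (hM : 1 ≤ M) (hW : Good 1 M e W) (hgen : AllCond K x τ n d e M v W)
    {p : List ℕ} (hp : p ∈ Vn τ n p.length) (hpe : p.length < e) (hpM : ∀ y ∈ p, y < M)
    (hpW : pad M e p ∉ W) :
    Lead (Jd K v n (bd d (fac n 0 '' W)) p.length) x τ n p := by
  have hτ : τ = 0 ∨ τ = 1 := by rcases hx.sq with h | h <;> omega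
  have hex : ∀ q ∈ Dom p, ∃ b ∈ Vn τ n p.length, tl τ 0 b = tl 2 0 q := by
    intro q hq
    have hlen : q.length = p.length := hq.2.2.length_eq
    have hqM := Dom.lt hq hpM
    obtain ⟨b, hb, hbq⟩ := exists_tl hτ (n := n) (f := tl 2 0 q)
      ((tl_pairwise hq.1).imp fun h => by omega) fun y hy => ⟨by
        have := le_of_mem_tl hq.2.1 hy; omega, by have := tl_le_of_mem hqM hy; omega⟩
    exact ⟨b, by rwa [tl_length, hlen] at hb, hbq⟩
  choose! β hβ hβq using hex
  set V := span K (mp v τ '' (β '' Dom p)) with hV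
  have hβV : β '' Dom p ⊆ Vn τ n p.length := by rintro _ ⟨q, hq, rfl⟩; exact hβ q hq
  have hβfin : (β '' Dom p).Finite := (Vn_finite τ n _).subset hβV
  have hβinj : Set.InjOn β (Dom p) := fun q hq q' hq' h =>
    tl_injective 2 0 (by rw [← hβq q hq, ← hβq q' hq', h])
  have hrank : Module.finrank K V = (Dom p).ncard := by
    rw [hV, finrank_span_image hβfin ((hv.linearIndepOn_of_span_eq hx (hind _) hspan).mono hβV),
      hβinj.ncard_image]
  have hVx : V ≤ span K (mp x τ '' Vn τ n p.length) := by
    refine le_trans ?_ (hx.pow_le_span_mp n _)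
    rw [← hspan, hV, span_le]
    rintro _ ⟨b, hb, rfl⟩
    exact mp_mem_pow (hβV hb)
  have hVJ : ∀ W', Good 1 M e W' → (∀ q ∈ Dom p, pad M e q ∉ W') →
      V ≤ Jd K v n (bd d (fac n 0 '' W')) p.length := by
    intro W' hW' h
    rw [hV, span_le]
    rintro _ ⟨_, ⟨q, hq, rfl⟩, rfl⟩
    refine subset_span ⟨tl τ 0 (β q), by rw [tl_length, (hβ q hq).2.2.2],
      tl_mem_Icc (hβ q hq), ?_, rfl⟩
    rw [hβq q hq]
    exact Dom.tl_notMem hc hn hd hM hW' hpM hpe hq (h q hq)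
  have hsub : {b | b ∈ Vn τ n p.length ∧ Lead V x τ n b} ⊆ Dom p := by
    rintro b ⟨hb, hlead⟩
    refine ⟨hb.1, hb.2.1, List.forall₂_iff_get.2 ⟨hb.2.2.2, fun j hj hj' => ?_⟩⟩
    simp only [List.get_eq_getElem]
    by_contra hcon
    push Not at hcon
    have hNM : p[j] < M := hpM _ (List.getElem_mem hj')
    have h1 := (lead_iff_Wnl hx hv hspan hind hc hn hd hM hgen hNM (l := j + 1) (by omega)
      (by omega) hb).1 (by
        rw [show b.length = p.length from hb.2.2.2] at *
        refine Lead.mono (hVJ _ (good_Wnl M e _ _) ?_) hlead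
        rintro q hq ⟨-, -, y, hy, hNy⟩
        have hlen : q.length = p.length := hq.2.2.length_eq
        rw [pad, List.take_append_of_le_length (by omega)] at hy
        obtain ⟨y', hy', hyy⟩ := exists_le_of_forall₂ (List.forall₂_take (j + 1) hq.2.2) hy
        obtain ⟨i, hi, rfl⟩ := List.mem_iff_getElem.1 hy'
        rw [List.getElem_take] at hyy
        have : p[i]'(by simp at hi; omega) ≤ p[j] := by
          simp at hi
          rcases (show i ≤ j by omega).eq_or_lt with h | h
          · subst h; rfl
          · exact List.pairwise_iff_getElem.1 hp.1 i j _ _ h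
        omega)
    apply h1
    obtain ⟨s, hs⟩ := sorted_decomp M hb.1
    set f := b.filter (· < M) with hf
    have hblen := hb.2.2.2
    have hlen2 : f.length + b.count M ≤ p.length := by
      rw [← hblen]
      conv_rhs => rw [hs, List.length_append, List.length_append, List.length_replicate]
      omega
    change pad M e f ∈ Wnl M e p[j] (j + 1) ∧ b.count M + 2 * f.length ≤ d
    refine ⟨⟨pad_mem_Lst (M := M) (e := e) (p := f) (by omega) hM (hb.1.filter _) fun y hy =>
      ⟨hb.2.1 y (List.mem_of_mem_filter hy), by
        have := List.of_mem_filter hy; simp at this; omega⟩,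
      mem_pad (by omega), ?_⟩, by omega⟩
    rcases lt_or_ge j f.length with hjf | hjf
    · refine ⟨b[j], ?_, hcon⟩
      rw [pad, List.take_append_of_le_length (by omega)]
      have : b[j] = f[j] := by
        conv_lhs => rw [List.getElem_of_eq hs]
        rw [List.getElem_append_left hjf]
      rw [this]
      exact List.mem_take_iff_getElem.2 ⟨j, by omega, rfl⟩
    · refine ⟨M, ?_, hNM⟩
      rw [pad, List.take_append, List.mem_append]
      right
      rw [List.take_replicate, List.mem_replicate]
      exact ⟨by omega, rfl⟩
  have hDfin : (Dom p).Finite := Set.Finite.of_finite_image hβfin hβinj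
  have hle := finrank_le_ncard_lead (hind p.length) V hVx
  rw [hrank] at hle
  have heq := Set.eq_of_subset_of_ncard_le hsub hle hDfin
  have hpD : p ∈ Dom p := ⟨hp.1, hp.2.1, List.forall₂_refl p⟩
  rw [← heq] at hpD
  refine Lead.mono (hVJ W hW fun q hq hqW => hpW ?_) hpD.2
  have hlen : q.length = p.length := hq.2.2.length_eq
  refine hW.up _ hqW _ (pad_mem_Lst hpe.le hM hp.1 fun y hy => ⟨hp.2.1 y hy, (hpM y hy).le⟩) ?_
  rw [pad, pad, hlen]
  exact List.rel_append hq.2.2 (List.forall₂_refl _)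

theorem lead_iff {n d e c M : ℕ} {W : Set (List ℕ)} (hx : SignComm K x τ)
    (hv : SignComm K v τ) (hspan : spanIcc K v 1 n = spanIcc K x 1 n)
    (hind : ∀ r, LinearIndepOn K (mp x τ) (Vn τ n r)) (hc : c ≤ 1) (hn : n = M + d)
    (hd : d + 2 = 2 * e + c) (hM : 1 ≤ M) (hW : Good 1 M e W) (hgen : AllCond K x τ n d e M v W)
    {r : ℕ} {b : List ℕ} (hb : b ∈ Vn τ n r) :
    Lead (Jd K v n (bd d (fac n 0 '' W)) r) x τ n b ↔ ¬ StdB M e d W b := by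
  have hτ : τ = 0 ∨ τ = 1 := by rcases hx.sq with h | h <;> omega
  exact lead_iff_of_nonstd hv hτ hind hc hn hd hM hW (fun r b hb hnb =>
    lead_of_not_stdB hx hspan hc hn hd hM hW hgen.1 (fun p hp hpe hpM hpW =>
      lead_of_pad_notMem hx hv hspan hind hc hn hd hM hW hgen hp hpe hpM hpW) hb hnb) hb

end Alg
end Squeezed

namespace Squeezed
open Submodule

section Alg

variable {K A : Type*} [Field K] [Ring A] [Algebra K A] {x v : ℕ → A} {τ : ℕ}

theorem prodIdeal_congr {N : Set (List ℕ)} {v w : ℕ → A} (L : Submodule K A) (r : ℕ)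
    (h : ∀ l ∈ N, ∀ j ∈ l, v j = w j) : prodIdeal N v L r = prodIdeal N w L r := by
  unfold prodIdeal
  exact iSup_congr fun l => by rw [map_prod_congr (h l.1 l.2.1)]

/-- The linear forms whose coefficients are the columns of the matrix `y`. -/
def colForm (x : ℕ → A) (N : ℕ) (y : Fin N × Fin N → K) (j : ℕ) : A :=
  if h : 1 ≤ j ∧ j ≤ N then ∑ a : Fin N, y (a, ⟨j - 1, by omega⟩) • x (a + 1) else 0

theorem colForm_mem {N : ℕ} (y : Fin N × Fin N → K) (j : ℕ) :
    colForm x N y j ∈ spanIcc K x 1 N := by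
  unfold colForm
  split_ifs
  · exact sum_mem fun a _ => smul_mem _ _ (mem_spanOn ⟨by omega, by omega⟩)
  · exact zero_mem _

theorem colForm_polyMaps {N : ℕ} (j : ℕ) :
    (fun y : Fin N × Fin N → K => colForm x N y j) ∈ polyMaps K (Fin N × Fin N) A := by
  unfold colForm
  split_ifs with h
  · have := sum_mem (S := polyMaps K (Fin N × Fin N) A) (t := Finset.univ)
      (f := fun (a : Fin N) (y : Fin N × Fin N → K) =>
        y (a, (⟨j - 1, by omega⟩ : Fin N)) • x (a + 1)) fun a _ => by
        simpa using coord_mem_polyMaps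
          (MvPolynomial.X (R := K) (a, (⟨j - 1, by omega⟩ : Fin N))) (x (a + 1))
    convert this using 1
    ext y
    simp
  · exact const_mem_polyMaps 0

theorem exists_colForm_eq {N : ℕ} {w : ℕ → A} (hw : ∀ j, w j ∈ spanIcc K x 1 N) :
    ∃ y : Fin N × Fin N → K, ∀ j, 1 ≤ j → j ≤ N → colForm x N y j = w j := by
  have hrange : spanIcc K x 1 N = span K (Set.range fun a : Fin N => x (a + 1)) := by
    unfold spanIcc spanOn
    congr 1
    ext z
    constructor
    · rintro ⟨j, hj, rfl⟩
      rw [Set.mem_Icc] at hj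
      exact ⟨⟨j - 1, by omega⟩, by simp [Nat.sub_add_cancel hj.1]⟩
    · rintro ⟨a, rfl⟩
      exact ⟨a + 1, ⟨by omega, by omega⟩, rfl⟩
  have h : ∀ j, ∃ c : Fin N → K, ∑ a, c a • x (a + 1) = w j := fun j =>
    (mem_span_range_iff_exists_fun K).1 (hrange ▸ hw j)
  choose c hc using h
  refine ⟨fun q => c (q.2 + 1) q.1, fun j h1 h2 => ?_⟩
  rw [colForm, dif_pos ⟨h1, h2⟩, ← hc]
  simp [Nat.sub_add_cancel h1]

theorem spanIcc_colForm {N : ℕ} {Q : Matrix (Fin N) (Fin N) K} (hQ : IsUnit Q.det) :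
    spanIcc K (colForm x N fun q => Q q.1 q.2) 1 N = spanIcc K x 1 N := by
  apply le_antisymm
  · unfold spanIcc
    rw [spanOn, span_le]
    rintro _ ⟨j, -, rfl⟩
    exact colForm_mem _ j
  · unfold spanIcc
    rw [spanOn, span_le]
    rintro _ ⟨j, hj, rfl⟩
    rw [Set.mem_Icc] at hj
    have hmul := Matrix.mul_nonsing_inv Q hQ
    have : x j = ∑ b : Fin N, Q⁻¹ b ⟨j - 1, by omega⟩ • colForm x N (fun q => Q q.1 q.2) (b + 1) := by
      have h1 : ∀ b : Fin N, colForm x N (fun q => Q q.1 q.2) (b + 1)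
          = ∑ a : Fin N, Q a b • x (a + 1) := fun b => by
        rw [colForm, dif_pos ⟨by omega, by omega⟩]; simp
      simp_rw [h1, Finset.smul_sum, smul_smul]
      rw [Finset.sum_comm]
      simp_rw [← Finset.sum_smul]
      have h2 : ∀ a : Fin N, ∑ b, Q⁻¹ b ⟨j - 1, by omega⟩ * Q a b
          = (1 : Matrix (Fin N) (Fin N) K) a ⟨j - 1, by omega⟩ := fun a => by
        rw [← hmul, Matrix.mul_apply]
        exact Finset.sum_congr rfl fun b _ => mul_comm _ _
      simp_rw [h2, Matrix.one_apply, ite_smul, one_smul, zero_smul]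
      simp [Nat.sub_add_cancel hj.1]
    rw [this]
    exact sum_mem fun b _ => smul_mem _ _ (mem_spanOn ⟨by omega, by omega⟩)

theorem gen_spanCond [Infinite K] (hx : SignComm K x τ) {n n' M e c β r Z : ℕ}
    {W : Set (List ℕ)} (hW : Good 1 M e W) (hM : 1 ≤ M) (hn' : n' + 2 = M + 2 * e + c)
    (hr : 2 * r + 2 = β + 2 * e + c) (hZ : Z + τ = M + τ * r) (hn : n' ≤ n) (hZn : Z ≤ n)
    (hr1 : 1 ≤ r) :
    Gen fun y : Fin n × Fin n → K => SpanCond K x τ n (colForm x n y) (NF n' 1 0 M e W) r Z β := by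
  have hτ : τ ≤ 1 := by rcases hx.sq with h | h <;> omega
  obtain ⟨w, hw, hwle⟩ := exists_forms hx n' M c β _ e 1 0 r 1 Z W rfl hW hM (by omega) hr (by omega)
  have hZle : spanIcc K x 1 Z ≤ spanIcc K x 1 n := spanOn_mono (Set.Icc_subset_Icc le_rfl hZn)
  obtain ⟨y₀, hy₀⟩ := exists_colForm_eq fun j => hZle (hw j)
  obtain ⟨r, rfl⟩ : ∃ r', r = r' + 1 := ⟨r - 1, by omega⟩
  have hMZ : M ≤ Z := by rw [mul_add] at hZ; omega
  have := spanOn_fg (K := K) (x := x) (Set.finite_Icc 1 n) (r + 1)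
  refine PolyFam.gen_le (V := fun y => prodIdeal (NF n' 1 0 M e W) (colForm x n y)
    (spanIcc K x 1 n) (r + 1) ⊔ (spanIcc K x 1 n ^ (r + 1 - 1) * spanIcc K x (Z + 1) n ⊔
      restTerm (spanIcc K x 1 n) (topProd x τ Z β) (r + 1) β))
    ((polyFam_prodIdeal _ colForm_polyMaps _ _).sup (PolyFam.const _)) _ ?_ y₀ ?_
  · intro y
    refine sup_le (prodIdeal_le (colForm_mem y)) (sup_le ?_ ?_)
    · rw [Nat.add_sub_cancel, pow_succ]
      exact mul_le_mul_right (spanOn_mono (Set.Icc_subset_Icc (by omega) le_rfl)) _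
    · unfold restTerm
      split_ifs with hb
      · calc _ ≤ spanIcc K x 1 n ^ (r + 1 - β) * spanIcc K x 1 n ^ β :=
            mul_le_mul_right ((span_singleton_le_iff_mem _ _).2 (pow_le_pow_left' hZle _
              (topProd_mem hτ (r := r + 1) (by omega) (by omega) hb))) _
          _ = _ := by rw [← pow_add, Nat.sub_add_cancel hb]
      · exact bot_le
  · refine (hx.pow_le_split n Z r hZn).trans (sup_le (hwle.trans ?_) ?_)
    · rw [prodIdeal_congr (w := colForm x n y₀) _ _ fun l hl j hj =>
        (hy₀ j (hl.2.1 j hj).1 ((hl.2.1 j hj).2.trans hn)).symm]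
      exact sup_le_sup (prodIdeal_mono_right hZle) (le_sup_of_le_right (restTerm_mono hZle _ _ _))
    · exact le_sup_of_le_right le_sup_left

theorem gen_genCond [Infinite K] (hx : SignComm K x τ) {n d e c M : ℕ}
    {W : Set (List ℕ)} (hn : n = M + d) (hd : d + 2 = 2 * e + c) (hM : 1 ≤ M)
    (hW : Good 1 M e W) :
    Gen fun y : Fin n × Fin n → K => GenCond K x τ n d e M (colForm x n y) W := by
  have hτ : τ ≤ 1 := by rcases hx.sq with h | h <;> omega
  refine (Gen.forall_mem (Finset.Ioc (d / 2) (d + 1))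
    (P := fun r y => SpanCond K x τ n (colForm x n y) (NF n 1 0 M e W) r
      (M + τ * (r - 1)) (2 * r - d)) fun r hr => ?_).mono fun y h r h1 h2 =>
      h r (Finset.mem_Ioc.2 (by omega))
  rw [Finset.mem_Ioc] at hr
  have hZ : M + τ * (r - 1) ≤ M + (r - 1) := by
    rcases Nat.le_one_iff_eq_zero_or_eq_one.1 hτ with rfl | rfl <;> omega
  obtain ⟨r, rfl⟩ : ∃ r', r = r' + 1 := ⟨r - 1, by omega⟩
  exact gen_spanCond hx (c := c) hW hM (by omega) (by omega)
    (by rw [Nat.add_sub_cancel, mul_add]; omega) le_rfl (by omega) (by omega)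

theorem gen_allCond [Infinite K] (hx : SignComm K x τ) {n d e c M : ℕ}
    {W : Set (List ℕ)} (hn : n = M + d) (hd : d + 2 = 2 * e + c) (hM : 1 ≤ M)
    (hW : Good 1 M e W) :
    Gen fun y : Fin n × Fin n → K => AllCond K x τ n d e M (colForm x n y) W := by
  have hτ : τ ≤ 1 := by rcases hx.sq with h | h <;> omega
  refine (gen_genCond hx hn hd hM hW).and (Gen.forall_mem _ fun N hN => Gen.forall_mem _
    fun l hl => ?_)
  rw [Finset.mem_range] at hN hl
  by_cases h1 : 1 ≤ l
  · refine ((gen_genCond hx hn hd hM (good_Wnl M e N l)).and (gen_spanCond hx (c := 1)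
      (good_Wall _ _) (by omega) (by omega) (by omega) ?_ (by omega) ?_ h1)).mono fun y h _ => h
    · obtain ⟨l, rfl⟩ : ∃ l', l = l' + 1 := ⟨l - 1, by omega⟩
      rw [Nat.add_sub_cancel, mul_add]; omega
    · rcases Nat.le_one_iff_eq_zero_or_eq_one.1 hτ with rfl | rfl <;> omega
  · exact Gen.of_forall fun y h => absurd h h1

end Alg
end Squeezed

namespace Squeezed

/-- A pure shifted simplicial complex on `[1, n]` whose facets have `d` elements. -/
structure PureShifted (n d : ℕ) (S : Set (Finset ℕ)) : Prop where
  sub : ∀ F ∈ S, F ⊆ Finset.Icc 1 n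
  down : ∀ F ∈ S, ∀ G ⊆ F, G ∈ S
  card_le : ∀ F ∈ S, F.card ≤ d
  ext : ∀ F ∈ S, ∃ G ∈ S, F ⊆ G ∧ G.card = d
  shift : ∀ F ∈ S, ∀ i ∈ F, ∀ j, i < j → j ≤ n → insert j (F.erase i) ∈ S

theorem pureShifted_of {n d : ℕ} {S : Set (Finset ℕ)} (hn : 1 ≤ n)
    (hS : SimplicialComplexOn (Finset.Icc 1 n) S) (hpure : PureComplex S)
    (hshift : ShiftedComplex (Finset.Icc 1 n) S) (hdim : sdim S = (d : ℤ) - 1) :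
    PureShifted n d S := by
  obtain ⟨hsub, hsing, hdown⟩ := hS
  have hfin : S.Finite := ((Finset.Icc 1 n).powerset.finite_toSet).subset fun F hF =>
    Finset.mem_coe.2 (Finset.mem_powerset.2 (hsub F hF))
  have hne : S.Nonempty := ⟨{1}, hsing 1 (by simp [hn])⟩
  have himg := hfin.image fun F : Finset ℕ => (F.card : ℤ) - 1
  obtain ⟨F₀, hF₀, hF₀d⟩ : (d : ℤ) - 1 ∈ (fun F : Finset ℕ => (F.card : ℤ) - 1) '' S := by
    rw [← hdim]
    exact (hne.image _).csSup_mem himg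
  have hle : ∀ F ∈ S, F.card ≤ d := fun F hF => by
    have : ((F.card : ℤ) - 1) ≤ sdim S := le_csSup himg.bddAbove ⟨F, hF, rfl⟩
    omega
  have hF₀' : F₀.card = d := by simp at hF₀d; omega
  have hfac₀ : IsFacet S F₀ :=
    ⟨hF₀, fun G hG h => Finset.eq_of_subset_of_card_le h (by rw [hF₀']; exact hle G hG)⟩
  refine ⟨hsub, hdown, hle, fun F hF => ?_, fun F hF i hi j hij hj => ?_⟩
  · obtain ⟨G, hFG, hG⟩ := hfin.exists_le_maximal hF
    exact ⟨G, hG.prop, hFG, (hpure G F₀ ⟨hG.prop, fun H hH h => hG.eq_of_le hH h⟩ hfac₀).trans hF₀'⟩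
  · exact hshift F hF i hi j hij (Finset.mem_Icc.2 ⟨by omega, hj⟩)

namespace PureShifted

variable {n d : ℕ} {S : Set (Finset ℕ)}

theorem replace (hS : PureShifted n d S) {P : Finset ℕ} {t : ℕ} (ht : 1 ≤ t) :
    ∀ (k : ℕ) (G : Finset ℕ), G ∈ S → P ⊆ G → Disjoint P (Finset.Icc t n) →
      (G \ P).card = (Finset.Icc t n).card → (Finset.Icc t n \ G).card = k →
      P ∪ Finset.Icc t n ∈ S := by
  intro k
  induction k with
  | zero =>
    intro G hG hP hdisj hcard hk
    rw [Finset.card_eq_zero, Finset.sdiff_eq_empty_iff_subset] at hk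
    exact hS.down G hG _ (Finset.union_subset hP hk)
  | succ k ih =>
    intro G hG hP hdisj hcard hk
    obtain ⟨j, hj⟩ : (Finset.Icc t n \ G).Nonempty := Finset.card_pos.1 (by omega)
    rw [Finset.mem_sdiff, Finset.mem_Icc] at hj
    obtain ⟨i, hi, hit⟩ : ∃ i ∈ G \ P, i ∉ Finset.Icc t n := by
      by_contra! hcon
      have := Finset.eq_of_subset_of_card_le hcon hcard.ge
      exact hj.2 (Finset.mem_sdiff.1 (this ▸ Finset.mem_Icc.2 hj.1 : j ∈ G \ P)).1
    rw [Finset.mem_sdiff] at hi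
    have hin := Finset.mem_Icc.1 (hS.sub G hG hi.1)
    rw [Finset.mem_Icc] at hit
    have hij : i < j := by omega
    have hjP : j ∉ P := fun h => hj.2 (hP h)
    refine ih (insert j (G.erase i)) (hS.shift G hG i hi.1 j hij hj.1.2) ?_ hdisj ?_ ?_
    · exact fun x hx => Finset.mem_insert_of_mem (Finset.mem_erase.2
        ⟨fun h => hi.2 (h ▸ hx), hP hx⟩)
    · rw [← hcard, Finset.insert_sdiff_of_notMem _ hjP, Finset.card_insert_of_notMem
        (by simp [hj.2]), Finset.erase_sdiff_comm, Finset.card_erase_add_one]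
      simpa using hi
    · have h1 : Finset.Icc t n \ insert j (G.erase i) = (Finset.Icc t n \ G).erase j := by
        ext x
        simp only [Finset.mem_sdiff, Finset.mem_insert, Finset.mem_erase, not_or, not_and]
        refine ⟨fun ⟨h1, h2, h3⟩ => ⟨h2, h1, fun h => h3 (fun hxi => hit ?_) h⟩,
          fun ⟨h1, h2, h3⟩ => ⟨h2, h1, fun _ => h3⟩⟩
        rw [Finset.mem_Icc] at h1
        rwa [← hxi]
      rw [h1, Finset.card_erase_of_mem (by simpa using hj), hk, Nat.add_sub_cancel]

/-- Faces can be completed by terminal intervals. -/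
theorem fill {M : ℕ} (hS : PureShifted n d S) (hn : n = M + d) {P : Finset ℕ} (hP : P ∈ S)
    (hPM : ∀ x ∈ P, x ≤ M + P.card) : P ∪ Finset.Icc (M + P.card + 1) n ∈ S := by
  obtain ⟨G, hG, hPG, hGd⟩ := hS.ext P hP
  refine hS.replace (by omega) _ G hG hPG ?_ ?_ rfl
  · rw [Finset.disjoint_left]
    intro x hx hx'
    have := hPM x hx
    rw [Finset.mem_Icc] at hx'
    omega
  · rw [Finset.card_sdiff_of_subset hPG, hGd, Nat.card_Icc]
    omega

/-- The faces with `i` elements which are contained in `[1, M + i - 1]`. -/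
def low (M : ℕ) (S : Set (Finset ℕ)) (i : ℕ) : Set (Finset ℕ) :=
  {P | P ∈ S ∧ P.card = i ∧ ∀ x ∈ P, x < M + i}

theorem low_finite (hS : PureShifted n d S) (M i : ℕ) : (low M S i).Finite :=
  ((Finset.Icc 1 n).powerset.finite_toSet).subset fun F hF =>
    Finset.mem_coe.2 (Finset.mem_powerset.2 (hS.sub F hF.1))

theorem exists_low (M : ℕ) (F : Finset ℕ) :
    ∃ i ≤ F.card, (F.filter (· < M + i)).card = i ∧ M + i ∉ F := by
  classical
  have hex : ∃ i, (F.filter (· ≤ M + i)).card ≤ i := ⟨F.card, Finset.card_filter_le _ _⟩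
  have hi := Nat.find_spec hex
  have hmin : ∀ j < Nat.find hex, j < (F.filter (· ≤ M + j)).card := fun j hj =>
    not_le.1 (Nat.find_min hex hj)
  have hle : Nat.find hex ≤ F.card := Nat.find_min' hex (Finset.card_filter_le _ _)
  generalize Nat.find hex = i at *
  have hmono : (F.filter (· < M + i)).card ≤ (F.filter (· ≤ M + i)).card :=
    Finset.card_le_card (Finset.monotone_filter_right F fun x _ h => h.le)
  have hge : i ≤ (F.filter (· < M + i)).card := by
    rcases i with _ | i
    · exact Nat.zero_le _
    · refine (Nat.succ_le_of_lt (hmin i (Nat.lt_succ_self i))).trans (Finset.card_le_card ?_)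
      exact Finset.monotone_filter_right F fun x _ h => by omega
  refine ⟨i, hle, by omega, fun hF => ?_⟩
  have : (F.filter (· < M + i)).card < (F.filter (· ≤ M + i)).card := by
    refine Finset.card_lt_card (Finset.ssubset_iff_subset_ne.2
      ⟨Finset.monotone_filter_right F fun x _ h => h.le, fun h => ?_⟩)
    have : M + i ∈ F.filter (· ≤ M + i) := by simp [hF]
    rw [← h] at this
    simp at this
  omega

theorem low_unique {M i j : ℕ} {F : Finset ℕ} (hi : (F.filter (· < M + i)).card = i)
    (hiF : M + i ∉ F) (hj : (F.filter (· < M + j)).card = j) (hij : i < j) : False := by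
  have h : F.filter (· < M + j) ⊆ F.filter (· < M + i) ∪ Finset.Ioo (M + i) (M + j) := by
    intro x hx
    rw [Finset.mem_filter] at hx
    rw [Finset.mem_union, Finset.mem_filter, Finset.mem_Ioo]
    rcases lt_trichotomy x (M + i) with h | h | h
    · exact Or.inl ⟨hx.1, h⟩
    · exact absurd (h ▸ hx.1) hiF
    · exact Or.inr ⟨h, hx.2⟩
  have := (Finset.card_le_card h).trans (Finset.card_union_le _ _)
  rw [Nat.card_Ioo] at this
  omega

theorem fvec_eq {M : ℕ} (hS : PureShifted n d S) (hn : n = M + d) {j : ℕ} (hj : j ≤ d) :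
    fvec S j = ∑ i ∈ Finset.range (j + 1), (low M S i).ncard * (d - i).choose (j - i) := by
  classical
  have hunion : {F ∈ S | F.card = j} = ⋃ i ∈ (Finset.range (j + 1) : Finset ℕ),
      ((fun q : Finset ℕ × Finset ℕ => q.1 ∪ q.2) ''
        (low M S i ×ˢ ((Finset.Icc (M + i + 1) n).powersetCard (j - i) : Set (Finset ℕ)))) := by
    ext F
    simp only [Set.mem_iUnion, Set.mem_image, Set.mem_prod, Finset.mem_coe,
      Finset.mem_powersetCard, Set.mem_ofPred_eq, Prod.exists, exists_prop, Finset.mem_range]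
    constructor
    · rintro ⟨hF, rfl⟩
      obtain ⟨i, hi, hi1, hi2⟩ := exists_low M F
      refine ⟨i, by omega, F.filter (· < M + i), F.filter (fun x => ¬ x < M + i),
        ⟨⟨hS.down F hF _ (Finset.filter_subset _ _), hi1, fun x hx => (Finset.mem_filter.1 hx).2⟩,
          fun x hx => ?_, ?_⟩, Finset.filter_union_filter_not_eq _ F⟩
      · rw [Finset.mem_filter] at hx
        have := Finset.mem_Icc.1 (hS.sub F hF hx.1)
        have : x ≠ M + i := fun h => hi2 (h ▸ hx.1)
        exact Finset.mem_Icc.2 (by omega)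
      · have := Finset.card_filter_add_card_filter_not (s := F) (· < M + i)
        omega
    · rintro ⟨i, hi, P, R, ⟨⟨hP, hPi, hPM⟩, hR, hRj⟩, rfl⟩
      refine ⟨hS.down _ (hS.fill hn hP fun x hx => by have := hPM x hx; omega) _
        (Finset.union_subset_union_right (hPi ▸ hR)), ?_⟩
      rw [Finset.card_union_of_disjoint, hPi, hRj]
      · omega
      · rw [Finset.disjoint_left]
        intro x hx hx'
        have h1 := hPM x hx
        have h2 := Finset.mem_Icc.1 (hR hx')
        omega
  have hfilt : ∀ i, ∀ q ∈ low M S i ×ˢ ((Finset.Icc (M + i + 1) n).powersetCard (j - i) :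
      Set (Finset ℕ)), (q.1 ∪ q.2).filter (· < M + i) = q.1 ∧ M + i ∉ q.1 ∪ q.2 := by
    rintro i ⟨P, R⟩ ⟨⟨hP, hPi, hPM⟩, hR⟩
    have hR' := (Finset.mem_powersetCard.1 (Finset.mem_coe.1 hR)).1
    refine ⟨?_, ?_⟩
    · rw [Finset.filter_union, Finset.filter_true_of_mem hPM, Finset.filter_false_of_mem,
        Finset.union_empty]
      intro x hx
      have := Finset.mem_Icc.1 (hR' hx)
      omega
    · rw [Finset.mem_union]
      rintro (h | h)
      · have := hPM _ h; omega
      · have := Finset.mem_Icc.1 (hR' h); omega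
  have hinj : ∀ i, Set.InjOn (fun q : Finset ℕ × Finset ℕ => q.1 ∪ q.2)
      (low M S i ×ˢ ((Finset.Icc (M + i + 1) n).powersetCard (j - i) : Set (Finset ℕ))) := by
    intro i q hq q' hq' h
    have h1 := (hfilt i q hq).1
    have h2 := (hfilt i q' hq').1
    simp only at h
    have h3 : q.1 = q'.1 := by rw [← h1, h, h2]
    have hR : ∀ q ∈ low M S i ×ˢ ((Finset.Icc (M + i + 1) n).powersetCard (j - i) :
        Set (Finset ℕ)), (q.1 ∪ q.2) \ q.1 = q.2 := by
      rintro ⟨P, R⟩ ⟨⟨hP, hPi, hPM⟩, hR⟩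
      have hR' := (Finset.mem_powersetCard.1 (Finset.mem_coe.1 hR)).1
      refine Finset.union_sdiff_cancel_left (Finset.disjoint_left.2 fun x hx hx' => ?_)
      have h1 := hPM x hx
      have h2 := Finset.mem_Icc.1 (hR' hx')
      omega
    exact Prod.ext h3 (by rw [← hR q hq, ← hR q' hq', h, h3])
  have hunion' := hunion.trans (Set.biUnion_eq_iUnion (↑(Finset.range (j + 1)) : Set ℕ)
    (fun i _ => (fun q : Finset ℕ × Finset ℕ => q.1 ∪ q.2) ''
        (low M S i ×ˢ ((Finset.Icc (M + i + 1) n).powersetCard (j - i) : Set (Finset ℕ)))))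
  rw [fvec, hunion', Set.ncard_iUnion_of_finite, finsum_eq_sum_of_fintype]
  · rw [← Finset.sum_coe_sort (Finset.range (j + 1))]
    refine Finset.sum_congr rfl fun i _ => ?_
    rw [(hinj _).ncard_image, Set.ncard_prod, Set.ncard_coe_finset, Finset.card_powersetCard,
      Nat.card_Icc]
    congr 2
    omega
  · exact fun i => (((hS.low_finite M i).prod (Finset.finite_toSet _)).image _)
  · rintro ⟨i, hi⟩ ⟨i', hi'⟩ hne
    rw [Function.onFun, Set.disjoint_left]
    rintro _ ⟨q, hq, rfl⟩ ⟨q', hq', h⟩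
    have h1 := hfilt i q hq
    have h2 := hfilt i' q' hq'
    simp only at h
    rw [h] at h2
    have hc1 : ((q.1 ∪ q.2).filter (· < M + i)).card = i := by rw [h1.1]; exact hq.1.2.1
    have hc2 : ((q.1 ∪ q.2).filter (· < M + i')).card = i' := by rw [h2.1]; exact hq'.1.2.1
    rcases lt_or_gt_of_ne (fun h => hne (Subtype.ext h) : i ≠ i') with h | h
    · exact low_unique hc1 h1.2 hc2 h
    · exact low_unique hc2 h2.2 hc1 h

theorem choose_inversion {d i k : ℕ} (hk : k ≤ i) (hi : i ≤ d) :
    ∑ j ∈ Finset.Ico k (i + 1), (-1 : ℤ) ^ (i - j) * ((d - j).choose (d - i) : ℤ) *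
      ((d - k).choose (j - k) : ℤ) = if k = i then 1 else 0 := by
  have hterm : ∀ j ∈ Finset.Ico k (i + 1), (-1 : ℤ) ^ (i - j) * ((d - j).choose (d - i) : ℤ) *
      ((d - k).choose (j - k) : ℤ) = ((d - k).choose (i - k) : ℤ) * (-1 : ℤ) ^ (i - k) *
        ((-1 : ℤ) ^ (j - k) * ((i - k).choose (j - k) : ℤ)) := by
    intro j hj
    rw [Finset.mem_Ico] at hj
    have h1 := Nat.choose_mul (n := d - k) (k := i - k) (s := j - k) (by omega)
    rw [show d - k - (j - k) = d - j by omega, show i - k - (j - k) = i - j by omega,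
      show (d - j).choose (i - j) = (d - j).choose (d - i) by
        rw [← Nat.choose_symm (by omega)]; congr 1; omega] at h1
    have h2 : (-1 : ℤ) ^ (i - j) = (-1) ^ (i - k) * (-1) ^ (j - k) := by
      rw [show i - k = (i - j) + (j - k) by omega, pow_add, mul_assoc, ← mul_pow]
      simp
    have h1' : ((d - k).choose (i - k) : ℤ) * ((i - k).choose (j - k) : ℤ) =
        ((d - k).choose (j - k) : ℤ) * ((d - j).choose (d - i) : ℤ) := by exact_mod_cast h1
    rw [h2]
    linear_combination -(-1 : ℤ) ^ (i - k) * (-1) ^ (j - k) * h1'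
  rw [Finset.sum_congr rfl hterm, ← Finset.mul_sum, Finset.sum_Ico_eq_sum_range,
    show i + 1 - k = i - k + 1 by omega]
  simp only [Nat.add_sub_cancel_left]
  rw [Int.alternating_sum_range_choose]
  split_ifs with h1 h2 h2
  · subst h2; simp
  · omega
  · omega
  · simp

theorem hvec_eq {M : ℕ} (hS : PureShifted n d S) (hn : n = M + d) {i : ℕ} (hi : i ≤ d) :
    hvec d S i = (low M S i).ncard := by
  rw [hvec]
  have h1 : ∀ j ∈ Finset.range (i + 1), (-1 : ℤ) ^ (i - j) * ((d - j).choose (d - i) : ℤ) *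
      (fvec S j : ℤ) = ∑ k ∈ Finset.range (j + 1), ((low M S k).ncard : ℤ) *
        ((-1 : ℤ) ^ (i - j) * ((d - j).choose (d - i) : ℤ) * ((d - k).choose (j - k) : ℤ)) := by
    intro j hj
    rw [Finset.mem_range] at hj
    rw [hS.fvec_eq hn (by omega)]
    push_cast
    rw [Finset.mul_sum]
    exact Finset.sum_congr rfl fun k _ => by ring
  rw [Finset.sum_congr rfl h1, Finset.sum_comm' (t' := Finset.range (i + 1))
    (s' := fun k => Finset.Ico k (i + 1)) (by
      intro x y; simp only [Finset.mem_range, Finset.mem_Ico]; omega)]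
  simp_rw [← Finset.mul_sum]
  rw [Finset.sum_congr rfl fun k hk => by
    rw [choose_inversion (by rw [Finset.mem_range] at hk; omega) hi]]
  simp

theorem Icc_subset_of_mem_low {M k : ℕ} (hS : PureShifted n d S) (hn : n = M + d) (hd : 0 < d)
    (hM : 1 ≤ M) (hsub : S ⊆ DeltaC n d) (hk : k ≤ d) {P : Finset ℕ} (hP : P ∈ low M S (d - k)) :
    Finset.Icc (M + k) (n - k - 1) ⊆ P := by
  obtain ⟨hPS, hPc, hPM⟩ := hP
  have hfill := hS.fill hn hPS fun x hx => by have := hPM x hx; omega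
  have hmem := hsub hfill
  rw [DeltaC, if_neg hd.ne'] at hmem
  obtain ⟨X, hX, hPX⟩ := hmem
  have hcard : (P ∪ Finset.Icc (M + P.card + 1) n).card = d := by
    rw [Finset.card_union_of_disjoint, Nat.card_Icc]
    · omega
    · rw [Finset.disjoint_left]
      intro x hx hx'
      have h1 := hPM x hx
      have h2 := Finset.mem_Icc.1 hx'
      omega
  have hXeq := Finset.eq_of_subset_of_card_le hPX (by rw [hcard, hX.2.1])
  have hnk : n - k ∉ X := by
    rw [← hXeq, Finset.mem_union, Finset.mem_Icc]
    rintro (h | h)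
    · have := hPM _ h; omega
    · omega
  have := hX.2.2 k (by omega) hnk
  rw [show n - d + k = M + k by omega, ← hXeq] at this
  intro x hx
  rcases Finset.mem_union.1 (this hx) with h | h
  · exact h
  · rw [Finset.mem_Icc] at h hx; omega

theorem card_filter_of_mem_low {M k : ℕ} (hS : PureShifted n d S) (hn : n = M + d) (hd : 0 < d)
    (hM : 1 ≤ M) (hsub : S ⊆ DeltaC n d) (hk : 2 * k ≤ d) {P : Finset ℕ}
    (hP : P ∈ low M S (d - k)) :
    (P.filter (· < M + k)).card = k ∧ P = P.filter (· < M + k) ∪ Finset.Icc (M + k) (n - k - 1) := by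
  have hIcc := hS.Icc_subset_of_mem_low hn hd hM hsub (by omega) hP
  have hP2 : P = P.filter (· < M + k) ∪ Finset.Icc (M + k) (n - k - 1) := by
    apply subset_antisymm
    · intro x hx
      have := hP.2.2 x hx
      rw [Finset.mem_union, Finset.mem_filter, Finset.mem_Icc]
      by_cases h : x < M + k
      · exact Or.inl ⟨hx, h⟩
      · right; omega
    · exact Finset.union_subset (Finset.filter_subset _ _) hIcc
  refine ⟨?_, hP2⟩
  have hc := hP.2.1
  rw [hP2, Finset.card_union_of_disjoint, Nat.card_Icc] at hc
  · omega
  · rw [Finset.disjoint_left]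
    intro x hx hx'
    rw [Finset.mem_filter] at hx
    rw [Finset.mem_Icc] at hx'
    omega

theorem union_Icc_mem {M k : ℕ} (hS : PureShifted n d S) (hn : n = M + d) (hd : 0 < d)
    (hM : 1 ≤ M) (hsub : S ⊆ DeltaC n d) (hsym : ∀ i ≤ d, hvec d S i = hvec d S (d - i))
    (hk : 2 * k ≤ d) {Q : Finset ℕ} (hQ : Q ∈ low M S k) :
    Q ∪ Finset.Icc (M + k) (n - k - 1) ∈ S := by
  have hcard : (low M S k).ncard = (low M S (d - k)).ncard := by
    have := hsym k (by omega)
    rw [hS.hvec_eq hn (by omega), hS.hvec_eq hn (by omega)] at this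
    exact_mod_cast this
  have himg : (fun P : Finset ℕ => P.filter (· < M + k)) '' low M S (d - k) ⊆ low M S k := by
    rintro _ ⟨P, hP, rfl⟩
    exact ⟨hS.down P hP.1 _ (Finset.filter_subset _ _),
      (hS.card_filter_of_mem_low hn hd hM hsub hk hP).1, fun x hx => (Finset.mem_filter.1 hx).2⟩
  have hinj : Set.InjOn (fun P : Finset ℕ => P.filter (· < M + k)) (low M S (d - k)) := by
    intro P hP P' hP' h
    simp only at h
    rw [(hS.card_filter_of_mem_low hn hd hM hsub hk hP).2, h,
      ← (hS.card_filter_of_mem_low hn hd hM hsub hk hP').2]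
  have heq := Set.eq_of_subset_of_ncard_le himg (by rw [hinj.ncard_image, hcard])
    (hS.low_finite M k)
  rw [← heq] at hQ
  obtain ⟨P, hP, rfl⟩ := hQ
  change P.filter (· < M + k) ∪ _ ∈ S
  rw [← (hS.card_filter_of_mem_low hn hd hM hsub hk hP).2]
  exact hP.1

end PureShifted
end Squeezed

namespace Squeezed

/-- The support of the stretching of `b`. -/
def supp (b : List ℕ) : Finset ℕ := (tl 1 0 b).toFinset

theorem supp_append_subset (b s : List ℕ) : supp b ⊆ supp (b ++ s) := by
  intro y hy
  rw [supp, List.mem_toFinset] at *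
  rw [tl_append]
  exact List.mem_append_left _ hy

theorem card_supp {b : List ℕ} (hb : b.Pairwise (· ≤ ·)) : (supp b).card = b.length := by
  rw [supp, List.toFinset_card_of_nodup, tl_length]
  exact (tl_pairwise (τ := 1) hb).imp fun h => by omega

theorem mem_supp_lt {M : ℕ} {b : List ℕ} (hb : ∀ y ∈ b, y < M) {y : ℕ} (hy : y ∈ supp b) :
    y + 2 ≤ M + b.length := by
  have := tl_le_of_mem hb (List.mem_toFinset.1 hy)
  omega

theorem forall₂_tl {q : ℕ} {s t : List ℕ} (h : List.Forall₂ (· ≤ ·) s t) :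
    List.Forall₂ (· ≤ ·) (tl 1 q s) (tl 1 q t) := by
  induction h generalizing q with
  | nil => exact List.Forall₂.nil
  | cons h _ ih => exact List.Forall₂.cons (Nat.add_le_add_right h _) ih

theorem forall₂_take_filter {M : ℕ} {s t : List ℕ} (h : List.Forall₂ (· ≤ ·) s t)
    (ht : t.Pairwise (· ≤ ·)) :
    List.Forall₂ (· ≤ ·) ((s.filter (· < M)).take (t.filter (· < M)).length)
      (t.filter (· < M)) := by
  induction h with
  | nil => simp
  | @cons a b s t h hst ih =>
    have ht' := List.pairwise_cons.1 ht
    by_cases hb : b < M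
    · have ha : a < M := by omega
      simp only [List.filter_cons, ha, hb, decide_true, if_true, List.length_cons,
        List.take_succ_cons]
      exact List.Forall₂.cons h (ih ht'.2)
    · have hnil : (b :: t).filter (· < M) = [] := by
        rw [List.filter_eq_nil_iff]
        intro y hy
        rcases List.mem_cons.1 hy with rfl | hy
        · simpa using hb
        · have := ht'.1 y hy
          simp; omega
      rw [hnil]
      simp

theorem forall₂_take_of_sublist {s t : List ℕ} (h : t.Sublist s) (hs : s.Pairwise (· ≤ ·)) :
    List.Forall₂ (· ≤ ·) (s.take t.length) t := by
  induction s generalizing t with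
  | nil => simp [List.sublist_nil.1 h]
  | cons a s ih =>
    have hs' := List.pairwise_cons.1 hs
    rcases t with _ | ⟨b, t⟩
    · simp
    · rw [List.length_cons, List.take_succ_cons]
      cases h with
      | cons _ h =>
        exact List.Forall₂.cons (hs'.1 b (h.subset (by simp)))
          (ih ((List.sublist_cons_self b t).trans h) hs'.2)
      | cons_cons _ h => exact List.Forall₂.cons le_rfl (ih h hs'.2)

theorem forall₂_orderedInsert {i j : ℕ} (hij : i ≤ j) {l : List ℕ} (hl : l.Pairwise (· ≤ ·)) :
    List.Forall₂ (· ≤ ·) (l.orderedInsert (· ≤ ·) i) (l.orderedInsert (· ≤ ·) j) := by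
  induction l generalizing i with
  | nil => simpa using hij
  | cons a l ih =>
    have hl' := List.pairwise_cons.1 hl
    simp only [List.orderedInsert]
    split_ifs with h1 h2 h2
    · exact List.Forall₂.cons hij (List.Forall₂.cons le_rfl (Forall₂_le_refl l))
    · refine List.Forall₂.cons h1 ?_
      have h3 : l.orderedInsert (· ≤ ·) a = a :: l := by
        rcases l with _ | ⟨c, l⟩
        · rfl
        · simp [List.orderedInsert, hl'.1 c (by simp)]
      rw [← h3]
      exact ih (by omega) hl'.2
    · omega
    · exact List.Forall₂.cons le_rfl (ih hij hl'.2)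

theorem filter_pad {M e : ℕ} {p : List ℕ} (hp : ∀ y ∈ p, y < M) :
    (pad M e p).filter (· < M) = p := by
  rw [pad, List.filter_append, List.filter_eq_self.2 (by simpa using hp)]
  simp

theorem tl_replicate (q a M : ℕ) : (tl 1 q (List.replicate a M)).toFinset =
    Finset.Ico (M + q) (M + q + a) := by
  induction a generalizing q with
  | zero => simp [tl]
  | succ a ih =>
    ext y
    have := ih (q + 1)
    rw [List.replicate_succ, tl, List.toFinset_cons, this]
    simp only [Finset.mem_insert, Finset.mem_Ico]
    omega

namespace PureShifted

variable {n d : ℕ} {S : Set (Finset ℕ)}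

theorem union_mem_of_forall₂ (hS : PureShifted n d S) {f g : List ℕ}
    (h : List.Forall₂ (· ≤ ·) f g) : ∀ {A : Finset ℕ}, f.Pairwise (· < ·) → g.Pairwise (· < ·) →
      A ∪ f.toFinset ∈ S → (∀ x ∈ A, ∀ y ∈ f, x < y) → (∀ y ∈ g, y ≤ n) → A ∪ g.toFinset ∈ S := by
  induction h with
  | nil => exact fun _ _ h _ _ => h
  | @cons a b f g hab _ ih =>
    intro A hf hg hA hlt hgn
    have hf' := List.pairwise_cons.1 hf
    have hg' := List.pairwise_cons.1 hg
    have h1 : insert a A ∪ g.toFinset ∈ S := by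
      refine ih hf'.2 hg'.2 ?_ ?_ fun y hy => hgn y (by simp [hy])
      · rwa [Finset.insert_union, ← Finset.union_insert, ← List.toFinset_cons]
      · intro x hx y hy
        rcases Finset.mem_insert.1 hx with rfl | hx
        · exact hf'.1 y hy
        · exact hlt x hx y (by simp [hy])
    rcases hab.eq_or_lt with rfl | hab
    · rwa [List.toFinset_cons, Finset.union_insert, ← Finset.insert_union]
    · have h2 := hS.shift _ h1 a (by simp) b hab (hgn b (by simp))
      rwa [Finset.insert_union, Finset.erase_insert, ← Finset.union_insert,
        ← List.toFinset_cons] at h2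
      rw [Finset.mem_union, List.mem_toFinset]
      rintro (h | h)
      · exact lt_irrefl a (hlt a h a (by simp))
      · have := hg'.1 a h
        omega

theorem supp_mem_of_forall₂ (hS : PureShifted n d S) {s t : List ℕ} (hs : s.Pairwise (· ≤ ·))
    (ht : t.Pairwise (· ≤ ·)) (h : List.Forall₂ (· ≤ ·) (s.take t.length) t) (hsS : supp s ∈ S)
    (htn : ∀ y ∈ supp t, y ≤ n) : supp t ∈ S := by
  have h1 : supp (s.take t.length) ∈ S := hS.down _ hsS _ (by
    conv_rhs => rw [← List.take_append_drop t.length s]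
    exact supp_append_subset _ _)
  have h2 := hS.union_mem_of_forall₂ (forall₂_tl (q := 0) h) (A := ∅)
    ((tl_pairwise (τ := 1) (hs.sublist (List.take_sublist _ _))).imp fun h => by omega)
    ((tl_pairwise (τ := 1) ht).imp fun h => by omega) (by rwa [Finset.empty_union]) (by simp)
    fun y hy => htn y (List.mem_toFinset.2 hy)
  rwa [Finset.empty_union] at h2

/-- The padded lists with support in `S`. -/
def listIdeal (M e : ℕ) (S : Set (Finset ℕ)) : Set (List ℕ) :=
  {s | s ∈ Lst 1 M e ∧ M ∈ s ∧ supp (s.filter (· < M)) ∈ S}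

theorem length_filter_lt {M e : ℕ} {s : List ℕ} (hs : s ∈ Lst 1 M e) (hM : M ∈ s) :
    (s.filter (· < M)).length < e := by
  rw [← hs.1]
  exact List.length_filter_lt_length_iff_exists.2 ⟨M, hM, by simp⟩

theorem good_listIdeal {M e c : ℕ} (hS : PureShifted n d S) (hn : n = M + d)
    (hd : d + 2 = 2 * e + c) (hc : c ≤ 1) : Good 1 M e (listIdeal M e S) where
  sub := fun s hs => hs.1
  top := fun s hs => hs.2.1
  up := by
    rintro s ⟨hs, hM, hsS⟩ t ht hst
    have hMt : M ∈ t := by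
      obtain ⟨y, hy, hy'⟩ := exists_le_of_forall₂ hst hM
      have := (ht.2.2 y hy).2
      rwa [show M = y by omega]
    refine ⟨ht, hMt, hS.supp_mem_of_forall₂ (hs.2.1.sublist List.filter_sublist)
      (ht.2.1.sublist List.filter_sublist) (forall₂_take_filter hst ht.2.1) hsS fun y hy => ?_⟩
    have h1 := mem_supp_lt (M := M) (fun y hy => by simpa using (List.mem_filter.1 hy).2) hy
    have h2 := length_filter_lt ht hMt
    omega

theorem stdB_iff {M e c r : ℕ} (hS : PureShifted n d S) (hn : n = M + d) (hdpos : 0 < d)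
    (hM : 1 ≤ M) (hsub : S ⊆ DeltaC n d) (hsym : ∀ i ≤ d, hvec d S i = hvec d S (d - i))
    (hd : d + 2 = 2 * e + c) (hc : c ≤ 1) {b : List ℕ} (hb : b ∈ Vn 1 n r) :
    StdB M e d (listIdeal M e S) b ↔ supp b ∈ S := by
  obtain ⟨s, hbs⟩ := sorted_decomp M hb.1
  have hfM : ∀ y ∈ b.filter (· < M), y < M := fun y hy => by simpa using (List.mem_filter.1 hy).2
  have hfs : (b.filter (· < M)).Pairwise (· ≤ ·) := hb.1.sublist List.filter_sublist
  have hf1 : ∀ y ∈ b.filter (· < M), 1 ≤ y := fun y hy => hb.2.1 y (List.mem_filter.1 hy).1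
  have hsM : ∀ y ∈ s, M + 1 ≤ y := by
    intro y hy
    have hcount : s.count M = 0 := by
      have h := congrArg (List.count M) hbs
      rw [List.count_append, List.count_append, List.count_replicate_self] at h
      omega
    have hfil : s.filter (· < M) = [] := by
      have h := congrArg (fun l => (l.filter (· < M)).length) hbs
      simp only [List.filter_append, List.length_append, List.filter_filter, Bool.and_self] at h
      exact List.eq_nil_of_length_eq_zero (by omega)
    have h1 : y ≠ M := fun h => List.count_eq_zero.1 hcount (h ▸ hy)
    have h2 : ¬ y < M := by simpa using List.filter_eq_nil_iff.1 hfil y hy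
    omega
  unfold StdB
  change pad M e (b.filter (· < M)) ∈ _ ∧ _ ↔ _
  generalize b.filter (· < M) = f at *
  generalize b.count M = a at *
  have hsuppP : supp (f ++ List.replicate a M) = supp f ∪ Finset.Ico (M + f.length)
      (M + f.length + a) := by
    rw [supp, tl_append, List.toFinset_append, tl_replicate, zero_add]
    rfl
  have hPsort : (f ++ List.replicate a M).Pairwise (· ≤ ·) := by
    have := hb.1
    rw [hbs, ← List.append_assoc] at this
    exact (List.pairwise_append.1 this).1
  have hPcard : (supp (f ++ List.replicate a M)).card = f.length + a := by
    rw [card_supp hPsort]; simp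
  have hPlt : ∀ x ∈ supp (f ++ List.replicate a M), x < M + (f.length + a) := by
    intro x hx
    rw [hsuppP, Finset.mem_union, Finset.mem_Ico] at hx
    rcases hx with hx | hx
    · have := mem_supp_lt hfM hx; omega
    · omega
  constructor
  · rintro ⟨hpad, ha⟩
    have hk : f.length < e := by omega
    obtain ⟨-, -, hfS⟩ := hpad
    rw [filter_pad hfM] at hfS
    have hU := hS.union_Icc_mem hn hdpos hM hsub hsym (k := f.length) (by omega)
      ⟨hfS, card_supp hfs, fun x hx => by have := mem_supp_lt hfM hx; omega⟩
    have hP : supp (f ++ List.replicate a M) ∈ S := by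
      refine hS.down _ hU _ ?_
      rw [hsuppP]
      refine Finset.union_subset_union_right fun x hx => ?_
      rw [Finset.mem_Ico] at hx
      rw [Finset.mem_Icc]
      omega
    have hfill := hS.fill hn hP fun x hx => by rw [hPcard]; exact (hPlt x hx).le
    refine hS.down _ hfill _ fun y hy => ?_
    have hyn := hb.2.2.1 y (List.mem_toFinset.1 hy)
    rw [hbs, ← List.append_assoc, supp, tl_append, List.toFinset_append, Finset.mem_union] at hy
    rcases hy with hy | hy
    · exact Finset.mem_union_left _ hy
    · have := le_of_mem_tl hsM (List.mem_toFinset.1 hy)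
      refine Finset.mem_union_right _ (Finset.mem_Icc.2 ⟨?_, hyn⟩)
      rw [hPcard]
      simp at this
      omega
  · intro hbS
    have hP : supp (f ++ List.replicate a M) ∈ S := hS.down _ hbS _ (by
      rw [hbs, ← List.append_assoc]; exact supp_append_subset _ _)
    have hid : f.length + a ≤ d := hPcard ▸ hS.card_le _ hP
    have key : a + 2 * f.length ≤ d := by
      by_contra! hcon
      have hlow : supp (f ++ List.replicate a M) ∈ low M S (d - (d - (f.length + a))) := by
        rw [show d - (d - (f.length + a)) = f.length + a by omega]
        exact ⟨hP, hPcard, hPlt⟩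
      have h1 := (hS.card_filter_of_mem_low hn hdpos hM hsub (by omega) hlow).1
      have h2 : supp (f.take (d - (f.length + a) + 1)) ⊆
          (supp (f ++ List.replicate a M)).filter (· < M + (d - (f.length + a))) := by
        intro y hy
        have h3 := mem_supp_lt (M := M) (fun y hy => hfM y (List.mem_of_mem_take hy)) hy
        rw [List.length_take] at h3
        refine Finset.mem_filter.2 ⟨supp_append_subset _ _ ?_, by omega⟩
        rw [← List.take_append_drop (d - (f.length + a) + 1) f]
        exact supp_append_subset _ _ hy
      have h3 := Finset.card_le_card h2
      rw [h1, card_supp (hfs.sublist (List.take_sublist _ _)), List.length_take] at h3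
      omega
    have hk : f.length < e := by omega
    refine ⟨⟨pad_mem_Lst hk.le hM hfs fun y hy => ⟨hf1 y hy, (hfM y hy).le⟩, mem_pad hk, ?_⟩, key⟩
    rw [filter_pad hfM]
    exact hS.down _ hP _ (supp_append_subset _ _)

end PureShifted
end Squeezed

namespace Squeezed

theorem sort_coe_eq {l : List ℕ} (hl : l.Pairwise (· ≤ ·)) {u : Multiset ℕ} (h : u = ↑l) :
    u.sort (· ≤ ·) = l := by
  refine List.Perm.eq_of_pairwise' (r := (· ≤ ·)) (Multiset.pairwise_sort _ _) hl ?_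
  rw [← Multiset.coe_eq_coe, Multiset.sort_eq, h]

theorem sort_cons_eq (i : ℕ) (u : Multiset ℕ) :
    (i ::ₘ u).sort (· ≤ ·) = (u.sort (· ≤ ·)).orderedInsert (· ≤ ·) i := by
  refine sort_coe_eq (List.Pairwise.orderedInsert _ _ (Multiset.pairwise_sort _ _)) ?_
  rw [Multiset.coe_eq_coe.2 (List.perm_orderedInsert _ _ _), ← Multiset.cons_coe,
    Multiset.sort_eq]

theorem mem_fac_append {n σ y : ℕ} {p s : List ℕ} : y ∈ fac n σ (p ++ s) ↔
    (∃ j < p.length, (y = p.getD j 0 + σ + 2 * j ∨ y = p.getD j 0 + σ + 2 * j + 1) ∧ y ≤ n) ∨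
      y ∈ fac n (σ + 2 * p.length) s := by
  induction p generalizing σ with
  | nil => simp
  | cons a p ih =>
    rw [List.cons_append, mem_fac_cons, ih, List.length_cons, show σ + 2 + 2 * p.length =
      σ + 2 * (p.length + 1) by ring, ← or_assoc]
    refine or_congr ⟨?_, ?_⟩ Iff.rfl
    · rintro (h | ⟨j, hj, h, h'⟩)
      · exact ⟨0, by simp, by simpa using h⟩
      · exact ⟨j + 1, by omega, by rw [List.getD_cons_succ]; omega, h'⟩
    · rintro ⟨j, hj, h, h'⟩
      rcases j with _ | j
      · exact Or.inl ⟨by simpa using h, h'⟩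
      · rw [List.getD_cons_succ] at h
        exact Or.inr ⟨j, by omega, by omega, h'⟩

theorem Fd_eq_fac {n d M e c : ℕ} (hn : n = M + d) (hd : d + 2 = 2 * e + c) (hc : c ≤ 1)
    {u : Multiset ℕ} (hu : ∀ i ∈ u, i < M) (hud : 2 * Multiset.card u ≤ d) :
    Fd n d u = fac n 0 (pad M e (u.sort (· ≤ ·))) := by
  ext y
  rw [pad, mem_fac_append, fac_replicate _ _ c hc (by rw [Multiset.length_sort]; omega), Fd,
    Finset.mem_union, Finset.mem_biUnion, Multiset.length_sort,
    show n + 2 * Multiset.card u - d = M + (0 + 2 * Multiset.card u) by omega]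
  refine or_congr ⟨?_, ?_⟩ Iff.rfl
  · rintro ⟨j, hj, hy⟩
    rw [Finset.mem_range] at hj
    have hlt : (u.sort (· ≤ ·)).getD j 0 < M := by
      rw [List.getD_eq_getElem _ _ (by rw [Multiset.length_sort]; exact hj)]
      exact hu _ ((Multiset.mem_sort _).1 (List.getElem_mem _))
    simp only [Finset.mem_insert, Finset.mem_singleton] at hy
    exact ⟨j, hj, by omega, by omega⟩
  · rintro ⟨j, hj, hy, -⟩
    refine ⟨j, Finset.mem_range.2 hj, ?_⟩
    simp only [Finset.mem_insert, Finset.mem_singleton]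
    omega

/-- A squeezed sphere is the boundary of its family of facets. -/
theorem squeezedSphere_eq_bd {n d : ℕ} {U : Set (Multiset ℕ)}
    (hU : ∀ u ∈ U, (Fd n d u).card = d + 1) :
    squeezedSphere n d U = bd d (Fd n d '' U) := by
  have hset : ∀ G, {H | H ∈ squeezedBall n d U ∧ H.card = d + 1 ∧ G ⊆ H} =
      {H | H ∈ Fd n d '' U ∧ G ⊆ H} := by
    intro G
    ext H
    constructor
    · rintro ⟨⟨u, hu, hH⟩, hHc, hGH⟩
      exact ⟨⟨u, hu, (Finset.eq_of_subset_of_card_le hH (by rw [hU u hu, hHc])).symm⟩, hGH⟩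
    · rintro ⟨⟨u, hu, rfl⟩, hGH⟩
      exact ⟨⟨u, hu, subset_rfl⟩, hU u hu, hGH⟩
  ext F
  constructor
  · rintro ⟨G, hFG, -, hGd, h⟩
    rw [hset, Set.ncard_eq_one] at h
    obtain ⟨H, hH⟩ := h
    exact ⟨G, hFG, hGd, H, (hH.ge rfl : H ∈ {H | H ∈ Fd n d '' U ∧ G ⊆ H}),
      fun H' h' => hH.le h'⟩
  · rintro ⟨G, hFG, hGd, H, hH, huniq⟩
    obtain ⟨⟨u, hu, rfl⟩, hGH⟩ := hH
    refine ⟨G, hFG, ⟨u, hu, hGH⟩, hGd, ?_⟩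
    rw [hset, Set.ncard_eq_one]
    exact ⟨Fd n d u, Set.Subset.antisymm (fun H' h' => huniq H' h')
      (Set.singleton_subset_iff.2 ⟨⟨u, hu, rfl⟩, hGH⟩)⟩

namespace PureShifted

variable {n d : ℕ} {S : Set (Finset ℕ)}

/-- The order ideal of monomials with support in `S`. -/
def orderIdeal (d M : ℕ) (S : Set (Finset ℕ)) : Set (Multiset ℕ) :=
  {u | (∀ i ∈ u, 1 ≤ i ∧ i < M) ∧ 2 * Multiset.card u ≤ d ∧ supp (u.sort (· ≤ ·)) ∈ S}

theorem isShiftedOrderIdeal_orderIdeal {M : ℕ} (hS : PureShifted n d S) (hn : n = M + d)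
    (hdpos : 0 < d) (hsing : ∀ v ∈ Finset.Icc 1 n, ({v} : Finset ℕ) ∈ S)
    (hsym : ∀ i ≤ d, hvec d S i = hvec d S (d - i)) :
    IsShiftedOrderIdeal (M - 1) (orderIdeal d M S) := by
  have hsupp : ∀ u : Multiset ℕ, (∀ i ∈ u, i < M) → 2 * Multiset.card u ≤ d →
      ∀ y ∈ supp (u.sort (· ≤ ·)), y ≤ n := by
    intro u hu hud y hy
    have := mem_supp_lt (fun y hy => hu y ((Multiset.mem_sort _).1 hy)) hy
    rw [Multiset.length_sort] at this
    omega
  refine ⟨fun u hu i hi => ?_, ⟨by simp, by simp, ?_⟩, fun i hi => ?_, fun u hu v hvu => ?_,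
    fun u i j hij hj hu => ?_⟩
  · have := hu.1 i hi
    rw [Finset.mem_Icc]
    omega
  · rw [Multiset.sort_zero]
    exact hS.down _ (hsing 1 (by rw [Finset.mem_Icc]; omega)) _ (Finset.empty_subset _)
  · rw [Finset.mem_Icc] at hi
    refine ⟨?_, ?_, ?_⟩
    · intro j hj
      rw [Multiset.mem_singleton.1 hj]
      omega
    · rw [Multiset.card_singleton]
      by_contra! hcon
      obtain rfl : d = 1 := by omega
      have h := hsym 0 (by omega)
      rw [hS.hvec_eq hn (by omega), hS.hvec_eq hn (by omega), Nat.sub_zero] at h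
      have h0 : (low M S 0).ncard ≤ 1 := by
        rw [← Set.ncard_singleton (∅ : Finset ℕ)]
        exact Set.ncard_le_ncard fun P hP => Finset.card_eq_zero.1 hP.2.1
      have h1 : ({{1}, {2}} : Set (Finset ℕ)) ⊆ low M S 1 := by
        rintro P (rfl | rfl)
        · exact ⟨hsing 1 (by rw [Finset.mem_Icc]; omega), rfl, by simp; omega⟩
        · exact ⟨hsing 2 (by rw [Finset.mem_Icc]; omega), rfl, by simp; omega⟩
      have h2 := Set.ncard_le_ncard h1 (hS.low_finite M 1)
      rw [Set.ncard_pair (by decide)] at h2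
      omega
    · rw [Multiset.sort_singleton]
      simpa [supp, tl] using hsing i (by rw [Finset.mem_Icc]; omega)
  · have hcard := Multiset.card_le_card hvu
    have hv1 : ∀ i ∈ v, 1 ≤ i ∧ i < M := fun i hi => hu.1 i (Multiset.mem_of_le hvu hi)
    have hud := hu.2.1
    refine ⟨hv1, by omega, ?_⟩
    refine hS.supp_mem_of_forall₂ (Multiset.pairwise_sort u _) (Multiset.pairwise_sort v _)
      (forall₂_take_of_sublist ?_ (Multiset.pairwise_sort u _)) hu.2.2
      (hsupp v (fun i hi => (hv1 i hi).2) (by omega))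
    refine List.sublist_of_subperm_of_pairwise (r := (· ≤ ·)) ?_ (Multiset.pairwise_sort _ _)
      (Multiset.pairwise_sort _ _)
    rwa [← Multiset.coe_le, Multiset.sort_eq, Multiset.sort_eq]
  · obtain ⟨h1, h2, h3⟩ := hu
    have h1' : ∀ x ∈ j ::ₘ u, 1 ≤ x ∧ x < M := by
      intro x hx
      rcases Multiset.mem_cons.1 hx with rfl | hx
      · have := h1 i (Multiset.mem_cons_self i u)
        omega
      · exact h1 x (Multiset.mem_cons_of_mem hx)
    have h2' : 2 * Multiset.card (j ::ₘ u) ≤ d := by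
      rw [Multiset.card_cons] at *; exact h2
    refine ⟨h1', h2', ?_⟩
    refine hS.supp_mem_of_forall₂ (Multiset.pairwise_sort (i ::ₘ u) _)
      (Multiset.pairwise_sort (j ::ₘ u) _) ?_ h3 (hsupp _ (fun i hi => (h1' i hi).2) h2')
    rw [List.take_of_length_le (by simp), sort_cons_eq, sort_cons_eq]
    exact forall₂_orderedInsert hij.le (Multiset.pairwise_sort u _)

theorem squeezedSphere_orderIdeal {M e c : ℕ} (hn : n = M + d) (hM : 1 ≤ M)
    (hd : d + 2 = 2 * e + c) (hc : c ≤ 1) :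
    squeezedSphere n d (orderIdeal d M S) = bd d (fac n 0 '' listIdeal M e S) := by
  have himg : (fun u : Multiset ℕ => pad M e (u.sort (· ≤ ·))) '' orderIdeal d M S =
      listIdeal M e S := by
    ext s
    constructor
    · rintro ⟨u, ⟨h1, h2, h3⟩, rfl⟩
      have hk : (u.sort (· ≤ ·)).length < e := by rw [Multiset.length_sort]; omega
      refine ⟨pad_mem_Lst hk.le hM (Multiset.pairwise_sort _ _) fun y hy => ?_, mem_pad hk, ?_⟩
      · have := h1 y ((Multiset.mem_sort _).1 hy); omega
      · rwa [filter_pad fun y hy => (h1 y ((Multiset.mem_sort _).1 hy)).2]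
    · rintro ⟨hs, hMs, hsS⟩
      have hlen := length_filter_lt hs hMs
      have hsort := sort_coe_eq (hs.2.1.sublist (List.filter_sublist (p := (· < M)))) rfl
      refine ⟨↑(s.filter (· < M)), ⟨?_, ?_, ?_⟩, ?_⟩
      · intro i hi
        rw [Multiset.mem_coe, List.mem_filter] at hi
        exact ⟨(hs.2.2 i hi.1).1, by simpa using hi.2⟩
      · rw [Multiset.coe_card]; omega
      · rwa [hsort]
      · simp only [hsort]
        obtain ⟨s', hs'⟩ := sorted_decomp M hs.2.1
        rcases s' with _ | ⟨y, s'⟩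
        · rw [List.append_nil] at hs'
          have h1 := congrArg List.length hs'
          rw [List.length_append, List.length_replicate, hs.1] at h1
          rw [pad, show e - (s.filter (· < M)).length = s.count M by omega]
          exact hs'.symm
        · exfalso
          have hy : y ∈ s := by rw [hs']; simp
          have hyM := (hs.2.2 y hy).2
          rcases hyM.lt_or_eq with h | rfl
          · have h1 := congrArg (fun l => (l.filter (· < M)).length) hs'
            simp only [List.filter_append, List.length_append, List.filter_filter, Bool.and_self,
              List.filter_cons, h, decide_true, if_true, List.length_cons] at h1
            omega
          · have h1 := congrArg (List.count y) hs'
            rw [List.count_append, List.count_append, List.count_replicate_self,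
              List.count_cons_self] at h1
            omega
  have hFd : ∀ u ∈ orderIdeal d M S, Fd n d u = fac n 0 (pad M e (u.sort (· ≤ ·))) :=
    fun u hu => Fd_eq_fac hn hd hc (fun i hi => (hu.1 i hi).2) hu.2.1
  rw [squeezedSphere_eq_bd, Set.image_congr hFd, ← himg, Set.image_image]
  intro u hu
  have hmem : pad M e (u.sort (· ≤ ·)) ∈ listIdeal M e S := himg ▸ Set.mem_image_of_mem _ hu
  have := fac_card (n := n) e 0 hc (by omega) hmem.1 hmem.2.1
  rw [hFd u hu]
  omega

end PureShifted

/-- The combinatorial part of the main theorem. -/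
theorem exists_squeezed {n d M e c : ℕ} {S : Set (Finset ℕ)} (hn : n = M + d) (hM : 1 ≤ M)
    (hdpos : 0 < d) (hd : d + 2 = 2 * e + c) (hc : c ≤ 1)
    (hΓ : SimplicialComplexOn (Finset.Icc 1 n) S) (hpure : PureComplex S)
    (hshift : ShiftedComplex (Finset.Icc 1 n) S) (hdim : sdim S = (d : ℤ) - 1)
    (hsym : ∀ i ≤ d, hvec d S i = hvec d S (d - i)) (hsub : S ⊆ DeltaC n d) :
    ∃ (U : Set (Multiset ℕ)) (W : Set (List ℕ)), IsShiftedOrderIdeal (n - d - 1) U ∧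
      (∀ u ∈ U, 2 * Multiset.card u ≤ d + 1) ∧ Good 1 M e W ∧
      squeezedSphere n d U = bd d (fac n 0 '' W) ∧
      ∀ r, ∀ b ∈ Vn 1 n r, StdB M e d W b ↔ supp b ∈ S := by
  have hS := pureShifted_of (by omega) hΓ hpure hshift hdim
  refine ⟨PureShifted.orderIdeal d M S, PureShifted.listIdeal M e S, ?_,
    fun u hu => hu.2.1.trans (Nat.le_succ d), hS.good_listIdeal hn hd hc,
    PureShifted.squeezedSphere_orderIdeal hn hM hd hc,
    fun r b hb => hS.stdB_iff hn hdpos hM hsub hsym hd hc hb⟩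
  rw [show n - d - 1 = M - 1 by omega]
  exact hS.isShiftedOrderIdeal_orderIdeal hn hdpos hΓ.2.1 hsym

end Squeezed

namespace Squeezed

theorem exists_count_of_lt : ∀ {a b : List ℕ}, a.Pairwise (· ≥ ·) → b.Pairwise (· ≥ ·) → a < b →
    ∃ k, a.count k < b.count k ∧ ∀ l, k < l → a.count l = b.count l
  | _, [], _, _, h => absurd h (List.not_lt_nil _)
  | [], y :: b, _, hb, _ => by
    rw [List.pairwise_cons] at hb
    refine ⟨y, by simp, fun l hl => ?_⟩
    rw [List.count_nil, eq_comm, List.count_eq_zero]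
    intro hm
    rcases List.mem_cons.1 hm with rfl | hm
    · omega
    · have := hb.1 _ hm; omega
  | x :: a, y :: b, ha, hb, h => by
    rw [List.pairwise_cons] at ha hb
    rcases List.cons_lt_cons_iff.1 h with hxy | ⟨rfl, h⟩
    · have hn : ∀ l, x < l → (x :: a).count l = 0 := fun l hl => List.count_eq_zero.2 fun hm => by
        rcases List.mem_cons.1 hm with rfl | hm
        · omega
        · have := ha.1 _ hm; omega
      refine ⟨y, by rw [hn y hxy]; simp, fun l hl => ?_⟩
      rw [hn l (by omega), eq_comm, List.count_eq_zero]
      intro hm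
      rcases List.mem_cons.1 hm with rfl | hm
      · omega
      · have := hb.1 _ hm; omega
    · replace h : a < b := by
        rcases List.cons_lt_cons_iff.1 h with h | h
        · exact absurd h (lt_irrefl _)
        · exact h.2
      obtain ⟨k, hk, hl⟩ := exists_count_of_lt ha.2 hb.2 h
      refine ⟨k, ?_, fun l h => ?_⟩
      · simp only [List.count_cons]; omega
      · simp only [List.count_cons, hl l h]

theorem reverse_lt_iff_count {a b : List ℕ} (ha : a.Pairwise (· ≤ ·)) (hb : b.Pairwise (· ≤ ·)) :
    a.reverse < b.reverse ↔ ∃ k, a.count k < b.count k ∧ ∀ l, k < l → a.count l = b.count l := by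
  have key : ∀ {a b : List ℕ}, a.Pairwise (· ≤ ·) → b.Pairwise (· ≤ ·) → a.reverse < b.reverse →
      ∃ k, a.count k < b.count k ∧ ∀ l, k < l → a.count l = b.count l := fun {a b} ha hb h => by
    simpa using exists_count_of_lt (a := a.reverse) (b := b.reverse)
      (List.pairwise_reverse.2 ha) (List.pairwise_reverse.2 hb) h
  refine ⟨key ha hb, fun ⟨k, hk, hl⟩ => ?_⟩
  rcases lt_trichotomy a.reverse b.reverse with h | h | h
  · exact h
  · rw [List.reverse_injective h] at hk
    exact absurd hk (lt_irrefl _)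
  · obtain ⟨k', hk', hl'⟩ := key hb ha h
    rcases lt_trichotomy k k' with h | rfl | h
    · have := hl _ h; omega
    · omega
    · have := hl' _ h; omega

end Squeezed

namespace Squeezed

section Sym

variable {n : ℕ} {K : Type*} [Field K]

/-- The increasing list of the indices, counted from one, of the variables of a monomial. -/
noncomputable def lst (u : Fin n →₀ ℕ) : List ℕ :=
  (u.toMultiset.map (fun a : Fin n => (a : ℕ) + 1)).sort (· ≤ ·)

/-- The variables of the polynomial ring, numbered from one. -/
noncomputable def symVar (K : Type*) [Field K] (n a : ℕ) : MvPolynomial (Fin n) K :=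
  if h : 1 ≤ a ∧ a ≤ n then MvPolynomial.X ⟨a - 1, by omega⟩ else 0

theorem symVar_succ (a : Fin n) : symVar K n (a + 1) = MvPolynomial.X a := by
  rw [symVar, dif_pos ⟨by omega, by omega⟩]
  rfl

theorem lst_coe (u : Fin n →₀ ℕ) :
    (lst u : Multiset ℕ) = u.toMultiset.map (fun a : Fin n => (a : ℕ) + 1) :=
  Multiset.sort_eq _ _

theorem lst_pairwise (u : Fin n →₀ ℕ) : (lst u).Pairwise (· ≤ ·) := Multiset.pairwise_sort _ _

theorem lst_length (u : Fin n →₀ ℕ) : (lst u).length = u.sum fun _ e => e := by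
  rw [← Multiset.coe_card, lst_coe, Multiset.card_map, Finsupp.card_toMultiset]
  rfl

theorem count_lst (u : Fin n →₀ ℕ) (a : Fin n) : (lst u).count ((a : ℕ) + 1) = u a := by
  rw [← Multiset.coe_count, lst_coe, Multiset.count_map_eq_count' (fun a : Fin n => (a : ℕ) + 1) _
    (fun a b h => by simpa [Fin.ext_iff] using h), Finsupp.count_toMultiset]

theorem mem_lst {u : Fin n →₀ ℕ} {y : ℕ} (h : y ∈ lst u) : 1 ≤ y ∧ y ≤ n := by
  rw [← Multiset.mem_coe, lst_coe, Multiset.mem_map] at h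
  obtain ⟨a, -, rfl⟩ := h
  omega

theorem lst_mem_Vn (u : Fin n →₀ ℕ) : lst u ∈ Vn 0 n (u.sum fun _ e => e) :=
  ⟨lst_pairwise u, fun _ h => (mem_lst h).1, fun _ h => (mem_lst (by rwa [tl_zero] at h)).2,
    lst_length u⟩

theorem exists_lst {b : List ℕ} (hb : b.Pairwise (· ≤ ·)) (h : ∀ y ∈ b, 1 ≤ y ∧ y ≤ n) :
    ∃ u : Fin n →₀ ℕ, lst u = b := by
  refine ⟨Finsupp.equivFunOnFinite.symm fun a : Fin n => b.count ((a : ℕ) + 1), ?_⟩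
  refine List.Perm.eq_of_pairwise' (r := (· ≤ ·)) (lst_pairwise _) hb ?_
  rw [List.perm_iff_count]
  intro y
  by_cases hy : 1 ≤ y ∧ y ≤ n
  · obtain ⟨a, rfl⟩ : ∃ a : Fin n, y = a + 1 := ⟨⟨y - 1, by omega⟩, by simp; omega⟩
    rw [count_lst]
    simp
  · rw [List.count_eq_zero.2 fun hm => hy (mem_lst hm), List.count_eq_zero.2 fun hm => hy (h _ hm)]

theorem lst_injective : Function.Injective (lst (n := n)) := fun u v h => by
  ext a
  rw [← count_lst, h, count_lst]

theorem mp_lst (u : Fin n →₀ ℕ) : mp (symVar K n) 0 (lst u) = MvPolynomial.monomial u 1 := by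
  rw [mp, tl_zero, ← Multiset.prod_coe, ← Multiset.map_coe, lst_coe, Multiset.map_map]
  simp only [Function.comp_def, symVar_succ]
  induction u using Finsupp.induction_linear with
  | zero => simp
  | add u v hu hv => rw [map_add, Multiset.map_add, Multiset.prod_add, hu, hv,
      MvPolynomial.monomial_mul, one_mul]
  | single a k => rw [Finsupp.toMultiset_single, Multiset.map_nsmul, Multiset.prod_nsmul,
      Multiset.map_singleton, Multiset.prod_singleton, MvPolynomial.X_pow_eq_monomial]

theorem degRevLexLT_iff {u v : Fin n →₀ ℕ} (h : (v.sum fun _ e => e) = u.sum fun _ e => e) :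
    DegRevLexLT v u ↔ (lst u).reverse < (lst v).reverse := by
  rw [reverse_lt_iff_count (lst_pairwise u) (lst_pairwise v), DegRevLexLT, h]
  constructor
  · rintro (h | ⟨-, k, hk, hl⟩)
    · exact absurd h (lt_irrefl _)
    · refine ⟨k + 1, by rwa [count_lst, count_lst], fun l hkl => ?_⟩
      by_cases hy : l ≤ n
      · obtain ⟨a, rfl⟩ : ∃ a : Fin n, l = a + 1 := ⟨⟨l - 1, by omega⟩, by simp; omega⟩
        rw [count_lst, count_lst, hl a (by rw [Fin.lt_def]; omega)]
      · rw [List.count_eq_zero.2 fun hm => hy (mem_lst hm).2,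
          List.count_eq_zero.2 fun hm => hy (mem_lst hm).2]
  · rintro ⟨k, hk, hl⟩
    have hm := mem_lst (List.count_pos_iff.1 (by omega : 0 < (lst v).count k))
    obtain ⟨a, rfl⟩ : ∃ a : Fin n, k = a + 1 := ⟨⟨k - 1, by omega⟩, by simp; omega⟩
    rw [count_lst, count_lst] at hk
    refine Or.inr ⟨rfl, a, hk, fun l hal => ?_⟩
    rw [← count_lst, ← count_lst, hl _ (by rw [Fin.lt_def] at hal; omega)]

theorem lst_sublist {u v : Fin n →₀ ℕ} (h : u ≤ v) : (lst u).Sublist (lst v) := by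
  refine List.sublist_of_subperm_of_pairwise ?_ (lst_pairwise u) (lst_pairwise v)
  rw [← Multiset.coe_le, lst_coe, lst_coe]
  exact Multiset.map_le_map (Finsupp.toMultiset_strictMono.monotone h)

theorem tl_one_eq_zipWith (q : ℕ) (b : List ℕ) :
    tl 1 q b = List.zipWith (· + ·) b (List.range' q b.length) := by
  induction b generalizing q with
  | nil => rfl
  | cons a b ih => simp [tl, ih, List.range'_succ]

theorem sqfreeOp_eq (u : Fin n →₀ ℕ) : sqfreeOp u = supp (lst u) := by
  rw [supp, tl_one_eq_zipWith, lst_length, sqfreeOp, Finsupp.card_toMultiset, List.range_eq_range']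
  rfl

end Sym

end Squeezed

namespace Squeezed
open Submodule

theorem signComm_of_comm {K A : Type*} [Field K] [CommRing A] [Algebra K A] (x : ℕ → A) :
    SignComm K x 0 :=
  ⟨fun j k => by rw [mul_comm]; exact mem_span_singleton_self _, Or.inl rfl⟩

section Sym

variable {n : ℕ} {K : Type*} [Field K]

theorem linearIndepOn_symVar (r : ℕ) : LinearIndepOn K (mp (symVar K n) 0) (Vn 0 n r) := by
  have h := (MvPolynomial.basisMonomials (Fin n) K).linearIndependent
  rw [MvPolynomial.coe_basisMonomials, ← funext mp_lst] at h
  refine LinearIndepOn.mono ((linearIndepOn_range_iff lst_injective (mp (symVar K n) 0)).2 h) ?_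
  intro b hb
  exact exists_lst hb.1 fun y hy => ⟨hb.2.1 y hy, hb.2.2.1 y (by rwa [tl_zero])⟩

theorem genLin_X (M : Matrix (Fin n) (Fin n) K) (j : Fin n) :
    genLin M (MvPolynomial.X j) = colForm (symVar K n) n (fun q => M q.1 q.2) (j + 1) := by
  rw [genLin, MvPolynomial.aeval_X, colForm, dif_pos ⟨by omega, by omega⟩]
  refine Finset.sum_congr rfl fun a _ => ?_
  rw [symVar_succ, MvPolynomial.smul_eq_C_mul]
  rfl

theorem genLin_faceMonomial (M : Matrix (Fin n) (Fin n) K) {F : Finset ℕ}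
    (hF : F ⊆ Finset.Icc 1 n) : genLin M (faceMonomial K n F) =
      ∏ i ∈ F, colForm (symVar K n) n (fun q => M q.1 q.2) i := by
  rw [faceMonomial, map_prod]
  refine Finset.prod_bij (fun a _ => (a : ℕ) + 1) ?_ ?_ ?_ ?_
  · intro a ha
    exact (Finset.mem_filter.1 ha).2
  · intro a _ b _ h
    simpa [Fin.ext_iff] using h
  · intro i hi
    have := Finset.mem_Icc.1 (hF hi)
    have h : i - 1 + 1 = i := by omega
    exact ⟨⟨i - 1, by omega⟩, by simpa [h] using hi, h⟩
  · intro a _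
    exact genLin_X M a

theorem Jd_le_homogeneous {v : ℕ → MvPolynomial (Fin n) K}
    (hspan : spanIcc K v 1 n = spanIcc K (symVar K n) 1 n) (S : Set (Finset ℕ)) (r : ℕ) :
    Jd K v n S r ≤ MvPolynomial.homogeneousSubmodule (Fin n) K r := by
  refine (Jd_le_pow n r S).trans ?_
  rw [hspan]
  refine ((signComm_of_comm _).pow_le_span_mp n r).trans (span_le.2 ?_)
  rintro _ ⟨b, hb, rfl⟩
  obtain ⟨u, rfl⟩ := exists_lst (n := n) hb.1
    fun y hy => ⟨hb.2.1 y hy, hb.2.2.1 y (by rwa [tl_zero])⟩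
  rw [mp_lst]
  refine MvPolynomial.isHomogeneous_monomial _ ?_
  rw [← hb.2.2.2, lst_length]
  rfl

section Ideal

variable {S : Set (Finset ℕ)} {M : Matrix (Fin n) (Fin n) K}

theorem Jd_le_map_genLin (hdown : ∀ F ∈ S, ∀ G ⊆ F, G ∈ S) (r : ℕ) :
    ∀ f ∈ Jd K (colForm (symVar K n) n fun q => M q.1 q.2) n S r,
      f ∈ Ideal.map (genLin M) (srIdeal K n S) := by
  intro f hf
  have : Jd K (colForm (symVar K n) n fun q => M q.1 q.2) n S r ≤
      (Ideal.map (genLin M) (srIdeal K n S)).restrictScalars K := by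
    refine span_le.2 ?_
    rintro _ ⟨l, -, h2, h3, rfl⟩
    have hl : l.toFinset ⊆ Finset.Icc 1 n := fun i hi =>
      Finset.mem_Icc.2 (h2 i (List.mem_toFinset.1 hi))
    change (l.map _).prod ∈ Ideal.map (genLin M) (srIdeal K n S)
    refine Ideal.mem_of_dvd _ ?_ (Ideal.mem_map_of_mem (genLin M)
      (Ideal.subset_span ⟨_, hl, h3, rfl⟩))
    rw [genLin_faceMonomial M hl, Finset.prod_list_map_count]
    exact Finset.prod_dvd_prod_of_dvd _ _ fun i hi =>
      dvd_pow_self _ (List.count_pos_iff.2 (List.mem_toFinset.1 hi)).ne'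
  exact this hf

theorem map_genLin_le (hdown : ∀ F ∈ S, ∀ G ⊆ F, G ∈ S) (hM : IsUnit M.det) :
    ∀ f ∈ Ideal.map (genLin M) (srIdeal K n S),
      f ∈ ⨆ r, Jd K (colForm (symVar K n) n fun q => M q.1 q.2) n S r := by
  set v := colForm (symVar K n) n fun q => M q.1 q.2 with hv
  have hX : ∀ (j : Fin n), ∀ f ∈ ⨆ r, Jd K v n S r, f * MvPolynomial.X j ∈ ⨆ r, Jd K v n S r := by
    intro j f hf
    induction hf using Submodule.iSup_induction' with
    | mem r f hf =>
      refine mem_iSup_of_mem (r + 1) (Jd_mul_x (spanIcc_colForm hM) hdown r (j + 1) (by omega)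
        (by omega) (mul_mem_mul hf ?_))
      rw [symVar_succ]
      exact mem_span_singleton_self _
    | zero => rw [zero_mul]; exact zero_mem _
    | add f g _ _ h1 h2 => rw [add_mul]; exact add_mem h1 h2
  have hmul : ∀ (p f : MvPolynomial (Fin n) K), f ∈ ⨆ r, Jd K v n S r →
      f * p ∈ ⨆ r, Jd K v n S r := by
    intro p
    induction p using MvPolynomial.induction_on with
    | C a =>
      intro f hf
      rw [mul_comm, MvPolynomial.C_mul']
      exact smul_mem _ _ hf
    | add p q hp hq => intro f hf; rw [mul_add]; exact add_mem (hp f hf) (hq f hf)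
    | mul_X p j hp => intro f hf; rw [← mul_assoc]; exact hX j _ (hp f hf)
  intro f hf
  rw [srIdeal, Ideal.map_span] at hf
  refine Submodule.span_induction (p := fun f _ => f ∈ ⨆ r, Jd K v n S r) ?_ (zero_mem _)
    (fun _ _ _ _ => add_mem) (fun a x _ hx => by rw [smul_eq_mul, mul_comm]; exact hmul a x hx) hf
  rintro _ ⟨_, ⟨F, hF, hFS, rfl⟩, rfl⟩
  change genLin M (faceMonomial K n F) ∈ _
  rw [genLin_faceMonomial M hF, ← hv]
  refine mem_iSup_of_mem F.card (subset_span ⟨F.toList, F.length_toList, fun j hj => ?_, ?_, ?_⟩)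
  · exact Finset.mem_Icc.1 (hF (Finset.mem_toList.1 hj))
  · rwa [Finset.toList_toFinset]
  · rw [Finset.prod_map_toList]

theorem homogeneousComponent_mem_Jd (hdown : ∀ F ∈ S, ∀ G ⊆ F, G ∈ S) (hM : IsUnit M.det)
    {f : MvPolynomial (Fin n) K} (hf : f ∈ Ideal.map (genLin M) (srIdeal K n S)) (r : ℕ) :
    MvPolynomial.homogeneousComponent r f ∈
      Jd K (colForm (symVar K n) n fun q => M q.1 q.2) n S r := by
  replace hf := map_genLin_le hdown hM f hf
  induction hf using Submodule.iSup_induction' with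
  | mem i f hf' =>
    rw [MvPolynomial.homogeneousComponent_of_mem
      (Jd_le_homogeneous (spanIcc_colForm hM) S i hf')]
    split_ifs with h
    · rwa [h]
    · exact zero_mem _
  | zero => rw [map_zero]; exact zero_mem _
  | add f g _ _ h1 h2 => rw [map_add]; exact add_mem h1 h2

theorem coeff_of_mem_Lw {u : Fin n →₀ ℕ} {w : MvPolynomial (Fin n) K}
    (hw : w ∈ Lw K (symVar K n) 0 n (lst u)) :
    ∀ v ∈ w.support, v ≠ u ∧ DegRevLexLT v u := by
  suffices h : ∀ v, ¬ (v ≠ u ∧ DegRevLexLT v u) → w.coeff v = 0 from fun v hv => by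
    by_contra hc
    exact MvPolynomial.mem_support_iff.1 hv (h v hc)
  intro v hv
  induction hw using Submodule.span_induction with
  | mem w hw =>
    obtain ⟨b, ⟨hb, hlt⟩, rfl⟩ := hw
    obtain ⟨v', rfl⟩ := exists_lst (n := n) hb.1
      fun y hy => ⟨hb.2.1 y hy, hb.2.2.1 y (by rwa [tl_zero])⟩
    rw [mp_lst, MvPolynomial.coeff_monomial, if_neg]
    rintro rfl
    have hlen := hb.2.2.2
    rw [lst_length, lst_length] at hlen
    exact hv ⟨by rintro rfl; exact lt_irrefl _ hlt, (degRevLexLT_iff hlen).2 hlt⟩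
  | zero => simp
  | add f g _ _ h1 h2 => rw [MvPolynomial.coeff_add, h1, h2, add_zero]
  | smul c f _ h => rw [MvPolynomial.coeff_smul, h, smul_zero]

theorem exists_leading_iff (hdown : ∀ F ∈ S, ∀ G ⊆ F, G ∈ S) (hM : IsUnit M.det)
    (u : Fin n →₀ ℕ) :
    (∃ f ∈ Ideal.map (genLin M) (srIdeal K n S), u ∈ f.support ∧
      ∀ v ∈ f.support, v ≠ u → DegRevLexLT v u) ↔
    Lead (Jd K (colForm (symVar K n) n fun q => M q.1 q.2) n S (u.sum fun _ e => e))
      (symVar K n) 0 n (lst u) := by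
  unfold Lead
  rw [mp_lst]
  constructor
  · rintro ⟨f, hf, hu, hlt⟩
    set r := u.sum fun _ e => e with hr
    have hg := homogeneousComponent_mem_Jd hdown hM hf r
    have hgu : (MvPolynomial.homogeneousComponent r f).coeff u = f.coeff u := by
      rw [MvPolynomial.coeff_homogeneousComponent, if_pos (show u.degree = r from rfl)]
    have hc := MvPolynomial.mem_support_iff.1 hu
    set g := MvPolynomial.homogeneousComponent r f with hgdef
    have hrest : g - MvPolynomial.monomial u (f.coeff u) ∈ Lw K (symVar K n) 0 n (lst u) := by
      have hsupp : u ∈ g.support := by rw [MvPolynomial.mem_support_iff, hgu]; exact hc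
      rw [MvPolynomial.as_sum g, ← Finset.add_sum_erase _ _ hsupp, hgu, add_sub_cancel_left]
      refine sum_mem fun v hv => ?_
      rw [Finset.mem_erase, MvPolynomial.mem_support_iff, hgdef,
        MvPolynomial.coeff_homogeneousComponent] at hv
      obtain ⟨hvu, hv⟩ := hv
      split_ifs at hv with hdeg
      · have hlt' := hlt v (MvPolynomial.mem_support_iff.2 hv) hvu
        have hm : MvPolynomial.monomial v (g.coeff v) =
            g.coeff v • mp (symVar K n) 0 (lst v) := by
          rw [mp_lst, MvPolynomial.smul_monomial, smul_eq_mul, mul_one]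
        rw [hm]
        refine smul_mem _ _ (subset_span ⟨lst v, ⟨?_, (degRevLexLT_iff hdeg).1 hlt'⟩, rfl⟩)
        rw [lst_length, ← hr, ← hdeg]
        exact lst_mem_Vn v
      · exact absurd rfl hv
    have : MvPolynomial.monomial u (1 : K) = (f.coeff u)⁻¹ • (g -
        (g - MvPolynomial.monomial u (f.coeff u))) := by
      rw [sub_sub_cancel, MvPolynomial.smul_monomial, smul_eq_mul, inv_mul_cancel₀ hc]
    rw [this]
    exact smul_mem _ _ (sub_mem (mem_sup_left hg) (mem_sup_right hrest))
  · intro h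
    obtain ⟨g, hg, w, hw, hgw⟩ := mem_sup.1 h
    have hg' : g = MvPolynomial.monomial u 1 - w := by rw [← hgw, add_sub_cancel_right]
    have hwc := coeff_of_mem_Lw hw
    have hwu : w.coeff u = 0 := by
      by_contra hne
      exact (hwc u (MvPolynomial.mem_support_iff.2 hne)).1 rfl
    refine ⟨g, Jd_le_map_genLin hdown _ g hg, ?_, fun v hv hvu => (hwc v ?_).2⟩
    · rw [MvPolynomial.mem_support_iff, hg', MvPolynomial.coeff_sub, hwu]
      simp
    · rw [MvPolynomial.mem_support_iff] at hv ⊢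
      rw [hg', MvPolynomial.coeff_sub, MvPolynomial.coeff_monomial, if_neg (Ne.symm hvu)] at hv
      intro h0
      rw [h0, sub_zero] at hv
      exact hv rfl

end Ideal

end Sym

end Squeezed

namespace Squeezed
open Submodule

theorem exists_le_of_mem_tl_sublist {s t : List ℕ} (h : t.Sublist s) :
    ∀ {q q' : ℕ}, q ≤ q' → ∀ y ∈ tl 1 q t, ∃ z ∈ tl 1 q' s, y ≤ z := by
  induction h with
  | slnil => simp [tl]
  | cons a _ ih =>
    intro q q' hq y hy
    obtain ⟨z, hz, hyz⟩ := ih (q := q) (q' := q' + 1) (by omega) y hy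
    exact ⟨z, List.mem_cons_of_mem _ hz, hyz⟩
  | cons_cons a _ ih =>
    intro q q' hq y hy
    rcases List.mem_cons.1 hy with rfl | hy
    · exact ⟨a + 1 * q', List.mem_cons_self, by omega⟩
    · obtain ⟨z, hz, hyz⟩ := ih (q := q + 1) (q' := q' + 1) (by omega) y hy
      exact ⟨z, List.mem_cons_of_mem _ hz, hyz⟩

theorem le_of_mem_Vn {n r y : ℕ} {b : List ℕ} (hb : b ∈ Vn 1 n r) (hy : y ∈ b) : y ≤ n := by
  have h : ∀ {q : ℕ} {b : List ℕ}, y ∈ b → ∃ z ∈ tl 1 q b, y ≤ z := by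
    intro q b hy
    induction b generalizing q with
    | nil => simp at hy
    | cons a b ih =>
      rcases List.mem_cons.1 hy with rfl | hy
      · exact ⟨y + 1 * q, List.mem_cons_self, by omega⟩
      · obtain ⟨z, hz, hyz⟩ := ih (q := q + 1) hy
        exact ⟨z, List.mem_cons_of_mem _ hz, hyz⟩
  obtain ⟨z, hz, hyz⟩ := h (q := 0) hy
  exact hyz.trans (hb.2.2.1 z hz)

theorem sublist_mem_Vn {n r : ℕ} {s t : List ℕ} (hs : s ∈ Vn 1 n r) (h : t.Sublist s) :
    t ∈ Vn 1 n t.length :=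
  ⟨hs.1.sublist h, fun x hx => hs.2.1 x (h.subset hx), fun y hy => by
    obtain ⟨z, hz, hyz⟩ := exists_le_of_mem_tl_sublist h le_rfl y hy
    exact hyz.trans (hs.2.2.1 z hz), rfl⟩

theorem exists_supp_eq {n : ℕ} {F : Finset ℕ} (hF : F ⊆ Finset.Icc 1 n) :
    ∃ b ∈ Vn 1 n F.card, tl 1 0 b = F.sort (· ≤ ·) ∧ supp b = F := by
  obtain ⟨b, hb, h⟩ := exists_tl (τ := 1) (Or.inr rfl) (n := n) (f := F.sort (· ≤ ·))
    ((Finset.sortedLT_sort F).pairwise.imp fun h => h) fun x hx =>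
      Finset.mem_Icc.1 (hF ((Finset.mem_sort _).1 hx))
  rw [Finset.length_sort] at hb
  exact ⟨b, hb, h, by rw [supp, h, Finset.sort_toFinset]⟩

theorem supp_subset_Icc {n r : ℕ} {b : List ℕ} (hb : b ∈ Vn 1 n r) : supp b ⊆ Finset.Icc 1 n :=
  fun y hy => Finset.mem_Icc.2
    ⟨le_of_mem_tl hb.2.1 (List.mem_toFinset.1 hy), hb.2.2.1 y (List.mem_toFinset.1 hy)⟩

section Sym

variable {n : ℕ} {K : Type*} [Field K]

/-- The monomial ideal generated by the monomials whose index list is not in `P`. -/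
noncomputable def nonstdIdeal (K : Type*) [Field K] (n : ℕ) (P : List ℕ → Prop) :
    Ideal (MvPolynomial (Fin n) K) :=
  Ideal.span ((fun u => MvPolynomial.monomial u 1) '' {u | ¬ P (lst u)})

theorem monomial_mem_nonstdIdeal {P : List ℕ → Prop} {u : Fin n →₀ ℕ} :
    MvPolynomial.monomial u (1 : K) ∈ nonstdIdeal K n P ↔ ∃ w ≤ u, ¬ P (lst w) := by
  rw [nonstdIdeal, MvPolynomial.mem_ideal_span_monomial_image]
  constructor
  · intro h
    obtain ⟨w, hw, hwu⟩ := h u (by simp)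
    exact ⟨w, hwu, hw⟩
  · rintro ⟨w, hwu, hw⟩ v hv
    rw [Finset.mem_singleton.1 (MvPolynomial.support_monomial_subset hv)]
    exact ⟨w, hw, hwu⟩

theorem initialIdeal_eq_nonstdIdeal {S : Set (Finset ℕ)} {P : List ℕ → Prop}
    (hdown : ∀ F ∈ S, ∀ G ⊆ F, G ∈ S) {M : Matrix (Fin n) (Fin n) K} (hM : IsUnit M.det)
    (hP : ∀ {r : ℕ} {b : List ℕ}, b ∈ Vn 0 n r →
      (Lead (Jd K (colForm (symVar K n) n fun q => M q.1 q.2) n S r) (symVar K n) 0 n b ↔ ¬ P b)) :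
    initialIdeal (Ideal.map (genLin M) (srIdeal K n S)) = nonstdIdeal K n P := by
  rw [initialIdeal, nonstdIdeal]
  congr 1
  ext m
  constructor
  · rintro ⟨f, hf, u, hu, rfl, h⟩
    exact ⟨u, (hP (lst_mem_Vn u)).1 ((exists_leading_iff hdown hM u).1 ⟨f, hf, hu, h⟩), rfl⟩
  · rintro ⟨u, hu, rfl⟩
    obtain ⟨f, hf, hu, h⟩ := (exists_leading_iff hdown hM u).2 ((hP (lst_mem_Vn u)).2 hu)
    exact ⟨f, hf, u, hu, rfl, h⟩

theorem eq_of_minimalMonomialGens_nonstdIdeal {d : ℕ} {S : Set (Finset ℕ)} {P : List ℕ → Prop}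
    (hS : PureShifted n d S) (hP : ∀ r, ∀ b ∈ Vn 1 n r, (P b ↔ supp b ∈ S)) :
    S = {F | F ⊆ Finset.Icc 1 n ∧
      ∀ u ∈ minimalMonomialGens (nonstdIdeal K n P), ¬ sqfreeOp u ⊆ F} := by
  ext F
  constructor
  · intro hF
    refine ⟨hS.sub F hF, fun u hu hsub => ?_⟩
    obtain ⟨w, hwu, hw⟩ := monomial_mem_nonstdIdeal.1 hu.1
    obtain rfl := hu.2 w hwu (monomial_mem_nonstdIdeal.2 ⟨w, le_rfl, hw⟩)
    rw [sqfreeOp_eq] at hsub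
    refine hw ((hP _ _ ⟨lst_pairwise w, fun y hy => (mem_lst hy).1, fun y hy => ?_, rfl⟩).2
      (hS.down F hF _ hsub))
    exact (Finset.mem_Icc.1 (hS.sub F hF (hsub (List.mem_toFinset.2 hy)))).2
  · rintro ⟨hF, hmin⟩
    by_contra hFS
    obtain ⟨b, hb, -, rfl⟩ := exists_supp_eq hF
    have hex : ∃ k, ¬ P (b.take k) := ⟨b.length, by
      rw [List.take_length]
      exact fun h => hFS ((hP _ b hb).1 h)⟩
    classical
    set k := Nat.find hex with hk
    have hkP : ¬ P (b.take k) := Nat.find_spec hex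
    have hpre : ∀ l, b.take l ∈ Vn 1 n (b.take l).length := fun l =>
      sublist_mem_Vn hb (List.take_sublist l b)
    obtain ⟨u, hu⟩ := exists_lst (n := n) (hpre k).1 fun y hy =>
      ⟨(hpre k).2.1 y hy, le_of_mem_Vn (hpre k) hy⟩
    refine hmin u ⟨monomial_mem_nonstdIdeal.2 ⟨u, le_rfl, by rwa [hu]⟩, fun v hvu hv => ?_⟩ ?_
    · obtain ⟨w, hwv, hw⟩ := monomial_mem_nonstdIdeal.1 hv
      have hsub : (lst w).Sublist (b.take k) := hu ▸ lst_sublist (hwv.trans hvu)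
      by_cases hlen : (b.take k).length ≤ (lst w).length
      · have hwu : w = u := lst_injective (by rw [hu]; exact hsub.eq_of_length_le hlen)
        exact le_antisymm hvu (hwu ▸ hwv)
      · exfalso
        push Not at hlen
        rw [List.length_take] at hlen
        have hPl : P (b.take (lst w).length) := not_not.1 (Nat.find_min hex (by omega))
        have hwV := sublist_mem_Vn (hpre k) hsub
        refine hw ((hP _ _ hwV).2 (hS.supp_mem_of_forall₂ (hpre _).1 (lst_pairwise w) ?_
          ((hP _ _ (hpre _)).1 hPl) fun y hy => hwV.2.2.1 y (List.mem_toFinset.1 hy)))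
        have := forall₂_take_of_sublist hsub (hpre k).1
        rwa [List.take_take, min_eq_left (by omega)] at this ⊢
        
    · rw [sqfreeOp_eq, hu]
      nth_rewrite 2 [← List.take_append_drop k b]
      exact supp_append_subset _ _

end Sym

end Squeezed

namespace Squeezed

theorem isSymmetricShift_bd {K : Type*} [Field K] [Infinite K] {n d M e c : ℕ} {S : Set (Finset ℕ)}
    {W : Set (List ℕ)} (hn : n = M + d) (hM : 1 ≤ M) (hd : d + 2 = 2 * e + c) (hc : c ≤ 1)
    (hW : Good 1 M e W) (hS : PureShifted n d S)
    (hstd : ∀ r, ∀ b ∈ Vn 1 n r, (StdB M e d W b ↔ supp b ∈ S)) :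
    IsSymmetricShift K n (bd d (fac n 0 '' W)) S := by
  obtain ⟨p, hp, hgen⟩ := gen_allCond (K := K) (signComm_of_comm (symVar K n)) hn hd hM hW
  refine ⟨nonstdIdeal K n (StdB M e d W), ⟨p, hp, fun Q hQ hev => ?_⟩,
    eq_of_minimalMonomialGens_nonstdIdeal hS hstd⟩
  exact initialIdeal_eq_nonstdIdeal bd_down hQ fun hb =>
    lead_iff (signComm_of_comm _) (signComm_of_comm _) (spanIcc_colForm hQ) linearIndepOn_symVar
      hc hn hd hM hW (hgen _ hev) hb

end Squeezed

namespace Squeezed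
open Submodule

/-- The generators of the exterior algebra. -/
noncomputable abbrev extVar (K : Type*) [Field K] (j : ℕ) : ExtAlg K :=
  ExteriorAlgebra.ι K (Pi.single j (1 : K))

section
variable {K : Type*} [Field K]

theorem signComm_ι (w : ℕ → ℕ → K) :
    SignComm K (fun j => (ExteriorAlgebra.ι K (w j) : ExtAlg K)) 1 where
  comm j k := mem_span_singleton.2 ⟨-1, by
    rw [neg_one_smul]
    exact (eq_neg_of_add_eq_zero_left (ExteriorAlgebra.ι_add_mul_swap (w j) (w k))).symm⟩
  sq := Or.inr ⟨rfl, fun _ => ExteriorAlgebra.ι_sq_zero _⟩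

theorem eMon_eq (F : Finset ℕ) : eMon K F = ((F.sort (· ≤ ·)).map (extVar K)).prod := rfl

theorem extCoeff_prod_ι (F : Finset ℕ) {r : ℕ} (w : Fin r → ℕ → K) :
    extCoeff K F (List.ofFn fun i => ExteriorAlgebra.ι K (w i)).prod =
      if h : r = F.card then
        Matrix.det (Matrix.of fun i j : Fin F.card => w (finCongr h.symm i) (F.orderIsoOfFin rfl j))
      else 0 := by
  rw [← ExteriorAlgebra.ιMulti_apply, extCoeff, ExteriorAlgebra.liftAlternating_apply_ιMulti]
  split_ifs with h
  · rfl
  · rfl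

theorem extCoeff_eMon_self (F : Finset ℕ) : extCoeff K F (eMon K F) = 1 := by
  have h := extCoeff_prod_ι F
    (fun i : Fin F.card => Pi.single ((F.orderIsoOfFin rfl i : F) : ℕ) (1 : K))
  rw [dif_pos rfl] at h
  have h1 : eMon K F = (List.ofFn fun i : Fin F.card =>
      extVar K ((F.orderIsoOfFin rfl i : F) : ℕ)).prod := by
    rw [eMon_eq]
    congr 1
    apply List.ext_getElem
    · simp
    · intro i h1 h2
      simp [Finset.orderEmbOfFin_apply]
  rw [h1, h, ← Matrix.det_one (n := Fin F.card) (R := K)]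
  congr 1
  ext i j
  simp [Matrix.one_apply, Pi.single_apply, eq_comm]

theorem eq_toFinset_of_extCoeff_ne {F : Finset ℕ} {l : List ℕ}
    (h : extCoeff K F (l.map (extVar K)).prod ≠ 0) : F = l.toFinset ∧ l.Nodup := by
  have h1 : l.map (extVar K) =
      List.ofFn fun i : Fin l.length => ExteriorAlgebra.ι K (Pi.single (l.get i) (1 : K)) := by
    apply List.ext_getElem <;> simp
  rw [h1, extCoeff_prod_ι] at h
  split_ifs at h with hl
  · have hF : F ⊆ l.toFinset := by
      intro k hk
      by_contra hkl
      apply h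
      refine Matrix.det_eq_zero_of_column_eq_zero ((F.orderIsoOfFin rfl).symm ⟨k, hk⟩) fun i => ?_
      rw [Matrix.of_apply, OrderIso.apply_symm_apply, Pi.single_apply, if_neg]
      rintro rfl
      exact hkl (List.mem_toFinset.2 (List.get_mem _ _))
    have hle := l.toFinset_card_le
    have hE := Finset.eq_of_subset_of_card_le hF (by omega)
    refine ⟨hE, ?_⟩
    rw [← Multiset.coe_nodup, ← Multiset.dedup_card_eq_card_iff_nodup]
    rw [hE] at hl
    exact hl.symm
  · exact absurd rfl h

theorem extCoeff_eMon_of_ne {F G : Finset ℕ} (h : F ≠ G) : extCoeff K F (eMon K G) = 0 := by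
  by_contra h'
  exact h ((eq_toFinset_of_extCoeff_ne h').1.trans (Finset.sort_toFinset G (· ≤ ·)))

theorem eMon_mem_span {l : List ℕ} (hl : l.Nodup) : eMon K l.toFinset ∈ K ∙ (l.map (extVar K)).prod := by
  refine (signComm_ι fun j => Pi.single j 1).prod_perm ?_
  exact (List.perm_of_nodup_nodup_toFinset_eq (Finset.sort_nodup _ _) hl
    (Finset.sort_toFinset _ (· ≤ ·)))

theorem extCoeff_ne_zero {l : List ℕ} (hl : l.Nodup) :
    extCoeff K l.toFinset (l.map (extVar K)).prod ≠ 0 := by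
  obtain ⟨c, hc⟩ := mem_span_singleton.1 (eMon_mem_span (K := K) hl)
  intro h0
  have := extCoeff_eMon_self (K := K) l.toFinset
  rw [← hc, map_smul, h0, smul_zero] at this
  exact zero_ne_one this

theorem SignComm.prod_mem_span_sort {A : Type*} [Ring A] [Algebra K A] {x : ℕ → A}
    (hx : SignComm K x 1) (l : List ℕ) :
    (l.map x).prod ∈ K ∙ ((l.toFinset.sort (· ≤ ·)).map x).prod := by
  by_cases hl : l.Nodup
  · exact hx.prod_perm (List.perm_of_nodup_nodup_toFinset_eq hl (Finset.sort_nodup _ _)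
      (Finset.sort_toFinset _ (· ≤ ·)).symm)
  · obtain ⟨a, ha⟩ := List.exists_duplicate_iff_not_nodup.2 hl
    obtain ⟨l', hl'⟩ := (List.duplicate_iff_sublist.1 ha).exists_perm_append
    have h0 : (([a, a] ++ l').map x).prod = 0 := by
      simp [← mul_assoc, (hx.sq.resolve_left one_ne_zero).2 a]
    have h1 := hx.prod_perm hl'
    rw [h0, span_zero_singleton, mem_bot] at h1
    rw [h1]
    exact zero_mem _

theorem prod_mem_span_eMon (l : List ℕ) :
    (l.map (extVar K)).prod ∈ K ∙ eMon K l.toFinset :=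
  (signComm_ι fun j => Pi.single j 1).prod_mem_span_sort l

end
end Squeezed

namespace Squeezed
open Submodule

/-- Restriction of vectors to the coordinates in `X`. -/
def restr (K : Type*) [Field K] (X : Finset ℕ) : (ℕ → K) →ₗ[K] (ℕ → K) where
  toFun m k := if k ∈ X then m k else 0
  map_add' m m' := by ext k; by_cases h : k ∈ X <;> simp [h]
  map_smul' c m := by ext k; by_cases h : k ∈ X <;> simp [h]

/-- The projection of the exterior algebra to the variables in `X`. -/
noncomputable def extProj (K : Type*) [Field K] (X : Finset ℕ) : ExtAlg K →ₐ[K] ExtAlg K :=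
  ExteriorAlgebra.map (restr K X)

/-- Combinations of products of a monomial in the variables of `X` outside `Icc 1 n` with an element
of a `Jd`. -/
def extN {K : Type*} [Field K] (v : ℕ → ExtAlg K) (n : ℕ) (S : Set (Finset ℕ)) (X : Finset ℕ) :
    Submodule K (ExtAlg K) :=
  span K {y | ∃ t : List ℕ, (∀ j ∈ t, j ∈ X ∧ j ∉ Finset.Icc 1 n) ∧ ∃ r, ∃ g ∈ Jd K v n S r,
    y = (t.map (extVar K)).prod * g}

variable {K : Type*} [Field K] {v : ℕ → ExtAlg K} {n : ℕ} {S : Set (Finset ℕ)} {X : Finset ℕ}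

theorem restr_eq_sum (m : ℕ → K) : restr K X m = ∑ i ∈ X, m i • Pi.single i (1 : K) := by
  ext k
  simp [restr, Finset.sum_apply, Pi.single_apply]

theorem extProj_ι (m : ℕ → K) :
    extProj K X (ExteriorAlgebra.ι K m) = ∑ i ∈ X, m i • extVar K i := by
  rw [extProj, ExteriorAlgebra.map_apply_ι, restr_eq_sum, map_sum]
  simp

theorem extProj_extVar {j : ℕ} (hj : j ∈ X) : extProj K X (extVar K j) = extVar K j := by
  rw [extProj_ι, Finset.sum_eq_single j] <;> simp +contextual [hj]

theorem extCoeff_extProj {F : Finset ℕ} (hF : F ⊆ X) (y : ExtAlg K) :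
    extCoeff K F (extProj K X y) = extCoeff K F y := by
  suffices h : (extCoeff K F).comp (extProj K X).toLinearMap = extCoeff K F from
    LinearMap.congr_fun h y
  refine ExteriorAlgebra.lhom_ext fun r => ?_
  ext w
  change extCoeff K F (ExteriorAlgebra.map (restr K X) (ExteriorAlgebra.ιMulti K r w)) =
    extCoeff K F (ExteriorAlgebra.ιMulti K r w)
  rw [ExteriorAlgebra.map_apply_ιMulti, ExteriorAlgebra.ιMulti_apply, ExteriorAlgebra.ιMulti_apply]
  simp only [Function.comp_apply]
  rw [extCoeff_prod_ι, extCoeff_prod_ι]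
  split_ifs with h
  · congr 1
    ext i j
    simp only [Matrix.of_apply]
    exact if_pos (hF (F.orderIsoOfFin rfl j).2)
  · rfl

theorem spanIcc_mul_Jd_le {A : Type*} [Ring A] [Algebra K A] {v : ℕ → A}
    (hS : ∀ F ∈ S, ∀ G ⊆ F, G ∈ S) (r : ℕ) :
    spanIcc K v 1 n * Jd K v n S r ≤ Jd K v n S (r + 1) := by
  rw [Jd, spanIcc, spanOn, span_mul_span, span_le]
  rintro _ ⟨_, ⟨j, hj, rfl⟩, _, ⟨l, h1, h2, h3, rfl⟩, rfl⟩
  refine subset_span ⟨j :: l, by simp [h1], fun y hy => ?_, fun h => h3 (hS _ h _ ?_), by simp⟩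
  · rcases List.mem_cons.1 hy with rfl | h
    · exact hj
    · exact h2 y h
  · intro y hy
    simp only [List.mem_toFinset, List.mem_cons] at hy ⊢
    exact .inr hy

theorem extVar_mul_mem_extN (hS : ∀ F ∈ S, ∀ G ⊆ F, G ∈ S)
    (hspan : spanIcc K v 1 n = spanIcc K (extVar K) 1 n) {i : ℕ} (hi : i ∈ X) {z : ExtAlg K}
    (hz : z ∈ extN v n S X) : extVar K i * z ∈ extN v n S X := by
  suffices h : extN v n S X ≤ (extN v n S X).comap (LinearMap.mulLeft K (extVar K i)) from h hz
  rw [extN, span_le]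
  rintro _ ⟨t, ht, r, g, hg, rfl⟩
  change extVar K i * ((t.map (extVar K)).prod * g) ∈ extN v n S X
  by_cases hin : i ∈ Finset.Icc 1 n
  · have h1 := (signComm_ι fun j => (Pi.single j 1 : ℕ → K)).prod_perm
      (l := i :: t) (l' := t ++ [i]) (List.perm_append_singleton i t).symm
    obtain ⟨c, hc⟩ := mem_span_singleton.1 h1
    have h2 : extVar K i * ((t.map (extVar K)).prod * g) =
        c • ((t.map (extVar K)).prod * (extVar K i * g)) := by
      simp only [List.map_cons, List.map_append, List.prod_cons, List.prod_append, List.map_nil,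
        List.prod_nil, mul_one] at hc
      rw [← mul_assoc, ← mul_assoc, ← smul_mul_assoc, hc]
    rw [h2]
    refine smul_mem _ _ (subset_span ⟨t, ht, r + 1, _, spanIcc_mul_Jd_le hS r
      (mul_mem_mul ?_ hg), rfl⟩)
    rw [hspan]
    exact mem_spanOn (by simpa using hin)
  · refine subset_span ⟨i :: t, fun j hj => ?_, r, g, hg, by simp [mul_assoc]⟩
    rcases List.mem_cons.1 hj with rfl | hj
    exacts [⟨hi, hin⟩, ht j hj]

theorem extProj_mul_mem_extN (hS : ∀ F ∈ S, ∀ G ⊆ F, G ∈ S)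
    (hspan : spanIcc K v 1 n = spanIcc K (extVar K) 1 n) (a : ExtAlg K) :
    ∀ z ∈ extN v n S X, extProj K X a * z ∈ extN v n S X := by
  induction a using ExteriorAlgebra.induction with
  | algebraMap c =>
    intro z hz
    rw [AlgHom.commutes, ← Algebra.smul_def]
    exact smul_mem _ _ hz
  | ι m =>
    intro z hz
    rw [extProj_ι, Finset.sum_mul]
    refine sum_mem fun i hi => ?_
    rw [smul_mul_assoc]
    exact smul_mem _ _ (extVar_mul_mem_extN hS hspan hi hz)
  | mul a b iha ihb =>
    intro z hz
    rw [map_mul, mul_assoc]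
    exact iha _ (ihb _ hz)
  | add a b iha ihb =>
    intro z hz
    rw [map_add, add_mul]
    exact add_mem (iha _ hz) (ihb _ hz)

theorem map_eMon {φ : ExtAlg K →ₐ[K] ExtAlg K} (hφ : ∀ j ∈ Finset.Icc 1 n, φ (extVar K j) = v j)
    {F : Finset ℕ} (hF : F ⊆ Finset.Icc 1 n) :
    φ (eMon K F) = ((F.sort (· ≤ ·)).map v).prod := by
  rw [eMon_eq, map_list_prod, List.map_map]
  congr 1
  exact List.map_congr_left fun j hj => hφ j (hF ((Finset.mem_sort _).1 hj))

theorem extProj_mem_extN {φ : ExtAlg K →ₐ[K] ExtAlg K}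
    (hφ : ∀ j ∈ Finset.Icc 1 n, φ (extVar K j) = v j) (hS : ∀ F ∈ S, ∀ G ⊆ F, G ∈ S)
    (hspan : spanIcc K v 1 n = spanIcc K (extVar K) 1 n) (hX : Finset.Icc 1 n ⊆ X) {y : ExtAlg K}
    (hy : y ∈ Ideal.map φ (extFaceIdeal K (Finset.Icc 1 n) S)) :
    extProj K X y ∈ extN v n S X := by
  rw [extFaceIdeal, Ideal.map_span] at hy
  induction hy using span_induction with
  | mem y hy =>
    obtain ⟨_, ⟨F, hF, hFS, rfl⟩, rfl⟩ := hy
    have hv : ∀ j ∈ Finset.Icc 1 n, extProj K X (v j) = v j := by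
      intro j hj
      have h1 : v j ∈ spanIcc K (extVar K) 1 n := by
        rw [← hspan]
        exact mem_spanOn (by simpa using hj)
      suffices h : spanIcc K (extVar K) 1 n ≤
          LinearMap.eqLocus (extProj K X).toLinearMap LinearMap.id from h h1
      rw [spanIcc, spanOn, span_le]
      rintro _ ⟨i, hi, rfl⟩
      exact extProj_extVar (hX (by simpa using hi))
    change extProj K X (φ (eMon K F)) ∈ extN v n S X
    rw [map_eMon hφ hF, map_list_prod, List.map_map]
    have h2 : (F.sort (· ≤ ·)).map (extProj K X ∘ v) = (F.sort (· ≤ ·)).map v :=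
      List.map_congr_left fun j hj => hv j (hF ((Finset.mem_sort _).1 hj))
    rw [h2]
    refine subset_span ⟨[], by simp, F.card, _, subset_span ⟨F.sort (· ≤ ·),
      Finset.length_sort _, fun j hj => ?_, ?_, rfl⟩, by simp⟩
    · exact Finset.mem_Icc.1 (hF ((Finset.mem_sort _).1 hj))
    · rwa [Finset.sort_toFinset]
  | zero => rw [map_zero]; exact zero_mem _
  | add y z _ _ hy hz => rw [map_add]; exact add_mem hy hz
  | smul a y _ hy => rw [smul_eq_mul, map_mul]; exact extProj_mul_mem_extN hS hspan a _ hy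

end Squeezed

namespace Squeezed
open Submodule

variable {K : Type*} [Field K] {v : ℕ → ExtAlg K} {n : ℕ} {S : Set (Finset ℕ)} {X : Finset ℕ}

theorem extCoeff_eq_zero_of_card {r : ℕ} {y : ExtAlg K} (hy : y ∈ spanIcc K (extVar K) 1 n ^ r)
    {G : Finset ℕ} (hG : G.card ≠ r) : extCoeff K G y = 0 := by
  suffices h : spanIcc K (extVar K) 1 n ^ r ≤ LinearMap.ker (extCoeff K G) from h hy
  rw [pow_eq_span, span_le]
  rintro _ ⟨l, h1, -, rfl⟩
  by_contra h
  obtain ⟨rfl, h3⟩ := eq_toFinset_of_extCoeff_ne h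
  exact hG ((List.toFinset_card_of_nodup h3).trans h1)

theorem extCoeff_eMon_mul {r : ℕ} {y : ExtAlg K} (hy : y ∈ spanIcc K (extVar K) 1 n ^ r)
    {G T : Finset ℕ} (hG : G ⊆ Finset.Icc 1 n) (hT : Disjoint T (Finset.Icc 1 n)) :
    extCoeff K (G ∪ T) (eMon K T * y) =
      extCoeff K (G ∪ T) (eMon K T * eMon K G) * extCoeff K G y := by
  suffices h : spanIcc K (extVar K) 1 n ^ r ≤ LinearMap.eqLocus
      ((extCoeff K (G ∪ T)).comp (LinearMap.mulLeft K (eMon K T)))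
      (extCoeff K (G ∪ T) (eMon K T * eMon K G) • extCoeff K G) from h hy
  rw [pow_eq_span, span_le]
  rintro _ ⟨l, h1, h2, rfl⟩
  change extCoeff K (G ∪ T) (eMon K T * _) = _ * extCoeff K G _
  by_cases hl : l.toFinset = G
  · obtain ⟨c, hc⟩ := mem_span_singleton.1 (prod_mem_span_eMon (K := K) l)
    rw [← hc, hl, mul_smul_comm, map_smul, map_smul, extCoeff_eMon_self, smul_eq_mul, smul_eq_mul,
      mul_one, mul_comm]
  · have hR : extCoeff K G (l.map (extVar K)).prod = 0 := by
      by_contra h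
      exact hl (eq_toFinset_of_extCoeff_ne h).1.symm
    rw [hR, mul_zero]
    by_contra h
    rw [eMon_eq, ← List.prod_append, ← List.map_append] at h
    have h3 := (eq_toFinset_of_extCoeff_ne h).1
    rw [List.toFinset_append, Finset.sort_toFinset] at h3
    apply hl
    have hl' : ∀ j ∈ l.toFinset, j ∈ Finset.Icc 1 n := fun j hj =>
      Finset.mem_Icc.2 (h2 j (List.mem_toFinset.1 hj))
    rw [Finset.disjoint_left] at hT
    ext j
    have h4 := Finset.ext_iff.1 h3 j
    simp only [Finset.mem_union] at h4
    constructor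
    · intro hj
      exact (h4.2 (.inr hj)).resolve_right fun h5 => hT h5 (hl' j hj)
    · intro hj
      exact (h4.1 (.inl hj)).resolve_left fun h5 => hT h5 (hG hj)

theorem extCoeff_eMon_mul_eMon_ne_zero {G T : Finset ℕ} (h : Disjoint T G) :
    extCoeff K (G ∪ T) (eMon K T * eMon K G) ≠ 0 := by
  rw [eMon_eq, eMon_eq, ← List.prod_append, ← List.map_append]
  have h1 : G ∪ T = (T.sort (· ≤ ·) ++ G.sort (· ≤ ·)).toFinset := by
    rw [List.toFinset_append, Finset.sort_toFinset, Finset.sort_toFinset, Finset.union_comm]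
  rw [h1]
  refine extCoeff_ne_zero ?_
  rw [List.nodup_append']
  refine ⟨Finset.sort_nodup _ _, Finset.sort_nodup _ _, fun j hj hj' => ?_⟩
  exact Finset.disjoint_left.1 h ((Finset.mem_sort _).1 hj) ((Finset.mem_sort _).1 hj')

theorem exists_coeff_of_mem_extN (hv : spanIcc K v 1 n = spanIcc K (extVar K) 1 n)
    {T : Finset ℕ} (hT : Disjoint T (Finset.Icc 1 n)) (r : ℕ) {z : ExtAlg K}
    (hz : z ∈ extN v n S X) :
    ∃ h ∈ Jd K v n S r, ∀ G ⊆ Finset.Icc 1 n, G.card = r →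
      extCoeff K (G ∪ T) z =
        extCoeff K (G ∪ T) (eMon K T * eMon K G) * extCoeff K G h := by
  induction hz using span_induction with
  | mem z hz =>
    obtain ⟨t, ht, r', g, hg, rfl⟩ := hz
    have hg' : g ∈ spanIcc K (extVar K) 1 n ^ r' := hv ▸ Jd_le_pow _ _ _ hg
    by_cases htT : t.toFinset = T
    · obtain ⟨c, hc⟩ := mem_span_singleton.1 (prod_mem_span_eMon (K := K) t)
      rw [htT] at hc
      rw [← hc]
      have hkey : ∀ G ⊆ Finset.Icc 1 n, extCoeff K (G ∪ T) (c • eMon K T * g) =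
          extCoeff K (G ∪ T) (eMon K T * eMon K G) * extCoeff K G (c • g) := by
        intro G hG
        rw [smul_mul_assoc, map_smul, map_smul, extCoeff_eMon_mul hg' hG hT, smul_eq_mul,
          smul_eq_mul, mul_left_comm]
      by_cases hr : r' = r
      · subst hr
        exact ⟨c • g, smul_mem _ _ hg, fun G hG _ => hkey G hG⟩
      · refine ⟨0, zero_mem _, fun G hG hGr => ?_⟩
        rw [hkey G hG, map_smul, extCoeff_eq_zero_of_card hg' (by omega), map_zero, smul_zero]
    · refine ⟨0, zero_mem _, fun G hG _ => ?_⟩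
      rw [map_zero, mul_zero]
      suffices h : spanIcc K (extVar K) 1 n ^ r' ≤ LinearMap.ker
        ((extCoeff K (G ∪ T)).comp (LinearMap.mulLeft K (t.map (extVar K)).prod)) from h hg'
      rw [pow_eq_span, span_le]
      rintro _ ⟨l, h1, h2, rfl⟩
      change extCoeff K (G ∪ T) ((t.map (extVar K)).prod * (l.map (extVar K)).prod) = 0
      by_contra h
      rw [← List.prod_append, ← List.map_append] at h
      have h3 := (eq_toFinset_of_extCoeff_ne h).1
      rw [List.toFinset_append] at h3
      apply htT
      rw [Finset.disjoint_left] at hT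
      ext j
      have h4 := Finset.ext_iff.1 h3 j
      simp only [Finset.mem_union, List.mem_toFinset] at h4 ⊢
      constructor
      · intro hj
        exact (h4.2 (.inl hj)).resolve_left fun h5 => (ht j hj).2 (hG h5)
      · intro hj
        exact (h4.1 (.inr hj)).resolve_right fun h5 => hT hj (Finset.mem_Icc.2 (h2 j h5))
  | zero => exact ⟨0, zero_mem _, fun G _ _ => by simp⟩
  | add y z _ _ hy hz =>
    obtain ⟨h1, h1m, h1e⟩ := hy
    obtain ⟨h2, h2m, h2e⟩ := hz
    exact ⟨h1 + h2, add_mem h1m h2m, fun G hG hr => by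
      rw [map_add, map_add, h1e G hG hr, h2e G hG hr, mul_add]⟩
  | smul a y _ hy =>
    obtain ⟨h1, h1m, h1e⟩ := hy
    exact ⟨a • h1, smul_mem _ _ h1m, fun G hG hr => by
      rw [map_smul, map_smul, h1e G hG hr, smul_eq_mul, smul_eq_mul, mul_left_comm]⟩

end Squeezed

namespace Squeezed
open Submodule

theorem reverse_tl_lt {τ : ℕ} {a b : List ℕ} (h : a.length = b.length) :
    (tl τ 0 a).reverse < (tl τ 0 b).reverse ↔ a.reverse < b.reverse := by
  induction a using List.reverseRecOn generalizing b with
  | nil => rw [List.length_eq_zero_iff.1 h.symm]; simp [tl]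
  | append_singleton a c ih =>
    obtain rfl | ⟨b, c', rfl⟩ := b.eq_nil_or_concat'
    · simp at h
    · have h' : a.length = b.length := by simpa using h
      rw [tl_snoc, tl_snoc, reverse_snoc_lt, reverse_snoc_lt, ih h', h']
      simp

theorem sort_supp {b : List ℕ} (hb : b.Pairwise (· ≤ ·)) :
    (supp b).sort (· ≤ ·) = tl 1 0 b := by
  have h1 := tl_pairwise (τ := 1) (q := 0) hb
  have h2 : (tl 1 0 b).Nodup := h1.imp fun h => by omega
  refine List.Perm.eq_of_pairwise' (r := (· ≤ ·)) (Finset.pairwise_sort _ _)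
    (h1.imp fun h => by omega) ?_
  exact List.perm_of_nodup_nodup_toFinset_eq (Finset.sort_nodup _ _) h2
    (Finset.sort_toFinset _ (· ≤ ·))

theorem revLexLT_supp_iff {n r : ℕ} {b b' : List ℕ} (hb : b ∈ Vn 1 n r) (hb' : b' ∈ Vn 1 n r) :
    RevLexLT (supp b') (supp b) ↔ b.reverse < b'.reverse := by
  have hnd : ∀ {b : List ℕ}, b ∈ Vn 1 n r → (tl 1 0 b).Nodup := fun hb =>
    (tl_pairwise (τ := 1) (q := 0) hb.1).imp fun h => by omega
  have hle : ∀ {b : List ℕ}, b ∈ Vn 1 n r → (tl 1 0 b).Pairwise (· ≤ ·) := fun hb =>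
    (tl_pairwise (τ := 1) (q := 0) hb.1).imp fun h => by omega
  have hcard : (supp b').card = (supp b).card := by
    rw [card_supp hb.1, card_supp hb'.1, hb.2.2.2, hb'.2.2.2]
  rw [← reverse_tl_lt (τ := 1) (hb.2.2.2.trans hb'.2.2.2.symm),
    reverse_lt_iff_count (hle hb) (hle hb'), RevLexLT]
  simp only [hcard, lt_irrefl, false_or, true_and]
  simp only [supp, List.mem_toFinset]
  refine exists_congr fun k => ?_
  have hc : ∀ {b : List ℕ}, b ∈ Vn 1 n r → ∀ k, (tl 1 0 b).count k = if k ∈ tl 1 0 b then 1 else 0 :=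
    fun hb k => List.Nodup.count (hnd hb)
  rw [hc hb, hc hb', ← and_assoc]
  refine and_congr (by split_ifs <;> simp_all) (forall₂_congr fun l _ => ?_)
  rw [hc hb, hc hb']
  split_ifs <;> simp_all

variable {K : Type*} [Field K] {v : ℕ → ExtAlg K} {n : ℕ} {S : Set (Finset ℕ)}

theorem mp_extVar {b : List ℕ} (hb : b.Pairwise (· ≤ ·)) : mp (extVar K) 1 b = eMon K (supp b) := by
  rw [eMon_eq, sort_supp hb, mp]

theorem supp_injOn {n r : ℕ} : Set.InjOn supp (Vn 1 n r) := fun b hb b' hb' h => by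
  apply tl_injective (τ := 1) (q := 0)
  rw [← sort_supp hb.1, ← sort_supp hb'.1, h]

theorem extCoeff_supp_mp {r : ℕ} {b b' : List ℕ} (hb : b ∈ Vn 1 n r) (hb' : b' ∈ Vn 1 n r) :
    extCoeff K (supp b) (mp (extVar K) 1 b') = if b' = b then 1 else 0 := by
  rw [mp_extVar hb'.1]
  split_ifs with h
  · rw [h, extCoeff_eMon_self]
  · exact extCoeff_eMon_of_ne fun h' => h (supp_injOn hb' hb h'.symm)

theorem linearIndepOn_mp_extVar (r : ℕ) : LinearIndepOn K (mp (extVar K) 1) (Vn 1 n r) := by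
  refine linearIndependent_iff'.2 fun s g hg i hi => ?_
  have h := congrArg (extCoeff K (supp i)) hg
  rw [map_sum, map_zero, Finset.sum_eq_single i] at h
  · rwa [map_smul, extCoeff_supp_mp i.2 i.2, if_pos rfl, smul_eq_mul, mul_one] at h
  · intro j _ hji
    rw [map_smul, extCoeff_supp_mp i.2 j.2, if_neg fun h' => hji (Subtype.ext h'), smul_zero]
  · exact fun h' => absurd hi h'

theorem eq_sum_extCoeff {r : ℕ} {y : ExtAlg K} (hy : y ∈ spanIcc K (extVar K) 1 n ^ r) :
    y = ∑ b ∈ (Vn_finite 1 n r).toFinset, extCoeff K (supp b) y • mp (extVar K) 1 b := by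
  have h1 := (signComm_ι fun j => (Pi.single j 1 : ℕ → K)).pow_le_span_mp n r hy
  clear hy
  induction h1 using span_induction with
  | mem y hy =>
    obtain ⟨b, hb, rfl⟩ := hy
    rw [Finset.sum_eq_single b]
    · rw [extCoeff_supp_mp hb hb]
      rw [if_pos rfl, one_smul]
    · intro b' hb' hne
      rw [extCoeff_supp_mp ((Vn_finite 1 n r).mem_toFinset.1 hb') hb]
      rw [if_neg hne.symm, zero_smul]
    · exact fun h => absurd ((Vn_finite 1 n r).mem_toFinset.2 hb) h
  | zero => simp
  | add y z _ _ hy hz =>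
    simp only [map_add, add_smul, Finset.sum_add_distrib]
    rw [← hy, ← hz]
  | smul a y _ hy =>
    simp only [map_smul, smul_assoc, ← Finset.smul_sum]
    rw [← hy]

theorem revLexLT_of_extCoeff_ne {r : ℕ} {b : List ℕ} (hb : b ∈ Vn 1 n r) {w : ExtAlg K}
    (hw : w ∈ Lw K (extVar K) 1 n b) {G : Finset ℕ} (hG : extCoeff K G w ≠ 0) :
    RevLexLT G (supp b) := by
  by_contra hn
  apply hG
  suffices h : Lw K (extVar K) 1 n b ≤ LinearMap.ker (extCoeff K G) from h hw
  rw [Lw, span_le]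
  rintro _ ⟨b', ⟨hb', hlt⟩, rfl⟩
  change extCoeff K G _ = 0
  rw [hb.2.2.2] at hb'
  rw [mp_extVar hb'.1]
  refine extCoeff_eMon_of_ne ?_
  rintro rfl
  exact hn ((revLexLT_supp_iff hb hb').2 hlt)

theorem lead_of_extCoeff {r : ℕ} {b : List ℕ} (hb : b ∈ Vn 1 n r)
    (hspan : spanIcc K v 1 n = spanIcc K (extVar K) 1 n) {y : ExtAlg K} (hy : y ∈ Jd K v n S r)
    (h0 : extCoeff K (supp b) y ≠ 0)
    (h : ∀ b' ∈ Vn 1 n r, extCoeff K (supp b') y ≠ 0 → b' ≠ b → b.reverse < b'.reverse) :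
    Lead (Jd K v n S r) (extVar K) 1 n b := by
  have hy' : y ∈ spanIcc K (extVar K) 1 n ^ r := hspan ▸ Jd_le_pow _ _ _ hy
  have h1 := eq_sum_extCoeff hy'
  rw [← Finset.add_sum_erase _ _ ((Vn_finite 1 n r).mem_toFinset.2 hb)] at h1
  have h2 : extCoeff K (supp b) y • mp (extVar K) 1 b ∈ Jd K v n S r ⊔ Lw K (extVar K) 1 n b := by
    rw [← sub_eq_iff_eq_add] at h1
    rw [← h1]
    refine sub_mem (mem_sup_left hy) (mem_sup_right (sum_mem fun b' hb' => ?_))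
    obtain ⟨hne, hb'⟩ := Finset.mem_erase.1 hb'
    rw [Set.Finite.mem_toFinset] at hb'
    by_cases h3 : extCoeff K (supp b') y = 0
    · rw [h3, zero_smul]
      exact zero_mem _
    · exact smul_mem _ _ (subset_span ⟨b', ⟨hb.2.2.2.symm ▸ hb', h b' hb' h3 hne⟩, rfl⟩)
  exact (smul_mem_iff _ h0).1 h2

end Squeezed

namespace Squeezed
open Submodule

theorem revLexLT_of_union {F G T : Finset ℕ} (hF : Disjoint F T) (hG : Disjoint G T)
    (hcard : F.card = G.card) (h : RevLexLT (F ∪ T) (G ∪ T)) : RevLexLT F G := by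
  rcases h with h | ⟨-, k, hk, hk', hl⟩
  · rw [Finset.card_union_of_disjoint hF, Finset.card_union_of_disjoint hG] at h
    omega
  · rw [Finset.disjoint_left] at hF hG
    simp only [Finset.mem_union, not_or] at hk hk' hl
    refine .inr ⟨hcard, k, hk.resolve_right hk'.2, hk'.1, fun l hkl => ?_⟩
    have h1 := hl l hkl
    exact ⟨fun h => (h1.1 (.inl h)).resolve_right (hF h),
      fun h => (h1.2 (.inl h)).resolve_right (hG h)⟩

variable {K : Type*} [Field K] {v : ℕ → ExtAlg K} {n : ℕ} {S Sgm : Set (Finset ℕ)}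
  {φ : ExtAlg K →ₐ[K] ExtAlg K}

theorem _root_.Ideal.mem_of_mem_span_singleton {A : Type*} [Ring A] [Algebra K A] {I : Ideal A}
    {x y : A} (hx : x ∈ I) (hy : y ∈ K ∙ x) : y ∈ I := by
  obtain ⟨c, rfl⟩ := mem_span_singleton.1 hy
  rw [Algebra.smul_def]
  exact I.mul_mem_left _ hx

theorem Jd_le_map (hv : SignComm K v 1) (hφ : ∀ j ∈ Finset.Icc 1 n, φ (extVar K j) = v j) (r : ℕ) :
    Jd K v n S r ≤
      (Ideal.map φ (extFaceIdeal K (Finset.Icc 1 n) S)).restrictScalars K := by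
  rw [Jd, span_le]
  rintro _ ⟨l, -, h2, h3, rfl⟩
  refine Ideal.mem_of_mem_span_singleton (K := K) ?_ (hv.prod_mem_span_sort l)
  have hl : l.toFinset ⊆ Finset.Icc 1 n := fun j hj =>
    Finset.mem_Icc.2 (h2 j (List.mem_toFinset.1 hj))
  rw [← map_eMon hφ hl]
  exact Ideal.mem_map_of_mem _ (Ideal.subset_span ⟨_, hl, h3, rfl⟩)

theorem eMon_mem_extFaceIdeal {V F : Finset ℕ} (h : F ∩ V ∉ Sgm) :
    eMon K F ∈ extFaceIdeal K V Sgm := by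
  have h1 : eMon K (F \ V) * eMon K (F ∩ V) ∈ extFaceIdeal K V Sgm :=
    Ideal.mul_mem_left _ _ (Ideal.subset_span ⟨_, Finset.inter_subset_right, h, rfl⟩)
  refine Ideal.mem_of_mem_span_singleton (K := K) h1 ?_
  rw [eMon_eq (F \ V), eMon_eq (F ∩ V), ← List.prod_append, ← List.map_append]
  have h2 : ((F \ V).sort (· ≤ ·) ++ (F ∩ V).sort (· ≤ ·)).toFinset = F := by
    rw [List.toFinset_append, Finset.sort_toFinset, Finset.sort_toFinset,
      Finset.sdiff_union_inter]
  have h3 := eMon_mem_span (K := K) (l := (F \ V).sort (· ≤ ·) ++ (F ∩ V).sort (· ≤ ·)) ?_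
  · rwa [h2] at h3
  · rw [List.nodup_append']
    refine ⟨Finset.sort_nodup _ _, Finset.sort_nodup _ _, fun j hj hj' => ?_⟩
    exact Finset.disjoint_left.1 (Finset.disjoint_sdiff_inter F V) ((Finset.mem_sort _).1 hj)
      ((Finset.mem_sort _).1 hj')

theorem lead_of_mem_map (hφ : ∀ j ∈ Finset.Icc 1 n, φ (extVar K j) = v j)
    (hspan : spanIcc K v 1 n = spanIcc K (extVar K) 1 n) (hS : ∀ F ∈ S, ∀ G ⊆ F, G ∈ S)
    {y : ExtAlg K} (hy : y ∈ Ideal.map φ (extFaceIdeal K (Finset.Icc 1 n) S)) {F : Finset ℕ}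
    (hF : extCoeff K F y ≠ 0) (hlt : ∀ G, extCoeff K G y ≠ 0 → G ≠ F → RevLexLT G F) :
    ∃ r, ∃ b ∈ Vn 1 n r, supp b = F ∩ Finset.Icc 1 n ∧
      Lead (Jd K v n S r) (extVar K) 1 n b := by
  obtain ⟨b, hb, -, hbF⟩ := exists_supp_eq (Finset.inter_subset_right (s₁ := F) (s₂ := Finset.Icc 1 n))
  refine ⟨_, b, hb, hbF, ?_⟩
  set r := (F ∩ Finset.Icc 1 n).card with hr
  set T := F \ Finset.Icc 1 n with hT
  have hdT : Disjoint T (Finset.Icc 1 n) := Finset.sdiff_disjoint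
  have hFT : F ∩ Finset.Icc 1 n ∪ T = F := by
    rw [Finset.union_comm, hT, Finset.sdiff_union_inter]
  have hmem := extProj_mem_extN (X := Finset.Icc 1 n ∪ F) hφ hS hspan Finset.subset_union_left hy
  obtain ⟨h, hh, hcoef⟩ := exists_coeff_of_mem_extN hspan hdT r hmem
  have hGT : ∀ G ⊆ Finset.Icc 1 n, G ∪ T ⊆ Finset.Icc 1 n ∪ F := fun G hG =>
    Finset.union_subset_union hG Finset.sdiff_subset
  have hd : ∀ {G}, G ⊆ Finset.Icc 1 n → Disjoint G T := fun hG =>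
    (hdT.mono_right hG).symm
  refine lead_of_extCoeff hb hspan hh (fun h0 => hF ?_) fun b' hb' h0 hne => ?_
  · have h1 := hcoef _ Finset.inter_subset_right hr.symm
    rw [hbF] at h0
    rwa [h0, mul_zero, extCoeff_extProj (hGT _ Finset.inter_subset_right), hFT] at h1
  · have hb'n := supp_subset_Icc hb'
    have hcard : (supp b').card = r := (card_supp hb'.1).trans hb'.2.2.2
    have h1 := hcoef _ hb'n hcard
    rw [extCoeff_extProj (hGT _ hb'n)] at h1
    have h2 : extCoeff K (supp b' ∪ T) y ≠ 0 :=
      h1 ▸ mul_ne_zero (extCoeff_eMon_mul_eMon_ne_zero (hd hb'n).symm) h0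
    have h3 : supp b' ∪ T ≠ F := by
      intro h3
      apply hne
      apply supp_injOn hb' hb
      rw [hbF, ← h3, Finset.union_inter_distrib_right, Finset.disjoint_iff_inter_eq_empty.1 hdT,
        Finset.union_empty, Finset.inter_eq_left.2 hb'n]
    have h4 := hlt _ h2 h3
    rw [← revLexLT_supp_iff hb hb', hbF]
    rw [← hFT] at h4
    exact revLexLT_of_union (hd hb'n) (hd Finset.inter_subset_right) hcard h4

theorem extInitialIdeal_map_eq (hv : SignComm K v 1)
    (hφ : ∀ j ∈ Finset.Icc 1 n, φ (extVar K j) = v j)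
    (hspan : spanIcc K v 1 n = spanIcc K (extVar K) 1 n) (hS : ∀ F ∈ S, ∀ G ⊆ F, G ∈ S)
    (hlead : ∀ r, ∀ b ∈ Vn 1 n r, (Lead (Jd K v n S r) (extVar K) 1 n b ↔ supp b ∉ Sgm)) :
    extInitialIdeal K (Ideal.map φ (extFaceIdeal K (Finset.Icc 1 n) S)) =
      extFaceIdeal K (Finset.Icc 1 n) Sgm := by
  apply le_antisymm
  · refine Ideal.span_le.2 ?_
    rintro _ ⟨y, hy, F, rfl, hF, hlt⟩
    obtain ⟨r, b, hb, hbF, h⟩ := lead_of_mem_map hφ hspan hS hy hF hlt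
    exact eMon_mem_extFaceIdeal (hbF ▸ (hlead r b hb).1 h)
  · refine Ideal.span_le.2 ?_
    rintro _ ⟨F, hFn, hFS, rfl⟩
    obtain ⟨b, hb, hbF, rfl⟩ := exists_supp_eq hFn
    obtain ⟨y, hy, w, hw, hyw⟩ := mem_sup.1 ((hlead _ b hb).2 hFS)
    rw [mp_extVar hb.1] at hyw
    have hirr : ¬ RevLexLT (supp b) (supp b) := by
      rintro (h | ⟨-, k, hk, hk', -⟩)
      exacts [lt_irrefl _ h, hk' hk]
    have hy' : y = eMon K (supp b) - w := eq_sub_of_add_eq hyw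
    refine Ideal.subset_span ⟨y, Jd_le_map hv hφ _ hy, supp b, rfl, ?_, fun G hG hne => ?_⟩
    · have h0 : extCoeff K (supp b) w = 0 := by
        by_contra h
        exact hirr (revLexLT_of_extCoeff_ne hb hw h)
      rw [hy', map_sub, h0, sub_zero, extCoeff_eMon_self]
      exact one_ne_zero
    · rw [hy', map_sub, extCoeff_eMon_of_ne hne, zero_sub, neg_ne_zero] at hG
      exact revLexLT_of_extCoeff_ne hb hw hG

theorem extAlgMap_extVar {V : Finset ℕ} (M : Matrix (Fin V.card) (Fin V.card) K) {j : ℕ}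
    (hj : j ∈ V) : extAlgMap K V M (extVar K j) =
      ∑ a : Fin V.card, M a ((V.orderIsoOfFin rfl).symm ⟨j, hj⟩) •
        extVar K (V.orderIsoOfFin rfl a : V) := by
  rw [extAlgMap, ExteriorAlgebra.lift_ι_apply]
  have h : extLinMap K V M (Pi.single j 1) = ∑ a : Fin V.card,
      M a ((V.orderIsoOfFin rfl).symm ⟨j, hj⟩) •
        (Pi.single ((V.orderIsoOfFin rfl a : V) : ℕ) (1 : K) : ℕ → K) := by
    ext k
    rw [Finset.sum_apply]
    simp only [extLinMap, LinearMap.coe_mk, AddHom.coe_mk, Pi.smul_apply, Pi.single_apply,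
      smul_eq_mul, mul_ite, mul_one, mul_zero]
    split_ifs with hk
    · rw [Finset.sum_eq_single ((V.orderIsoOfFin rfl).symm ⟨j, hj⟩),
        Finset.sum_eq_single ((V.orderIsoOfFin rfl).symm ⟨k, hk⟩)]
      · simp
      · intro a _ ha
        rw [if_neg]
        intro h
        exact ha ((OrderIso.eq_symm_apply _).2 (Subtype.ext h.symm))
      · simp
      · intro a _ ha
        rw [if_neg]
        intro h
        exact ha ((OrderIso.eq_symm_apply _).2 (Subtype.ext h))
      · simp
    · exact absurd (by assumption : k = j) fun h => hk (h ▸ hj)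
    · refine (Finset.sum_eq_zero fun a _ => if_neg fun h => hk ?_).symm
      exact h ▸ (V.orderIsoOfFin rfl a).2
  rw [LinearMap.comp_apply, h, map_sum]
  simp only [map_smul]

theorem orderIsoOfFin_Icc {n : ℕ} (a : Fin (Finset.Icc 1 n).card) :
    ((Finset.orderIsoOfFin (Finset.Icc 1 n) rfl a : Finset.Icc 1 n) : ℕ) = a + 1 := by
  have h : (fun i : Fin (Finset.Icc 1 n).card => (i : ℕ) + 1) =
      Finset.orderEmbOfFin (Finset.Icc 1 n) rfl := by
    refine Finset.orderEmbOfFin_unique rfl (fun x => ?_) fun x y h => ?_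
    · have := x.2.trans_eq (Nat.card_Icc 1 n)
      exact Finset.mem_Icc.2 ⟨by omega, by omega⟩
    · exact Nat.succ_lt_succ h
  exact (congrFun h a).symm

theorem extAlgMap_eq_colForm (M : Matrix (Fin (Finset.Icc 1 n).card) (Fin (Finset.Icc 1 n).card) K)
    {j : ℕ} (hj : j ∈ Finset.Icc 1 n) : extAlgMap K (Finset.Icc 1 n) M (extVar K j) =
      colForm (extVar K) (Finset.Icc 1 n).card (fun q => M q.1 q.2) j := by
  have hj' := Finset.mem_Icc.1 hj
  rw [extAlgMap_extVar M hj, colForm, dif_pos ⟨hj'.1, by simpa using hj'.2⟩]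
  refine Finset.sum_congr rfl fun a _ => ?_
  rw [orderIsoOfFin_Icc]
  congr 2
  rw [OrderIso.symm_apply_eq]
  ext
  rw [orderIsoOfFin_Icc]
  simp; omega

theorem signComm_colForm {N : ℕ} (y : Fin N × Fin N → K) :
    SignComm K (colForm (extVar K) N y) 1 := by
  have h : colForm (extVar K) N y = fun j => ExteriorAlgebra.ι K (if h : 1 ≤ j ∧ j ≤ N then
      ∑ a : Fin N, y (a, ⟨j - 1, by omega⟩) • (Pi.single (a + 1 : ℕ) (1 : K) : ℕ → K) else 0) := by
    ext1 j
    unfold colForm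
    split_ifs
    · rw [map_sum]
      simp only [map_smul]
    · rw [map_zero]
  rw [h]
  exact signComm_ι _

theorem isExteriorShift_bd [Infinite K] {n d M e c : ℕ} {S : Set (Finset ℕ)}
    {W : Set (List ℕ)} (hn : n = M + d) (hM : 1 ≤ M) (hd : d + 2 = 2 * e + c) (hc : c ≤ 1)
    (hW : Good 1 M e W) (hstd : ∀ r, ∀ b ∈ Vn 1 n r, (StdB M e d W b ↔ supp b ∈ S)) :
    IsExteriorShift K (Finset.Icc 1 n) (bd d (fac n 0 '' W)) S := by
  have hcard : (Finset.Icc 1 n).card = n := by simp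
  have hx : SignComm K (extVar K) 1 := signComm_ι _
  obtain ⟨p, hp, hgen⟩ := gen_allCond (K := K) hx (hcard.trans hn) hd hM hW
  refine ⟨p, hp, fun Q hQ hev => ?_⟩
  have hgen' := hgen _ hev
  beta_reduce at hgen'
  have hspan := spanIcc_colForm (x := extVar K) hQ
  have hv := signComm_colForm fun q => Q q.1 q.2
  have hφ := fun j (hj : j ∈ Finset.Icc 1 n) => extAlgMap_eq_colForm Q hj
  generalize colForm (extVar K) (Finset.Icc 1 n).card (fun q => Q q.1 q.2) = v at *
  rw [hcard] at hgen' hspan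
  refine extInitialIdeal_map_eq hv hφ hspan bd_down fun r b hb => ?_
  rw [← hstd r b hb]
  exact lead_iff hx hv hspan linearIndepOn_mp_extVar hc hn hd hM hW hgen' hb

end Squeezed

/-- Theorem 1.4 / `main2`. Let `Δ` denote either exterior or symmetric
algebraic shifting, and let `Sgm` be a `(d-1)`-dimensional pure shifted complex on `[n]`
with `h_i(Sgm) = h_{d-i}(Sgm)` for all `i` and `Sgm ⊆ Δˢ(C(n,d)) = Δ(n,d)`. Then there is a
squeezed `(d-1)`-sphere `Γ = S_d(U)` with `Δ(Γ) = Sgm`. -/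
theorem stmt1 (n d : ℕ) (hd : 0 < d) (hdn : d < n) (Sgm : Set (Finset ℕ))
    (hΓ : SimplicialComplexOn (Finset.Icc 1 n) Sgm)
    (hpure : PureComplex Sgm)
    (hshift : ShiftedComplex (Finset.Icc 1 n) Sgm)
    (hdim : sdim Sgm = (d : ℤ) - 1)
    (hsym : ∀ i ≤ d, hvec d Sgm i = hvec d Sgm (d - i))
    (hsub : Sgm ⊆ DeltaC n d) :
    (∀ (K : Type) [Field K], Infinite K →
      ∃ U : Set (Multiset ℕ), IsShiftedOrderIdeal (n - d - 1) U ∧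
        (∀ u ∈ U, 2 * Multiset.card u ≤ d + 1) ∧
        IsExteriorShift K (Finset.Icc 1 n) (squeezedSphere n d U) Sgm) ∧
    (∀ (K : Type) [Field K], CharZero K →
      ∃ U : Set (Multiset ℕ), IsShiftedOrderIdeal (n - d - 1) U ∧
        (∀ u ∈ U, 2 * Multiset.card u ≤ d + 1) ∧
        IsSymmetricShift K n (squeezedSphere n d U) Sgm) := by
  obtain ⟨M, rfl⟩ : ∃ M, n = M + d := ⟨n - d, by omega⟩
  have hM : 1 ≤ M := by omega
  have hde : d + 2 = 2 * (d / 2 + 1) + d % 2 := by omega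
  have hc : d % 2 ≤ 1 := by omega
  obtain ⟨U, W, hU, hUd, hW, hsph, hstd⟩ :=
    Squeezed.exists_squeezed rfl hM hd hde hc hΓ hpure hshift hdim hsym hsub
  refine ⟨fun K _ _ => ⟨U, hU, hUd, ?_⟩, fun K _ _ => ⟨U, hU, hUd, ?_⟩⟩
  · rw [hsph]
    exact Squeezed.isExteriorShift_bd rfl hM hde hc hW hstd
  · rw [hsph]
    have : Infinite K := Infinite.of_injective _ (Nat.cast_injective (R := K))
    exact Squeezed.isSymmetricShift_bd rfl hM hde hc hW
      (Squeezed.pureShifted_of (by omega) hΓ hpure hshift hdim) hstd
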